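/- Let μ be a Gibbs measure for the Gauss map associated to a locally Hölder potential φ ≤ 0 with pressure P(φ) = 0 and 𝓛_φ1 = 1. Assume that μ satisfies the polynomial tail condition (there exists δ > 0 such that μ({x : a₁(x) ≥ n}) = O(n^{−δ}) as n → ∞) and that the Hausdorff dimension dim μ = h_μ/λ_μ is strictly greater than 1/2. Then μ is a Rajchman measure with polynomially decaying Fourier transform: there exists η > 0 such that |μ̂(ξ)| = O(|ξ|^{−η}) as |ξ| → ∞. -/

import Mathlib

open MeasureTheory Filter Set Topology
open scoped ENNReal NNReal Classical Real

noncomputable section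

/-- The Gauss map `T(x) = 1/x mod 1`. -/
def gaussMap (x : ℝ) : ℝ := Int.fract x⁻¹

/-- The space `X = [0,1] ∖ ℚ` of irrational numbers in the unit interval. -/
def gaussSet : Set ℝ := {x | x ∈ Set.Icc (0:ℝ) 1 ∧ Irrational x}

/-- The first continued fraction digit `a₁(x) = ⌊1/x⌋`. -/
def cfDigit1 (x : ℝ) : ℕ := ⌊x⁻¹⌋₊

/-- The `(i+1)`-th continued fraction digit `a_{i+1}(x) = a₁(Tⁱ x)`. -/
def cfDigit (i : ℕ) (x : ℝ) : ℕ := cfDigit1 (gaussMap^[i] x)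

/-- The inverse branch `T_a(x) = 1/(x+a)` of the Gauss map. -/
def invBranch1 (a : ℕ) (x : ℝ) : ℝ := (x + (a : ℝ))⁻¹

/-- The composed inverse branch `T_𝐚 = T_{a₁} ∘ ⋯ ∘ T_{aₙ}` for `𝐚 = [a₁,…,aₙ]`. -/
def invBranch (l : List ℕ) (x : ℝ) : ℝ := l.foldr invBranch1 x

/-- The cylinder set `I_𝐚` of points of `X` whose first digits are given by `𝐚`. -/
def cylinder (l : List ℕ) : Set ℝ :=
  {x | x ∈ gaussSet ∧ ∀ i : Fin l.length, cfDigit i.1 x = l.get i}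

/-- The Birkhoff sum `S_n φ = ∑_{k<n} φ ∘ T^k`. -/
def birkhoff (φ : ℝ → ℝ) (n : ℕ) (x : ℝ) : ℝ :=
  ∑ k ∈ Finset.range n, φ (gaussMap^[k] x)

/-- The pair `(pₙ(𝐚), qₙ(𝐚))` of numerator and denominator (continuant) of the
finite continued fraction `[a₁,…,aₙ] = pₙ/qₙ`. -/
def contPQ : List ℕ → ℕ × ℕ
  | [] => (0, 1)
  | a :: l => ((contPQ l).2, a * (contPQ l).2 + (contPQ l).1)

/-- The continuant `qₙ(𝐚)`, the denominator of `[a₁,…,aₙ]` in lowest terms. -/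
def contQ (l : List ℕ) : ℕ := (contPQ l).2

/-- Words of length `n` with digits in `ℕ = {1,2,…}`. -/
def Word (n : ℕ) : Type := {l : List ℕ // l.length = n ∧ ∀ a ∈ l, 0 < a}

/-- The periodic point `𝐚^∞` with periodic continued fraction expansion repeating `𝐚`. -/
def periodicPoint (l : List ℕ) : ℝ :=
  limUnder atTop fun k : ℕ => invBranch (List.flatten (List.replicate k l)) (1/2 : ℝ)

/-- The `n`-th partition sum `∑_{𝐚 ∈ ℕⁿ} exp(S_nφ(𝐚^∞))` appearing in the pressure. -/
def partSum (φ : ℝ → ℝ) (n : ℕ) : ℝ≥0∞ :=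
  ∑' l : Word n, ENNReal.ofReal (Real.exp (birkhoff φ n (periodicPoint l.1)))

/-- `φ` has (finite) pressure `P(φ) = p`, i.e. `(1/n) log ∑_{𝐚∈ℕⁿ} exp(S_nφ(𝐚^∞)) → p`. -/
def HasPressure (φ : ℝ → ℝ) (p : ℝ) : Prop :=
  (∀ n : ℕ, 0 < n → partSum φ n ≠ ⊤) ∧
    Tendsto (fun n : ℕ => Real.log (partSum φ n).toReal / (n : ℝ)) atTop (𝓝 p)

/-- The pressure of `φ` is finite: `P(φ) < ∞`. -/
def PressureFinite (φ : ℝ → ℝ) : Prop := ∃ p : ℝ, HasPressure φ p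

/-- `φ` is locally Hölder: oscillation on `n`-cylinders decays geometrically. -/
def LocHolder (φ : ℝ → ℝ) : Prop :=
  ∃ C > (0:ℝ), ∃ θ ∈ Set.Ioo (0:ℝ) 1, ∀ l : List ℕ, l ≠ [] → (∀ a ∈ l, 0 < a) →
    ∀ x ∈ cylinder l, ∀ y ∈ cylinder l, |φ x - φ y| ≤ C * θ ^ l.length

/-- The normalization `𝓛_φ 1 = 1` of the Ruelle transfer operator of `φ`. -/
def TransferNormalized (φ : ℝ → ℝ) : Prop :=
  ∀ x ∈ gaussSet, ∑' a : ℕ+, Real.exp (φ (invBranch1 (a : ℕ) x)) = 1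

/-- `μ` is invariant under the Gauss map. -/
def GaussInvariant (μ : Measure ℝ) : Prop :=
  ∀ s : Set ℝ, MeasurableSet s → μ (gaussMap ⁻¹' s) = μ s

/-- The Gibbs property for the potential `φ` (with `P(φ) = 0`):
`C⁻¹ e^{S_nφ(T_𝐚 x)} ≤ μ(I_𝐚) ≤ C e^{S_nφ(T_𝐚 x)}`. -/
def IsGibbs (φ : ℝ → ℝ) (μ : Measure ℝ) : Prop :=
  ∃ C : ℝ, 1 ≤ C ∧ ∀ l : List ℕ, l ≠ [] → (∀ a ∈ l, 0 < a) → ∀ x ∈ gaussSet,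
    C⁻¹ * Real.exp (birkhoff φ l.length (invBranch l x)) ≤ (μ (cylinder l)).toReal ∧
      (μ (cylinder l)).toReal ≤ C * Real.exp (birkhoff φ l.length (invBranch l x))

/-- The Kolmogorov–Sinai entropy of `μ`:
`h = lim (1/n) ∑_{𝐚∈ℕⁿ} -μ(I_𝐚) log μ(I_𝐚)`. -/
def HasEntropy (μ : Measure ℝ) (h : ℝ) : Prop :=
  Tendsto (fun n : ℕ => (∑' l : Word n, Real.negMulLog (μ (cylinder l.1)).toReal) / (n : ℝ))
    atTop (𝓝 h)

/-- `log |T'| (x) = log (1/x²)` for the Gauss map. -/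
def logAbsDerivGauss (x : ℝ) : ℝ := Real.log (1 / x ^ 2)

/-- The observable `ψ = -log |T'|`. -/
def gaussPsi (x : ℝ) : ℝ := -Real.log (1 / x ^ 2)

/-- The Lyapunov exponent `λ_μ = ∫ log|T'| dμ`. -/
def lyapunov (μ : Measure ℝ) : ℝ := ∫ x, logAbsDerivGauss x ∂μ

/-- The polynomial tail condition `μ({x : a₁(x) ≥ n}) = O(n^{-δ})`. -/
def PolyTail (μ : Measure ℝ) : Prop :=
  ∃ δ > (0:ℝ), ∃ K : ℝ, ∀ n : ℕ, 0 < n →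
    (μ {x | x ∈ gaussSet ∧ n ≤ cfDigit1 x}).toReal ≤ K * (n : ℝ) ^ (-δ)

/-- The Fourier transform `μ̂(ξ) = ∫ e^{-2πiξx} dμ(x)`. -/
def muFourier (μ : Measure ℝ) (ξ : ℝ) : ℂ :=
  ∫ x, Complex.exp (-(2 * Real.pi * ξ * x : ℝ) * Complex.I) ∂μ

/-- A sequence `u` equidistributes modulo 1. -/
def EquidistributedMod1 (u : ℕ → ℝ) : Prop :=
  ∀ a b : ℝ, 0 ≤ a → a ≤ b → b ≤ 1 →
    Tendsto (fun N : ℕ =>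
        (((Finset.range N).filter fun k => Int.fract (u k) ∈ Set.Ico a b).card : ℝ) / (N : ℝ))
      atTop (𝓝 (b - a))

/-- The set `B(𝒜)` of `𝒜`-badly approximable numbers: all digits lie in `𝒜`. -/
def badSet (A : Finset ℕ) : Set ℝ := {x | x ∈ gaussSet ∧ ∀ i : ℕ, cfDigit i x ∈ A}

/-- Locally Hölder on the subsystem `B(𝒜)`. -/
def LocHolderOn (A : Finset ℕ) (φ : ℝ → ℝ) : Prop :=
  ∃ C > (0:ℝ), ∃ θ ∈ Set.Ioo (0:ℝ) 1, ∀ l : List ℕ, l ≠ [] → (∀ a ∈ l, a ∈ A) →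
    ∀ x ∈ cylinder l ∩ badSet A, ∀ y ∈ cylinder l ∩ badSet A,
      |φ x - φ y| ≤ C * θ ^ l.length

/-- The Gibbs property for the Gauss map restricted to `B(𝒜)`. -/
def IsGibbsOn (A : Finset ℕ) (φ : ℝ → ℝ) (μ : Measure ℝ) : Prop :=
  ∃ C : ℝ, 1 ≤ C ∧ ∀ l : List ℕ, l ≠ [] → (∀ a ∈ l, a ∈ A) → ∀ x ∈ badSet A,
    C⁻¹ * Real.exp (birkhoff φ l.length (invBranch l x)) ≤ (μ (cylinder l)).toReal ∧
      (μ (cylinder l)).toReal ≤ C * Real.exp (birkhoff φ l.length (invBranch l x))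

/-- The `n`-regular set `A_n(ε)` of the large deviation decomposition. -/
def regSet (φ : ℝ → ℝ) (lam s ε : ℝ) (n : ℕ) : Set ℝ :=
  {x | |birkhoff gaussPsi n x / (n : ℝ) + lam| < ε ∧
       |birkhoff φ n x / birkhoff gaussPsi n x - s| < ε}

/-- The collection `𝓡ₙ` of `n`-regular words. -/
def regWords (φ : ℝ → ℝ) (lam s ε : ℝ) (n : ℕ) : Set (List ℕ) :=
  {l | l.length = n ∧ (∀ a ∈ l, 0 < a) ∧
       ∀ k : ℕ, n / 2 ≤ k → k ≤ n → cylinder (l.take k) ⊆ regSet φ lam s ε k}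

/-- The union `Rₙ` of the `n`-regular cylinders. -/
def regUnion (φ : ℝ → ℝ) (lam s ε : ℝ) (n : ℕ) : Set ℝ :=
  ⋃ l ∈ regWords φ lam s ε n, cylinder l

end

/-! ### Continued fraction combinatorics -/

/-- All digits of the word are positive. -/
def PosWord (l : List ℕ) : Prop := ∀ a ∈ l, 0 < a

theorem PosWord.nil : PosWord [] := by simp [PosWord]

theorem posWord_cons {a : ℕ} {l : List ℕ} : PosWord (a :: l) ↔ 0 < a ∧ PosWord l := by
  simp [PosWord]

theorem posWord_append {l m : List ℕ} : PosWord (l ++ m) ↔ PosWord l ∧ PosWord m := by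
  simp only [PosWord, List.mem_append]
  exact ⟨fun h => ⟨fun a ha => h a (.inl ha), fun a ha => h a (.inr ha)⟩,
    fun h a ha => ha.elim (h.1 a) (h.2 a)⟩

theorem PosWord.reverse {l : List ℕ} (h : PosWord l) : PosWord l.reverse := by
  intro a ha; exact h a (List.mem_reverse.1 ha)

theorem gaussSet_pos {x : ℝ} (hx : x ∈ gaussSet) : 0 < x :=
  lt_of_le_of_ne hx.1.1 fun h => hx.2.ne_zero h.symm

theorem gaussSet_lt_one {x : ℝ} (hx : x ∈ gaussSet) : x < 1 :=
  lt_of_le_of_ne hx.1.2 hx.2.ne_one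

theorem gaussMap_mem {x : ℝ} (hx : x ∈ gaussSet) : gaussMap x ∈ gaussSet := by
  refine ⟨⟨Int.fract_nonneg _, (Int.fract_lt_one _).le⟩, ?_⟩
  have : Irrational x⁻¹ := by rw [irrational_inv_iff]; exact hx.2
  exact this.sub_intCast _

theorem gaussMap_iterate_mem {x : ℝ} (hx : x ∈ gaussSet) (n : ℕ) : gaussMap^[n] x ∈ gaussSet := by
  induction n generalizing x with
  | zero => exact hx
  | succ n ih => exact ih (gaussMap_mem hx)

theorem cfDigit1_pos {x : ℝ} (hx : x ∈ gaussSet) : 0 < cfDigit1 x := by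
  have := (one_lt_inv₀ (gaussSet_pos hx)).2 (gaussSet_lt_one hx)
  exact Nat.floor_pos.2 this.le

theorem invBranch1_cfDigit1 {x : ℝ} (hx : x ∈ gaussSet) :
    invBranch1 (cfDigit1 x) (gaussMap x) = x := by
  have h0 : 0 ≤ x⁻¹ := inv_nonneg.2 hx.1.1
  have : gaussMap x + (cfDigit1 x : ℝ) = x⁻¹ := by
    unfold gaussMap cfDigit1
    rw [natCast_floor_eq_intCast_floor h0]
    exact Int.fract_add_floor _
  rw [invBranch1, this, inv_inv]

theorem invBranch1_pos {a : ℕ} (ha : 0 < a) {x : ℝ} (hx : 0 ≤ x) : 0 < invBranch1 a x := by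
  unfold invBranch1; positivity

theorem invBranch1_mem {a : ℕ} (ha : 0 < a) {x : ℝ} (hx : x ∈ gaussSet) :
    invBranch1 a x ∈ gaussSet := by
  have h1 : (1 : ℝ) ≤ a := by exact_mod_cast ha
  refine ⟨⟨(invBranch1_pos ha hx.1.1).le, inv_le_one_of_one_le₀ (by linarith [hx.1.1])⟩, ?_⟩
  unfold invBranch1
  rw [irrational_inv_iff]
  exact hx.2.add_natCast a

theorem gaussMap_invBranch1 (a : ℕ) {x : ℝ} (hx : x ∈ gaussSet) :
    gaussMap (invBranch1 a x) = x := by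
  unfold gaussMap invBranch1
  rw [inv_inv, Int.fract_add_natCast, Int.fract_eq_self]
  exact ⟨hx.1.1, gaussSet_lt_one hx⟩

theorem cfDigit1_invBranch1 (a : ℕ) {x : ℝ} (hx : x ∈ gaussSet) :
    cfDigit1 (invBranch1 a x) = a := by
  unfold cfDigit1 invBranch1
  rw [inv_inv, Nat.floor_add_natCast hx.1.1, Nat.floor_eq_zero.2 (gaussSet_lt_one hx), zero_add]

theorem cylinder_nil : cylinder [] = gaussSet := by
  ext x; simp [_root_.cylinder]

theorem mem_cylinder_cons {a : ℕ} {l : List ℕ} {x : ℝ} :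
    x ∈ cylinder (a :: l) ↔ x ∈ gaussSet ∧ cfDigit1 x = a ∧ gaussMap x ∈ cylinder l := by
  have key : (∀ i : Fin (a :: l).length, cfDigit i.1 x = (a :: l).get i) ↔
      cfDigit1 x = a ∧ ∀ i : Fin l.length, cfDigit i.1 (gaussMap x) = l.get i :=
    Fin.forall_fin_succ
  constructor
  · rintro ⟨hx, h⟩
    exact ⟨hx, (key.1 h).1, gaussMap_mem hx, (key.1 h).2⟩
  · rintro ⟨hx, h1, h2⟩
    exact ⟨hx, key.2 ⟨h1, h2.2⟩⟩

theorem invBranch_cons (a : ℕ) (l : List ℕ) (x : ℝ) :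
    invBranch (a :: l) x = invBranch1 a (invBranch l x) := rfl

theorem invBranch_nil (x : ℝ) : invBranch [] x = x := rfl

theorem invBranch_append (l m : List ℕ) (x : ℝ) :
    invBranch (l ++ m) x = invBranch l (invBranch m x) := by
  simp [invBranch, List.foldr_append]

theorem invBranch_mem_cylinder {l : List ℕ} (hl : PosWord l) {x : ℝ} (hx : x ∈ gaussSet) :
    invBranch l x ∈ cylinder l := by
  induction l with
  | nil => rw [cylinder_nil]; exact hx
  | cons a l ih =>
    rw [posWord_cons] at hl
    have := ih hl.2
    rw [invBranch_cons, mem_cylinder_cons, gaussMap_invBranch1 a this.1]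
    exact ⟨invBranch1_mem hl.1 this.1, cfDigit1_invBranch1 a this.1, this⟩

theorem invBranch_mem {l : List ℕ} (hl : PosWord l) {x : ℝ} (hx : x ∈ gaussSet) :
    invBranch l x ∈ gaussSet := (invBranch_mem_cylinder hl hx).1

theorem gaussMap_iterate_invBranch {l : List ℕ} (hl : PosWord l) {x : ℝ} (hx : x ∈ gaussSet) :
    gaussMap^[l.length] (invBranch l x) = x := by
  induction l with
  | nil => rfl
  | cons a l ih =>
    rw [posWord_cons] at hl
    rw [List.length_cons, Function.iterate_succ_apply, invBranch_cons,
      gaussMap_invBranch1 a (invBranch_mem hl.2 hx), ih hl.2]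

theorem invBranch_gaussMap_iterate {l : List ℕ} {x : ℝ} (hx : x ∈ cylinder l) :
    invBranch l (gaussMap^[l.length] x) = x := by
  induction l generalizing x with
  | nil => rfl
  | cons a l ih =>
    rw [mem_cylinder_cons] at hx
    rw [List.length_cons, Function.iterate_succ_apply, invBranch_cons, ih hx.2.2, ← hx.2.1,
      invBranch1_cfDigit1 hx.1]

theorem mem_cylinder_append {l m : List ℕ} {x : ℝ} :
    x ∈ cylinder (l ++ m) ↔ x ∈ cylinder l ∧ gaussMap^[l.length] x ∈ cylinder m := by
  induction l generalizing x with
  | nil =>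
    simp only [List.nil_append, cylinder_nil, List.length_nil, Function.iterate_zero, id]
    exact ⟨fun h => ⟨h.1, h⟩, fun h => h.2⟩
  | cons a l ih =>
    rw [List.cons_append, mem_cylinder_cons, mem_cylinder_cons, ih, List.length_cons,
      Function.iterate_succ_apply]
    tauto

/-- The word formed by the first `n` digits of `x`. -/
noncomputable def cfWord (n : ℕ) (x : ℝ) : List ℕ := (List.range n).map fun i => cfDigit i x

theorem cfWord_length (n : ℕ) (x : ℝ) : (cfWord n x).length = n := by simp [cfWord]

theorem cfWord_succ (n : ℕ) (x : ℝ) : cfWord (n + 1) x = cfDigit1 x :: cfWord n (gaussMap x) := by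
  simp only [cfWord, List.range_succ_eq_map, List.map_cons, List.map_map]
  rfl

theorem cfWord_add (m n : ℕ) (x : ℝ) :
    cfWord (m + n) x = cfWord m x ++ cfWord n (gaussMap^[m] x) := by
  induction m generalizing x with
  | zero => simp [cfWord]
  | succ m ih =>
    rw [show m + 1 + n = (m + n) + 1 by omega, cfWord_succ, cfWord_succ, ih]
    rfl

theorem cfWord_pos {x : ℝ} (hx : x ∈ gaussSet) (n : ℕ) : PosWord (cfWord n x) := by
  induction n generalizing x with
  | zero => simp [cfWord, PosWord]
  | succ n ih => rw [cfWord_succ, posWord_cons]; exact ⟨cfDigit1_pos hx, ih (gaussMap_mem hx)⟩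

theorem mem_cylinder_iff {l : List ℕ} {x : ℝ} :
    x ∈ cylinder l ↔ x ∈ gaussSet ∧ cfWord l.length x = l := by
  induction l generalizing x with
  | nil => simp [cylinder_nil, cfWord]
  | cons a l ih =>
    rw [mem_cylinder_cons, ih, List.length_cons, cfWord_succ, List.cons.injEq]
    exact ⟨fun h => ⟨h.1, h.2.1, h.2.2.2⟩, fun h => ⟨h.1, h.2.1, gaussMap_mem h.1, h.2.2⟩⟩

theorem mem_cylinder_cfWord {x : ℝ} (hx : x ∈ gaussSet) (n : ℕ) : x ∈ cylinder (cfWord n x) := by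
  rw [mem_cylinder_iff, cfWord_length]; exact ⟨hx, rfl⟩

theorem posWord_of_mem_cylinder {l : List ℕ} {x : ℝ} (hx : x ∈ cylinder l) : PosWord l := by
  rw [mem_cylinder_iff] at hx
  rw [← hx.2]; exact cfWord_pos hx.1 _

theorem cylinder_disjoint {l m : List ℕ} (hlen : l.length = m.length) (h : l ≠ m) :
    Disjoint (cylinder l) (cylinder m) := by
  rw [Set.disjoint_left]
  intro x hx hy
  rw [mem_cylinder_iff] at hx hy
  exact h (by rw [← hx.2, ← hy.2, hlen])

/-! ### Continuants -/

/-- The rows of the matrix product attached to a word, started at the row `(u, v)`. -/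
def cfRow (u v : ℕ) : List ℕ → ℕ × ℕ
  | [] => (u, v)
  | a :: l => ((cfRow u v l).2, a * (cfRow u v l).2 + (cfRow u v l).1)

/-- The coefficient `p` in `T_l x = (p + p' x) / (q + q' x)`. -/
def cfP (l : List ℕ) : ℕ := (cfRow 0 1 l).1
/-- The coefficient `q` in `T_l x = (p + p' x) / (q + q' x)`. -/
def cfQ (l : List ℕ) : ℕ := (cfRow 0 1 l).2
/-- The coefficient `p'` in `T_l x = (p + p' x) / (q + q' x)`. -/
def cfP' (l : List ℕ) : ℕ := (cfRow 1 0 l).1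
/-- The coefficient `q'` in `T_l x = (p + p' x) / (q + q' x)`. -/
def cfQ' (l : List ℕ) : ℕ := (cfRow 1 0 l).2

@[simp] theorem cfP_nil : cfP [] = 0 := rfl
@[simp] theorem cfQ_nil : cfQ [] = 1 := rfl
@[simp] theorem cfP'_nil : cfP' [] = 1 := rfl
@[simp] theorem cfQ'_nil : cfQ' [] = 0 := rfl
@[simp] theorem cfP_cons (a : ℕ) (l : List ℕ) : cfP (a :: l) = cfQ l := rfl
@[simp] theorem cfQ_cons (a : ℕ) (l : List ℕ) : cfQ (a :: l) = a * cfQ l + cfP l := rfl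
@[simp] theorem cfP'_cons (a : ℕ) (l : List ℕ) : cfP' (a :: l) = cfQ' l := rfl
@[simp] theorem cfQ'_cons (a : ℕ) (l : List ℕ) : cfQ' (a :: l) = a * cfQ' l + cfP' l := rfl

theorem cfQ_pos {l : List ℕ} (hl : PosWord l) : 0 < cfQ l := by
  induction l with
  | nil => simp
  | cons a l ih =>
    rw [posWord_cons] at hl
    have := Nat.mul_pos hl.1 (ih hl.2)
    rw [cfQ_cons]; omega

theorem cfQ'_le_cfQ_and_add_le_add {l : List ℕ} (hl : PosWord l) :
    cfQ' l ≤ cfQ l ∧ cfQ' l + cfP' l ≤ cfQ l + cfP l := by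
  induction l with
  | nil => simp
  | cons a l ih =>
    rw [posWord_cons] at hl
    obtain ⟨h1, h2⟩ := ih hl.2
    obtain ⟨b, rfl⟩ : ∃ b, a = b + 1 := ⟨a - 1, by omega⟩
    have h3 : b * cfQ' l ≤ b * cfQ l := Nat.mul_le_mul_left _ h1
    simp only [cfQ_cons, cfQ'_cons, cfP_cons, cfP'_cons, add_mul, one_mul]
    omega

theorem cfQ'_le_cfQ {l : List ℕ} (hl : PosWord l) : cfQ' l ≤ cfQ l :=
  (cfQ'_le_cfQ_and_add_le_add hl).1

theorem cfDet (l : List ℕ) :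
    (cfP l : ℝ) * cfQ' l - cfP' l * cfQ l = (-1) ^ (l.length + 1) := by
  induction l with
  | nil => simp
  | cons a l ih =>
    simp only [cfQ_cons, cfQ'_cons, cfP_cons, cfP'_cons, List.length_cons]
    push_cast
    rw [pow_succ, ← ih]; ring

theorem cfDen_pos {l : List ℕ} (hl : PosWord l) {x : ℝ} (hx : 0 ≤ x) :
    0 < (cfQ l : ℝ) + cfQ' l * x := by
  have : (0 : ℝ) < cfQ l := by exact_mod_cast cfQ_pos hl
  positivity

theorem cfQ_le_cfDen {l : List ℕ} {x : ℝ} (hx : 0 ≤ x) :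
    (cfQ l : ℝ) ≤ cfQ l + cfQ' l * x := by
  have : (0 : ℝ) ≤ cfQ' l * x := by positivity
  linarith

theorem cfDen_le {l : List ℕ} (hl : PosWord l) {x : ℝ} (hx1 : x ≤ 1) :
    (cfQ l : ℝ) + cfQ' l * x ≤ 2 * cfQ l := by
  have h : (cfQ' l : ℝ) ≤ cfQ l := by exact_mod_cast cfQ'_le_cfQ hl
  have h2 : (cfQ' l : ℝ) * x ≤ cfQ' l * 1 := by gcongr
  linarith

theorem invBranch_eq {l : List ℕ} (hl : PosWord l) {x : ℝ} (hx : 0 ≤ x) :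
    invBranch l x = (cfP l + cfP' l * x) / (cfQ l + cfQ' l * x) := by
  induction l with
  | nil => simp [invBranch]
  | cons a l ih =>
    have hd := cfDen_pos hl hx
    rw [posWord_cons] at hl
    have hd' := cfDen_pos hl.2 hx
    rw [invBranch_cons, invBranch1, ih hl.2]
    simp only [cfQ_cons, cfQ'_cons, cfP_cons, cfP'_cons, Nat.cast_add, Nat.cast_mul] at hd ⊢
    have hn := hd'.ne'
    rw [inv_eq_iff_eq_inv, inv_div, div_add' _ _ _ hn]
    congr 1
    ring

theorem invBranch_sub {l : List ℕ} (hl : PosWord l) {x y : ℝ} (hx : 0 ≤ x) (hy : 0 ≤ y) :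
    invBranch l x - invBranch l y =
      (-1) ^ l.length * (x - y) / ((cfQ l + cfQ' l * x) * (cfQ l + cfQ' l * y)) := by
  have h1 := cfDen_pos hl hx
  have h2 := cfDen_pos hl hy
  rw [invBranch_eq hl hx, invBranch_eq hl hy, div_sub_div _ _ h1.ne' h2.ne']
  congr 1
  have h3 := cfDet l
  rw [pow_succ] at h3
  linear_combination (y - x) * h3

theorem abs_invBranch_sub_le {l : List ℕ} (hl : PosWord l) {x y : ℝ} (hx : 0 ≤ x) (hy : 0 ≤ y) :
    |invBranch l x - invBranch l y| ≤ |x - y| / (cfQ l : ℝ) ^ 2 := by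
  have h0 : (0 : ℝ) < cfQ l := by exact_mod_cast cfQ_pos hl
  rw [invBranch_sub hl hx hy, abs_div, abs_mul, abs_pow, abs_neg, abs_one, one_pow, one_mul,
    abs_of_pos (mul_pos (cfDen_pos hl hx) (cfDen_pos hl hy)), sq]
  gcongr
  · exact cfQ_le_cfDen hx
  · exact cfQ_le_cfDen hy

theorem cfRow_append_singleton (l : List ℕ) (a : ℕ) :
    cfP (l ++ [a]) = a * cfP l + cfP' l ∧ cfQ (l ++ [a]) = a * cfQ l + cfQ' l ∧
    cfP' (l ++ [a]) = cfP l ∧ cfQ' (l ++ [a]) = cfQ l := by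
  induction l with
  | nil => simp
  | cons b l ih =>
    obtain ⟨h1, h2, h3, h4⟩ := ih
    simp only [List.cons_append, cfQ_cons, cfQ'_cons, cfP_cons, cfP'_cons, h1, h2, h3, h4]
    refine ⟨trivial, ?_, trivial, trivial⟩
    ring

theorem cfRow_reverse (l : List ℕ) :
    cfQ l.reverse = cfQ l ∧ cfQ' l.reverse = cfP l ∧ cfP l.reverse = cfQ' l ∧
      cfP' l.reverse = cfP' l := by
  induction l with
  | nil => simp
  | cons a l ih =>
    obtain ⟨h1, h2, h3, h4⟩ := ih
    obtain ⟨g1, g2, g3, g4⟩ := cfRow_append_singleton l.reverse a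
    rw [List.reverse_cons, g1, g2, g3, g4, h1, h2, h3, h4]
    simp

theorem cfQ_reverse (l : List ℕ) : cfQ l.reverse = cfQ l := (cfRow_reverse l).1

/-- The ratio `q' / q` of the last two continuants of a word. -/
noncomputable def cfRatio (l : List ℕ) : ℝ := cfQ' l / cfQ l

theorem cfRatio_nonneg (l : List ℕ) : 0 ≤ cfRatio l := by unfold cfRatio; positivity

theorem cfRatio_le_one {l : List ℕ} (hl : PosWord l) : cfRatio l ≤ 1 := by
  have h0 : (0 : ℝ) < cfQ l := by exact_mod_cast cfQ_pos hl
  rw [cfRatio, div_le_one h0]; exact_mod_cast cfQ'_le_cfQ hl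

theorem cfRatio_append {l m : List ℕ} (hl : PosWord l) (hm : PosWord m) :
    cfRatio (l ++ m) = invBranch m.reverse (cfRatio l) := by
  induction m using List.reverseRecOn with
  | nil => simp [invBranch_nil]
  | append_singleton m a ih =>
    rw [posWord_append] at hm
    obtain ⟨-, g2, -, g4⟩ := cfRow_append_singleton (l ++ m) a
    have h0 : (0 : ℝ) < cfQ (l ++ m) := by exact_mod_cast cfQ_pos (posWord_append.2 ⟨hl, hm.1⟩)
    rw [← List.append_assoc, List.reverse_append, List.reverse_singleton, List.singleton_append,
      invBranch_cons, ← ih hm.1, cfRatio, g2, g4, cfRatio, invBranch1]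
    push_cast
    have ha : (0 : ℝ) < a := by exact_mod_cast (posWord_cons.1 hm.2).1
    field_simp
    ring

theorem cfQ'_pos {l : List ℕ} (hl : PosWord l) (h : 0 < l.length) : 0 < cfQ' l := by
  rcases List.eq_nil_or_concat' l with rfl | ⟨l, b, rfl⟩
  · simp at h
  rw [(cfRow_append_singleton l b).2.2.2]
  exact cfQ_pos (posWord_append.1 hl).1

/-- A word is determined by its length and its last two continuants. -/
theorem eq_of_cfQ_eq {l m : List ℕ} (hl : PosWord l) (hm : PosWord m) (hlen : l.length = m.length)
    (hq : cfQ l = cfQ m) (hq' : cfQ' l = cfQ' m) : l = m := by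
  induction l using List.reverseRecOn generalizing m with
  | nil => exact (List.length_eq_zero_iff.1 (by simpa using hlen.symm)).symm
  | append_singleton l a ih =>
    rcases List.eq_nil_or_concat' m with rfl | ⟨m, b, rfl⟩
    · simp at hlen
    obtain ⟨-, g2, -, g4⟩ := cfRow_append_singleton l a
    obtain ⟨-, k2, -, k4⟩ := cfRow_append_singleton m b
    rw [posWord_append] at hl hm
    rw [g2, k2] at hq
    rw [g4, k4] at hq'
    simp only [List.length_append, List.length_singleton, add_left_inj] at hlen
    have hp := cfQ_pos hl.1
    have e1 := cfQ'_le_cfQ hl.1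
    have e2 := cfQ'_le_cfQ hm.1
    have hb := (posWord_cons.1 hm.2).1
    have ha := (posWord_cons.1 hl.2).1
    have key : a = b ∧ cfQ' l = cfQ' m := by
      rcases Nat.eq_zero_or_pos l.length with h0 | h0
      · obtain rfl := List.length_eq_zero_iff.1 h0
        obtain rfl := List.length_eq_zero_iff.1 (h0 ▸ hlen.symm)
        simpa using hq
      · have f1 := cfQ'_pos hl.1 h0
        have f2 := cfQ'_pos hm.1 (hlen ▸ h0)
        have hab : a = b := by
          rcases lt_trichotomy a b with h | h | h
          · obtain ⟨d, rfl⟩ := Nat.exists_eq_add_of_lt h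
            have : (a + d + 1) * cfQ m = a * cfQ m + d * cfQ m + cfQ m := by ring
            rw [hq', this] at hq
            have := Nat.zero_le (d * cfQ m)
            omega
          · exact h
          · obtain ⟨d, rfl⟩ := Nat.exists_eq_add_of_lt h
            have : (b + d + 1) * cfQ m = b * cfQ m + d * cfQ m + cfQ m := by ring
            rw [hq', this] at hq
            have := Nat.zero_le (d * cfQ m)
            omega
        subst hab
        rw [hq'] at hq
        exact ⟨rfl, by omega⟩
    rw [key.1, ih hl.1 hm.1 hlen hq' key.2]

/-! ### Measurability and small cylinders -/

theorem measurable_gaussMap : Measurable gaussMap := measurable_fract.comp measurable_inv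

theorem measurable_cfDigit1 : Measurable cfDigit1 := Nat.measurable_floor.comp measurable_inv

theorem measurableSet_gaussSet : MeasurableSet gaussSet := by
  refine measurableSet_Icc.inter ?_
  exact (Set.countable_range ((↑) : ℚ → ℝ)).measurableSet.compl

theorem measurable_invBranch (l : List ℕ) : Measurable (invBranch l) := by
  induction l with
  | nil => exact measurable_id
  | cons a l ih => exact (ih.add_const _).inv

theorem measurableSet_cfWord_eq (n : ℕ) (l : List ℕ) : MeasurableSet {x | cfWord n x = l} := by
  induction n generalizing l with
  | zero => simp [cfWord]
  | succ n ih =>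
    rcases l with _ | ⟨a, l⟩
    · simp [cfWord_succ]
    · have : {x | cfWord (n + 1) x = a :: l} =
          cfDigit1 ⁻¹' {a} ∩ gaussMap ⁻¹' {x | cfWord n x = l} := by
        ext x; simp [cfWord_succ]
      rw [this]
      exact (measurable_cfDigit1 (measurableSet_singleton a)).inter (measurable_gaussMap (ih l))

theorem measurableSet_cylinder (l : List ℕ) : MeasurableSet (cylinder l) := by
  have : cylinder l = gaussSet ∩ {x | cfWord l.length x = l} := by
    ext x; exact mem_cylinder_iff
  rw [this]
  exact measurableSet_gaussSet.inter (measurableSet_cfWord_eq _ _)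

theorem measurable_comp_cfWord {α : Type*} [MeasurableSpace α] (n : ℕ) (g : List ℕ → α) :
    Measurable fun x => g (cfWord n x) := by
  intro s _
  have : (fun x => g (cfWord n x)) ⁻¹' s = ⋃ l ∈ g ⁻¹' s, {x | cfWord n x = l} := by
    ext x; simp
  rw [this]
  exact MeasurableSet.biUnion (Set.to_countable _) fun l _ => measurableSet_cfWord_eq n l

theorem length_le_cfQ {l : List ℕ} (hl : PosWord l) : l.length ≤ cfQ l := by
  induction l using List.reverseRecOn with
  | nil => simp
  | append_singleton l a ih =>
    rw [posWord_append, posWord_cons] at hl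
    rw [(cfRow_append_singleton l a).2.1, List.length_append, List.length_singleton]
    have h1 := Nat.le_mul_of_pos_left (cfQ l) hl.2.1
    rcases Nat.eq_zero_or_pos l.length with h | h
    · have := cfQ_pos hl.1
      omega
    · have := cfQ'_pos hl.1 h
      have := ih hl.1
      omega

theorem abs_sub_le_of_mem_cylinder {l : List ℕ} {x y : ℝ} (hx : x ∈ cylinder l)
    (hy : y ∈ cylinder l) : |x - y| ≤ 1 / (cfQ l : ℝ) ^ 2 := by
  have hl := posWord_of_mem_cylinder hx
  have h1 := gaussMap_iterate_mem hx.1 l.length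
  have h2 := gaussMap_iterate_mem hy.1 l.length
  have := abs_invBranch_sub_le hl h1.1.1 h2.1.1
  rw [invBranch_gaussMap_iterate hx, invBranch_gaussMap_iterate hy] at this
  refine this.trans ?_
  gcongr
  rw [abs_le]
  constructor <;> linarith [h1.1.1, h1.1.2, h2.1.1, h2.1.2]

/-- Sets that are unions of cylinders at all large levels exhaust open sets. -/
theorem exists_cylinder_subset {U : Set ℝ} (hU : IsOpen U) {x : ℝ} (hx : x ∈ gaussSet)
    (hxU : x ∈ U) : ∃ N : ℕ, ∀ n ≥ N, cylinder (cfWord n x) ⊆ U := by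
  obtain ⟨ε, hε, hb⟩ := Metric.isOpen_iff.1 hU x hxU
  obtain ⟨N, hN⟩ := exists_nat_gt (1 / ε)
  refine ⟨N + 1, fun n hn y hy => hb ?_⟩
  have h1 := abs_sub_le_of_mem_cylinder hy (mem_cylinder_cfWord hx n)
  rw [Metric.mem_ball, Real.dist_eq]
  refine h1.trans_lt ?_
  have h2 : (n : ℝ) ≤ cfQ (cfWord n x) := by
    have := length_le_cfQ (cfWord_pos hx n)
    rw [cfWord_length] at this
    exact_mod_cast this
  have hn1 : (N : ℝ) + 1 ≤ n := by exact_mod_cast hn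
  have hN0 : (0 : ℝ) ≤ N := Nat.cast_nonneg N
  have h3 : (1 : ℝ) ≤ cfQ (cfWord n x) := by linarith
  rw [div_lt_iff₀ (by positivity)]
  rw [div_lt_iff₀ hε] at hN
  nlinarith

/-- Domination of measures can be checked on deep cylinders. -/
theorem measure_le_of_cylinder {m₁ m₂ : Measure ℝ} [IsFiniteMeasure m₁] [IsFiniteMeasure m₂]
    (h₁ : m₁ gaussSetᶜ = 0) (C : ℝ≥0) (N : ℕ)
    (h : ∀ l : List ℕ, N ≤ l.length → PosWord l → m₁ (cylinder l) ≤ C * m₂ (cylinder l)) :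
    m₁ ≤ C • m₂ := by
  have hopen : ∀ U : Set ℝ, IsOpen U → m₁ U ≤ (C • m₂) U := by
    intro U hU
    have hlen : ∀ n, N ≤ n → m₁ (⋃ l ∈ {l : List ℕ | l.length = n ∧ PosWord l ∧ cylinder l ⊆ U},
        cylinder l) ≤ (C • m₂) U := by
      intro n hn
      have hc : {l : List ℕ | l.length = n ∧ PosWord l ∧ cylinder l ⊆ U}.Countable :=
        Set.to_countable _
      have hd : {l : List ℕ | l.length = n ∧ PosWord l ∧ cylinder l ⊆ U}.PairwiseDisjoint
          cylinder := fun a ha b hb hab => cylinder_disjoint (ha.1.trans hb.1.symm) hab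
      rw [measure_biUnion hc hd fun l _ => measurableSet_cylinder l]
      calc _ ≤ ∑' p : {l : List ℕ | l.length = n ∧ PosWord l ∧ cylinder l ⊆ U},
            (C • m₂) (cylinder p.1) := by
            refine ENNReal.tsum_le_tsum fun p => ?_
            exact h p.1 (by rw [p.2.1]; exact hn) p.2.2.1
        _ = (C • m₂) (⋃ l ∈ {l : List ℕ | l.length = n ∧ PosWord l ∧ cylinder l ⊆ U},
            cylinder l) := (measure_biUnion hc hd fun l _ => measurableSet_cylinder l).symm
        _ ≤ _ := measure_mono (Set.iUnion₂_subset fun l hl => hl.2.2)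
    set V : ℕ → Set ℝ := fun n =>
      ⋃ l ∈ {l : List ℕ | l.length = N + n ∧ PosWord l ∧ cylinder l ⊆ U}, cylinder l with hV
    have hmono : Monotone V := by
      refine monotone_nat_of_le_succ fun n x hx => ?_
      simp only [hV, Set.mem_iUnion, Set.mem_ofPred_eq] at hx ⊢
      obtain ⟨l, ⟨hl, hp, hs⟩, hxl⟩ := hx
      refine ⟨cfWord (N + (n + 1)) x, ⟨cfWord_length _ _, cfWord_pos hxl.1 _, ?_⟩,
        mem_cylinder_cfWord hxl.1 _⟩
      rw [← add_assoc, cfWord_add, ← hl, (mem_cylinder_iff.1 hxl).2]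
      exact fun y hy => hs (mem_cylinder_append.1 hy).1
    have hsub : U ⊆ (⋃ n, V n) ∪ gaussSetᶜ := by
      intro x hx
      by_cases hxX : x ∈ gaussSet
      · left
        obtain ⟨n, hn⟩ := exists_cylinder_subset hU hxX hx
        simp only [hV, Set.mem_iUnion, Set.mem_ofPred_eq]
        exact ⟨n, cfWord (N + n) x, ⟨cfWord_length _ _, cfWord_pos hxX _, hn _ (by omega)⟩,
          mem_cylinder_cfWord hxX _⟩
      · right; exact hxX
    calc m₁ U ≤ m₁ ((⋃ n, V n) ∪ gaussSetᶜ) := measure_mono hsub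
      _ ≤ m₁ (⋃ n, V n) + m₁ gaussSetᶜ := measure_union_le _ _
      _ = ⨆ n, m₁ (V n) := by rw [h₁, add_zero, hmono.measure_iUnion]
      _ ≤ _ := iSup_le fun n => hlen (N + n) (by omega)
  refine Measure.le_iff.2 fun s _ => ?_
  rw [s.measure_eq_iInf_isOpen (C • m₂)]
  exact le_iInf₂ fun U hU => le_iInf fun hUo => (measure_mono hU).trans (hopen U hUo)

/-! ### Weights of words -/

/-- The Birkhoff sum of `φ` along the inverse branch `T_c`. -/
noncomputable def wsum (φ : ℝ → ℝ) (c : List ℕ) (x : ℝ) : ℝ :=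
  birkhoff φ c.length (invBranch c x)

/-- The weight `exp (S_n φ (T_c x))`. -/
noncomputable def gw (φ : ℝ → ℝ) (c : List ℕ) (x : ℝ) : ℝ := Real.exp (wsum φ c x)

theorem gw_pos (φ : ℝ → ℝ) (c : List ℕ) (x : ℝ) : 0 < gw φ c x := Real.exp_pos _

theorem birkhoff_succ (φ : ℝ → ℝ) (n : ℕ) (x : ℝ) :
    birkhoff φ (n + 1) x = φ x + birkhoff φ n (gaussMap x) := by
  rw [birkhoff, Finset.sum_range_succ', add_comm]; rfl

theorem birkhoff_add (φ : ℝ → ℝ) (m n : ℕ) (x : ℝ) :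
    birkhoff φ (m + n) x = birkhoff φ m x + birkhoff φ n (gaussMap^[m] x) := by
  simp only [birkhoff, Finset.sum_range_add]
  congr 1
  refine Finset.sum_congr rfl fun k _ => ?_
  rw [← Function.iterate_add_apply, add_comm]

theorem wsum_nil (φ : ℝ → ℝ) (x : ℝ) : wsum φ [] x = 0 := by simp [wsum, birkhoff]

theorem wsum_append (φ : ℝ → ℝ) {c d : List ℕ} (hc : PosWord c) (hd : PosWord d) {x : ℝ}
    (hx : x ∈ gaussSet) : wsum φ (c ++ d) x = wsum φ c (invBranch d x) + wsum φ d x := by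
  rw [wsum, List.length_append, birkhoff_add, invBranch_append,
    gaussMap_iterate_invBranch hc (invBranch_mem hd hx)]
  rfl

theorem wsum_cons (φ : ℝ → ℝ) (a : ℕ) {l : List ℕ} (hl : PosWord l) {x : ℝ}
    (hx : x ∈ gaussSet) :
    wsum φ (a :: l) x = φ (invBranch1 a (invBranch l x)) + wsum φ l x := by
  rw [wsum, List.length_cons, birkhoff_succ, invBranch_cons,
    gaussMap_invBranch1 a (invBranch_mem hl hx)]
  rfl

theorem gw_append (φ : ℝ → ℝ) {c d : List ℕ} (hc : PosWord c) (hd : PosWord d) {x : ℝ}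
    (hx : x ∈ gaussSet) : gw φ (c ++ d) x = gw φ c (invBranch d x) * gw φ d x := by
  rw [gw, wsum_append φ hc hd hx, Real.exp_add]; rfl

theorem measurable_birkhoff {φ : ℝ → ℝ} (hφ : Measurable φ) (n : ℕ) : Measurable (birkhoff φ n) :=
  Finset.measurable_sum _ fun k _ => hφ.comp (measurable_gaussMap.iterate k)

theorem measurable_gw {φ : ℝ → ℝ} (hφ : Measurable φ) (c : List ℕ) : Measurable (gw φ c) :=
  ((measurable_birkhoff hφ _).comp (measurable_invBranch c)).exp

/-- Bounded distortion of Birkhoff sums. -/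
theorem wsum_sub_le {φ : ℝ → ℝ} {K θ : ℝ} (hθ : θ ∈ Set.Ioo (0 : ℝ) 1)
    (hφ : ∀ l : List ℕ, l ≠ [] → (∀ a ∈ l, 0 < a) →
      ∀ x ∈ cylinder l, ∀ y ∈ cylinder l, |φ x - φ y| ≤ K * θ ^ l.length)
    {c d : List ℕ} (hc : PosWord c) {x y : ℝ} (hx : x ∈ cylinder d) (hy : y ∈ cylinder d) :
    wsum φ c x - wsum φ c y ≤ K * θ / (1 - θ) * θ ^ d.length * (1 - θ ^ c.length) := by
  have h1 : 0 < 1 - θ := by linarith [hθ.2]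
  induction c with
  | nil => simp [wsum_nil]
  | cons a c ih =>
    have hc' := posWord_cons.1 hc
    have hcyl : ∀ z ∈ cylinder d, invBranch1 a (invBranch c z) ∈ cylinder (a :: c ++ d) := by
      intro z hz
      rw [← invBranch_cons]
      refine mem_cylinder_append.2 ⟨invBranch_mem_cylinder hc hz.1, ?_⟩
      rw [gaussMap_iterate_invBranch hc hz.1]; exact hz
    have hd := posWord_of_mem_cylinder hx
    have h2 := (abs_le.1 (hφ (a :: c ++ d) (by simp) (posWord_append.2 ⟨hc, hd⟩) _ (hcyl x hx) _
      (hcyl y hy))).2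
    have h3 := ih hc'.2
    rw [wsum_cons φ a hc'.2 hx.1, wsum_cons φ a hc'.2 hy.1]
    rw [List.length_append, List.length_cons] at h2
    rw [List.length_cons]
    have h4 : K * θ / (1 - θ) * θ ^ d.length * (1 - θ ^ (c.length + 1)) =
        K * θ / (1 - θ) * θ ^ d.length * (1 - θ ^ c.length) + K * θ ^ (c.length + 1 + d.length) := by
      field_simp
      ring
    rw [h4]
    linarith

/-- A Gibbs measure for a normalized potential, with explicit constants. -/
structure GibbsSystem (φ : ℝ → ℝ) (μ : Measure ℝ) (B θ C : ℝ) : Prop where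
  prob : IsProbabilityMeasure μ
  ae_mem : ∀ᵐ x ∂μ, x ∈ gaussSet
  mp : MeasurePreserving gaussMap μ μ
  meas : Measurable φ
  theta_pos : 0 < θ
  theta_lt : θ < 1
  B_nonneg : 0 ≤ B
  one_le_C : 1 ≤ C
  nonpos : ∀ x, φ x ≤ 0
  norm : ∀ x ∈ gaussSet, ∑' a : ℕ+, ENNReal.ofReal (Real.exp (φ (invBranch1 (a : ℕ) x))) = 1
  distortion : ∀ c d : List ℕ, PosWord c → ∀ x ∈ cylinder d, ∀ y ∈ cylinder d,
    wsum φ c x - wsum φ c y ≤ B * θ ^ d.length * (1 - θ ^ c.length)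
  gibbs_le : ∀ c : List ℕ, PosWord c → ∀ x ∈ gaussSet, μ.real (cylinder c) ≤ C * gw φ c x
  le_gibbs : ∀ c : List ℕ, PosWord c → ∀ x ∈ gaussSet, gw φ c x ≤ C * μ.real (cylinder c)

theorem measurable_indicator_of_locHolder {φ : ℝ → ℝ} (hφ : LocHolder φ) :
    Measurable (gaussSet.indicator φ) := by
  obtain ⟨K, hK, θ, hθ, h⟩ := hφ
  rcases gaussSet.eq_empty_or_nonempty with he | ⟨x₀, hx₀⟩
  · simp [he, measurable_const]
  set g : ℕ → ℝ → ℝ := fun n => gaussSet.indicator fun x => φ (invBranch (cfWord (n + 1) x) x₀)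
    with hg
  have hmeas : ∀ n, Measurable (g n) := fun n =>
    (measurable_comp_cfWord (n + 1) fun l => φ (invBranch l x₀)).indicator measurableSet_gaussSet
  refine measurable_of_tendsto_metrizable hmeas (tendsto_pi_nhds.2 fun x => ?_)
  by_cases hx : x ∈ gaussSet
  · simp only [hg, Set.indicator_of_mem hx]
    have hlim : Tendsto (fun n : ℕ => K * θ ^ (n + 1)) atTop (𝓝 0) := by
      have := (tendsto_pow_atTop_nhds_zero_of_lt_one hθ.1.le hθ.2).const_mul K
      rw [mul_zero] at this
      exact this.comp (tendsto_add_atTop_nat 1)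
    rw [tendsto_iff_dist_tendsto_zero]
    refine squeeze_zero (fun _ => dist_nonneg) (fun n => ?_) hlim
    have hw := cfWord_pos hx (n + 1)
    have := h (cfWord (n + 1) x) (by rw [cfWord_succ]; simp) hw _
      (invBranch_mem_cylinder hw hx₀) _ (mem_cylinder_cfWord hx (n + 1))
    rwa [cfWord_length] at this
  · simp only [hg, Set.indicator_of_notMem hx]
    exact tendsto_const_nhds

theorem birkhoff_congr {φ ψ : ℝ → ℝ} (h : ∀ x ∈ gaussSet, φ x = ψ x) (n : ℕ) {x : ℝ}
    (hx : x ∈ gaussSet) : birkhoff φ n x = birkhoff ψ n x :=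
  Finset.sum_congr rfl fun k _ => h _ (gaussMap_iterate_mem hx k)

theorem exists_gibbsSystem {φ : ℝ → ℝ} {μ : Measure ℝ} [hμ : IsProbabilityMeasure μ]
    (hμX : μ gaussSet = 1) (hinv : GaussInvariant μ)
    (hφH : LocHolder φ) (hφ0 : ∀ x ∈ gaussSet, φ x ≤ 0)
    (hL : TransferNormalized φ) (hGibbs : IsGibbs φ μ) :
    ∃ ψ : ℝ → ℝ, ∃ B θ C : ℝ, GibbsSystem ψ μ B θ C ∧ ∀ l : List ℕ, l ≠ [] → PosWord l →
      ∀ x ∈ cylinder l, ∀ y ∈ cylinder l, |ψ x - ψ y| ≤ B * θ ^ l.length := by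
  have hmeas := measurable_indicator_of_locHolder hφH
  have hcongr : ∀ x ∈ gaussSet, gaussSet.indicator φ x = φ x := fun x hx =>
    Set.indicator_of_mem hx φ
  obtain ⟨K, hK, θ, hθ, h⟩ := hφH
  obtain ⟨C, hC, hg⟩ := hGibbs
  have h1 : 0 < 1 - θ := by linarith [hθ.2]
  have h' : ∀ l : List ℕ, l ≠ [] → (∀ a ∈ l, 0 < a) → ∀ x ∈ cylinder l, ∀ y ∈ cylinder l,
      |gaussSet.indicator φ x - gaussSet.indicator φ y| ≤ K * θ ^ l.length := by
    intro l hl hp x hx y hy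
    rw [hcongr x hx.1, hcongr y hy.1]; exact h l hl hp x hx y hy
  have hgw : ∀ c : List ℕ, PosWord c → ∀ x ∈ gaussSet, gw (gaussSet.indicator φ) c x =
      Real.exp (birkhoff φ c.length (invBranch c x)) := by
    intro c hc x hx
    rw [gw, wsum, birkhoff_congr hcongr _ (invBranch_mem hc hx)]
  have hgib : ∀ c : List ℕ, PosWord c → ∀ x ∈ gaussSet,
      C⁻¹ * gw (gaussSet.indicator φ) c x ≤ μ.real (cylinder c) ∧
      μ.real (cylinder c) ≤ C * gw (gaussSet.indicator φ) c x := by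
    intro c hc x hx
    rw [hgw c hc x hx]
    rcases eq_or_ne c [] with rfl | hne
    · simp [cylinder_nil, birkhoff, measureReal_def, hμX, hC, inv_le_one_of_one_le₀ hC]
    · exact hg c hne hc x hx
  refine ⟨gaussSet.indicator φ, max K (K * θ / (1 - θ)), θ, C, ?_, ?_⟩
  · refine ⟨hμ, ?_, ⟨measurable_gaussMap, ?_⟩, hmeas, hθ.1, hθ.2, ?_, hC, ?_, ?_, ?_, ?_, ?_⟩
    · rw [ae_iff]
      exact (prob_compl_eq_zero_iff measurableSet_gaussSet).2 hμX
    · ext s hs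
      rw [Measure.map_apply measurable_gaussMap hs]
      exact hinv s hs
    · exact le_max_of_le_left hK.le
    · intro x
      exact Set.indicator_apply_le' (fun hx => hφ0 x hx) fun _ => le_rfl
    · intro x hx
      have hsum : Summable fun a : ℕ+ => Real.exp (φ (invBranch1 (a : ℕ) x)) := by
        by_contra hns
        have := hL x hx
        rw [tsum_eq_zero_of_not_summable hns] at this
        exact zero_ne_one this
      have : ∀ a : ℕ+, gaussSet.indicator φ (invBranch1 (a : ℕ) x) = φ (invBranch1 (a : ℕ) x) :=
        fun a => hcongr _ (invBranch1_mem a.2 hx)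
      simp only [this]
      rw [← ENNReal.ofReal_tsum_of_nonneg (fun _ => (Real.exp_pos _).le) hsum, hL x hx,
        ENNReal.ofReal_one]
    · intro c d hc x hx y hy
      refine (wsum_sub_le hθ h' hc hx hy).trans ?_
      have h2 : 0 ≤ 1 - θ ^ c.length := by
        linarith [pow_le_one₀ hθ.1.le hθ.2.le (n := c.length)]
      have h3 : 0 ≤ θ ^ d.length := pow_nonneg hθ.1.le _
      gcongr
      exact le_max_right _ _
    · exact fun c hc x hx => (hgib c hc x hx).2
    · intro c hc x hx
      have := (hgib c hc x hx).1
      rwa [inv_mul_le_iff₀ (by linarith)] at this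
  · intro l hl hp x hx y hy
    refine (h' l hl hp x hx y hy).trans ?_
    have h3 : 0 ≤ θ ^ l.length := pow_nonneg hθ.1.le _
    gcongr
    exact le_max_left _ _

/-! ### The transfer operator -/

/-- The Ruelle transfer operator of `φ` acting on nonnegative functions. -/
noncomputable def transfer (φ : ℝ → ℝ) (f : ℝ → ℝ≥0∞) (y : ℝ) : ℝ≥0∞ :=
  ∑' a : ℕ+, ENNReal.ofReal (Real.exp (φ (invBranch1 (a : ℕ) y))) * f (invBranch1 (a : ℕ) y)

theorem measurable_invBranch1 (a : ℕ) : Measurable (invBranch1 a) :=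
  (measurable_id.add_const _).inv

theorem measurable_transfer {φ : ℝ → ℝ} (hφ : Measurable φ) {f : ℝ → ℝ≥0∞} (hf : Measurable f) :
    Measurable (transfer φ f) :=
  Measurable.tsum fun a => ((hφ.comp (measurable_invBranch1 a)).exp.ennreal_ofReal).mul
    (hf.comp (measurable_invBranch1 a))

theorem measurable_transfer_iterate {φ : ℝ → ℝ} (hφ : Measurable φ) {f : ℝ → ℝ≥0∞}
    (hf : Measurable f) (n : ℕ) : Measurable ((transfer φ)^[n] f) := by
  induction n with
  | zero => exact hf
  | succ n ih => rw [Function.iterate_succ_apply']; exact measurable_transfer hφ ih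

theorem transfer_mono_on {φ : ℝ → ℝ} {f g : ℝ → ℝ≥0∞} (h : ∀ x ∈ gaussSet, f x ≤ g x) {y : ℝ}
    (hy : y ∈ gaussSet) : transfer φ f y ≤ transfer φ g y :=
  ENNReal.tsum_le_tsum fun a => by gcongr; exact h _ (invBranch1_mem a.2 hy)

theorem transfer_iterate_mono_on {φ : ℝ → ℝ} {f g : ℝ → ℝ≥0∞} (h : ∀ x ∈ gaussSet, f x ≤ g x)
    (n : ℕ) : ∀ y ∈ gaussSet, (transfer φ)^[n] f y ≤ (transfer φ)^[n] g y := by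
  induction n with
  | zero => exact h
  | succ n ih =>
    intro y hy
    rw [Function.iterate_succ_apply', Function.iterate_succ_apply']
    exact transfer_mono_on ih hy

theorem transfer_iterate_congr {φ : ℝ → ℝ} {f g : ℝ → ℝ≥0∞} (h : ∀ x ∈ gaussSet, f x = g x)
    (n : ℕ) {y : ℝ} (hy : y ∈ gaussSet) : (transfer φ)^[n] f y = (transfer φ)^[n] g y :=
  le_antisymm (transfer_iterate_mono_on (fun x hx => (h x hx).le) n y hy)
    (transfer_iterate_mono_on (fun x hx => (h x hx).ge) n y hy)

theorem transfer_mul_comp {φ : ℝ → ℝ} (f g : ℝ → ℝ≥0∞) {y : ℝ} (hy : y ∈ gaussSet) :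
    transfer φ (fun x => f x * g (gaussMap x)) y = transfer φ f y * g y := by
  rw [transfer, transfer, ← ENNReal.tsum_mul_right]
  refine tsum_congr fun a => ?_
  rw [gaussMap_invBranch1 a hy, mul_assoc]

theorem transfer_iterate_mul_comp {φ : ℝ → ℝ} (f g : ℝ → ℝ≥0∞) (n : ℕ) {y : ℝ}
    (hy : y ∈ gaussSet) :
    (transfer φ)^[n] (fun x => f x * g (gaussMap^[n] x)) y = (transfer φ)^[n] f y * g y := by
  induction n generalizing f with
  | zero => rfl
  | succ n ih =>
    rw [Function.iterate_succ_apply, Function.iterate_succ_apply, ← ih]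
    exact transfer_iterate_congr
      (fun x hx => transfer_mul_comp f (fun x => g (gaussMap^[n] x)) hx) n hy

theorem transfer_indicator {φ : ℝ → ℝ} (F : ℝ → ℝ≥0∞) (a : ℕ) (ha : 0 < a) (l : List ℕ) {y : ℝ}
    (hy : y ∈ gaussSet) :
    transfer φ ((cylinder (a :: l)).indicator F) y =
      (cylinder l).indicator
        (fun z => ENNReal.ofReal (Real.exp (φ (invBranch1 a z))) * F (invBranch1 a z)) y := by
  have hmem : ∀ b : ℕ+, invBranch1 (b : ℕ) y ∈ cylinder (a :: l) ↔ (b : ℕ) = a ∧ y ∈ cylinder l := by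
    intro b
    rw [mem_cylinder_cons, cfDigit1_invBranch1 _ hy, gaussMap_invBranch1 _ hy]
    exact ⟨fun h => h.2, fun h => ⟨invBranch1_mem b.2 hy, h⟩⟩
  lift a to ℕ+ using ha
  rw [transfer, tsum_eq_single a]
  · by_cases hyl : y ∈ cylinder l
    · rw [Set.indicator_of_mem ((hmem _).2 ⟨rfl, hyl⟩), Set.indicator_of_mem hyl]
    · rw [Set.indicator_of_notMem fun h => hyl ((hmem _).1 h).2, Set.indicator_of_notMem hyl,
        mul_zero]
  · intro b hb
    rw [Set.indicator_of_notMem fun h => hb (PNat.eq ((hmem _).1 h).1), mul_zero]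

theorem transfer_iterate_indicator {φ : ℝ → ℝ} (F : ℝ → ℝ≥0∞) {c : List ℕ} (hc : PosWord c)
    {y : ℝ} (hy : y ∈ gaussSet) :
    (transfer φ)^[c.length] ((cylinder c).indicator F) y =
      ENNReal.ofReal (gw φ c y) * F (invBranch c y) := by
  induction c generalizing F with
  | nil =>
    rw [cylinder_nil, List.length_nil, Function.iterate_zero, id, Set.indicator_of_mem hy, gw,
      wsum_nil]
    simp [invBranch_nil]
  | cons a c ih =>
    have hc' := posWord_cons.1 hc
    rw [List.length_cons, Function.iterate_succ_apply,
      transfer_iterate_congr (fun x hx => transfer_indicator F a hc'.1 c hx) _ hy, ih _ hc'.2,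
      gw, gw, wsum_cons φ a hc'.2 hy, Real.exp_add, mul_comm (Real.exp _),
      ENNReal.ofReal_mul (Real.exp_pos _).le, mul_assoc, invBranch_cons]

/-- The dual action of the transfer operator on measures. -/
noncomputable def transferDual (φ : ℝ → ℝ) (μ : Measure ℝ) : Measure ℝ :=
  Measure.sum fun a : ℕ+ =>
    (μ.withDensity fun y => ENNReal.ofReal (Real.exp (φ (invBranch1 (a : ℕ) y)))).map
      (invBranch1 (a : ℕ))

theorem lintegral_transferDual {φ : ℝ → ℝ} (hφ : Measurable φ) (μ : Measure ℝ) {f : ℝ → ℝ≥0∞}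
    (hf : Measurable f) : ∫⁻ x, f x ∂(transferDual φ μ) = ∫⁻ y, transfer φ f y ∂μ := by
  have hm : ∀ a : ℕ, Measurable fun y => ENNReal.ofReal (Real.exp (φ (invBranch1 a y))) :=
    fun a => (hφ.comp (measurable_invBranch1 a)).exp.ennreal_ofReal
  rw [transferDual, lintegral_sum_measure]
  simp only [transfer]
  have hm' : ∀ a : ℕ+, AEMeasurable (fun y =>
      ENNReal.ofReal (Real.exp (φ (invBranch1 (a : ℕ) y))) * f (invBranch1 (a : ℕ) y)) μ :=
    fun a => ((hm a).mul (hf.comp (measurable_invBranch1 a))).aemeasurable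
  rw [lintegral_tsum hm']
  refine tsum_congr fun a => ?_
  rw [lintegral_map hf (measurable_invBranch1 a),
    lintegral_withDensity_eq_lintegral_mul _ (hm a) (g := fun y => f (invBranch1 (a : ℕ) y))
      (hf.comp (measurable_invBranch1 a))]
  rfl

namespace GibbsSystem

variable {φ : ℝ → ℝ} {μ : Measure ℝ} {B θ C : ℝ}

theorem nonempty (G : GibbsSystem φ μ B θ C) : gaussSet.Nonempty := by
  have := G.prob
  exact G.ae_mem.exists

theorem C_pos (G : GibbsSystem φ μ B θ C) : 0 < C := lt_of_lt_of_le one_pos G.one_le_C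

theorem measure_cylinder_append_le (G : GibbsSystem φ μ B θ C) {c e : List ℕ} (hc : PosWord c)
    (he : PosWord e) :
    μ.real (cylinder (c ++ e)) ≤ C ^ 3 * (μ.real (cylinder c) * μ.real (cylinder e)) := by
  obtain ⟨x, hx⟩ := G.nonempty
  have hC := G.C_pos
  calc μ.real (cylinder (c ++ e)) ≤ C * (gw φ c (invBranch e x) * gw φ e x) := by
        rw [← gw_append φ hc he hx]; exact G.gibbs_le _ (posWord_append.2 ⟨hc, he⟩) x hx
    _ ≤ C * ((C * μ.real (cylinder c)) * (C * μ.real (cylinder e))) := by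
        have h1 := G.le_gibbs c hc _ (invBranch_mem he hx)
        have h2 := G.le_gibbs e he x hx
        have := (gw_pos φ e x).le
        gcongr
    _ = _ := by ring

theorem le_measure_cylinder_append (G : GibbsSystem φ μ B θ C) {c e : List ℕ} (hc : PosWord c)
    (he : PosWord e) :
    μ.real (cylinder c) * μ.real (cylinder e) ≤ C ^ 3 * μ.real (cylinder (c ++ e)) := by
  obtain ⟨x, hx⟩ := G.nonempty
  have hC := G.C_pos
  calc μ.real (cylinder c) * μ.real (cylinder e)
      ≤ (C * gw φ c (invBranch e x)) * (C * gw φ e x) := by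
        have h1 := G.gibbs_le c hc _ (invBranch_mem he hx)
        have h2 := G.gibbs_le e he x hx
        have := (gw_pos φ c (invBranch e x)).le
        gcongr
    _ = C ^ 2 * gw φ (c ++ e) x := by rw [gw_append φ hc he hx]; ring
    _ ≤ C ^ 2 * (C * μ.real (cylinder (c ++ e))) := by
        gcongr; exact G.le_gibbs _ (posWord_append.2 ⟨hc, he⟩) x hx
    _ = _ := by ring

theorem setLIntegral_gw_le (G : GibbsSystem φ μ B θ C) {c e : List ℕ} (hc : PosWord c)
    (he : PosWord e) :
    ∫⁻ y in cylinder e, ENNReal.ofReal (gw φ c y) ∂μ ≤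
      ENNReal.ofReal (C ^ 4) * μ (cylinder (c ++ e)) := by
  have := G.prob
  have hC := G.C_pos
  calc ∫⁻ y in cylinder e, ENNReal.ofReal (gw φ c y) ∂μ
      ≤ ∫⁻ _ in cylinder e, ENNReal.ofReal (C * μ.real (cylinder c)) ∂μ :=
        setLIntegral_mono measurable_const fun y hy =>
          ENNReal.ofReal_le_ofReal (G.le_gibbs c hc y hy.1)
    _ = ENNReal.ofReal (C * (μ.real (cylinder c) * μ.real (cylinder e))) := by
        rw [setLIntegral_const, ← ofReal_measureReal (measure_ne_top μ _),
          ← ENNReal.ofReal_mul (by positivity), mul_assoc]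
    _ ≤ ENNReal.ofReal (C * (C ^ 3 * μ.real (cylinder (c ++ e)))) := by
        exact ENNReal.ofReal_le_ofReal
          (mul_le_mul_of_nonneg_left (G.le_measure_cylinder_append hc he) hC.le)
    _ = _ := by
        rw [← ofReal_measureReal (measure_ne_top μ _), ← ENNReal.ofReal_mul (by positivity)]
        congr 1; ring

theorem le_setLIntegral_gw (G : GibbsSystem φ μ B θ C) {c e : List ℕ} (hc : PosWord c)
    (he : PosWord e) :
    μ (cylinder (c ++ e)) ≤
      ENNReal.ofReal (C ^ 4) * ∫⁻ y in cylinder e, ENNReal.ofReal (gw φ c y) ∂μ := by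
  have := G.prob
  have hC := G.C_pos
  calc μ (cylinder (c ++ e)) ≤ ENNReal.ofReal (C ^ 3 * (μ.real (cylinder c) *
        μ.real (cylinder e))) := by
        rw [← ofReal_measureReal (measure_ne_top μ _)]
        exact ENNReal.ofReal_le_ofReal (G.measure_cylinder_append_le hc he)
    _ = ENNReal.ofReal (C ^ 4) * (ENNReal.ofReal (C⁻¹ * μ.real (cylinder c)) * μ (cylinder e)) := by
        rw [← ofReal_measureReal (measure_ne_top μ (cylinder e)),
          ← ENNReal.ofReal_mul (by positivity), ← ENNReal.ofReal_mul (by positivity)]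
        congr 1; field_simp
    _ = ENNReal.ofReal (C ^ 4) *
        ∫⁻ _ in cylinder e, ENNReal.ofReal (C⁻¹ * μ.real (cylinder c)) ∂μ := by
        rw [setLIntegral_const]
    _ ≤ _ := by
        refine mul_le_mul_right ?_ _
        refine setLIntegral_mono (measurable_gw G.meas c).ennreal_ofReal fun y hy => ?_
        refine ENNReal.ofReal_le_ofReal ?_
        rw [inv_mul_le_iff₀ hC]
        exact G.gibbs_le c hc y hy.1

theorem lintegral_transfer_indicator (G : GibbsSystem φ μ B θ C) {c e : List ℕ}
    (hc : PosWord c) :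
    ∫⁻ y, (transfer φ)^[c.length] ((cylinder (c ++ e)).indicator 1) y ∂μ =
      ∫⁻ y in cylinder e, ENNReal.ofReal (gw φ c y) ∂μ := by
  rw [← lintegral_indicator (measurableSet_cylinder e)]
  refine lintegral_congr_ae ?_
  filter_upwards [G.ae_mem] with y hy
  have h1 : (cylinder (c ++ e)).indicator (1 : ℝ → ℝ≥0∞) =
      (cylinder c).indicator ((cylinder (c ++ e)).indicator 1) := by
    rw [Set.indicator_indicator, Set.inter_eq_self_of_subset_right]
    exact fun x hx => (mem_cylinder_append.1 hx).1
  rw [h1, transfer_iterate_indicator _ hc hy]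
  have h2 : invBranch c y ∈ cylinder (c ++ e) ↔ y ∈ cylinder e := by
    rw [mem_cylinder_append, gaussMap_iterate_invBranch hc hy]
    exact ⟨fun h => h.2, fun h => ⟨invBranch_mem_cylinder hc hy, h⟩⟩
  by_cases hye : y ∈ cylinder e
  · rw [Set.indicator_of_mem (h2.2 hye), Set.indicator_of_mem hye, Pi.one_apply, mul_one]
  · rw [Set.indicator_of_notMem fun h => hye (h2.1 h), Set.indicator_of_notMem hye, mul_zero]

theorem transfer_one (G : GibbsSystem φ μ B θ C) : ∀ y ∈ gaussSet, transfer φ 1 y = 1 := by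
  intro y hy
  simp only [transfer, Pi.one_apply, mul_one]
  exact G.norm y hy

theorem transfer_iterate_one (G : GibbsSystem φ μ B θ C) (n : ℕ) :
    ∀ y ∈ gaussSet, (transfer φ)^[n] 1 y = 1 := by
  induction n with
  | zero => intro y _; rfl
  | succ n ih =>
    intro y hy
    rw [Function.iterate_succ_apply, transfer_iterate_congr (g := 1) G.transfer_one n hy, ih y hy]

theorem exists_density (G : GibbsSystem φ μ B θ C) : ∃ R : ℝ → ℝ≥0∞, Measurable R ∧
    ∀ f : ℝ → ℝ≥0∞, Measurable f → ∫⁻ y, transfer φ f y ∂μ = ∫⁻ y, f y * R y ∂μ := by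
  have := G.prob
  have hInt_formula : ∀ f : ℝ → ℝ≥0∞, Measurable f → ∫⁻ x, f x ∂(transferDual φ μ) =
      ∫⁻ y, transfer φ f y ∂μ := fun f hf => lintegral_transferDual G.meas μ hf
  have hind : ∀ s, MeasurableSet s → transferDual φ μ s = ∫⁻ y, transfer φ (s.indicator 1) y ∂μ := by
    intro s hs
    rw [← hInt_formula _ (measurable_one.indicator hs), lintegral_indicator_one hs]
  have hfin : IsFiniteMeasure (transferDual φ μ) := by
    refine ⟨?_⟩
    rw [hind _ MeasurableSet.univ, Set.indicator_univ]
    calc _ = ∫⁻ _, 1 ∂μ := lintegral_congr_ae (by filter_upwards [G.ae_mem] using G.transfer_one)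
      _ < ⊤ := by simp
  have hX : transferDual φ μ gaussSetᶜ = 0 := by
    rw [hind _ measurableSet_gaussSet.compl, lintegral_eq_zero_iff
      (measurable_transfer G.meas (measurable_one.indicator measurableSet_gaussSet.compl))]
    filter_upwards [G.ae_mem] with y hy
    simp only [transfer, Pi.zero_apply, ENNReal.tsum_eq_zero]
    intro a
    rw [Set.indicator_of_notMem, mul_zero]
    exact fun h => h (invBranch1_mem a.2 hy)
  have hle : transferDual φ μ ≤ (C ^ 4).toNNReal • μ := by
    refine measure_le_of_cylinder hX _ 1 fun l hl hp => ?_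
    rcases l with _ | ⟨a, l⟩
    · simp at hl
    have hp' := posWord_cons.1 hp
    rw [hind _ (measurableSet_cylinder _)]
    have hpa : PosWord [a] := posWord_cons.2 ⟨hp'.1, PosWord.nil⟩
    have h1 := G.lintegral_transfer_indicator (e := l) hpa
    have h2 := G.setLIntegral_gw_le hpa hp'.2
    rw [← h1] at h2
    exact h2
  have hac : transferDual φ μ ≪ μ :=
    (Measure.absolutelyContinuous_of_le hle).trans (Measure.smul_absolutelyContinuous)
  refine ⟨(transferDual φ μ).rnDeriv μ, Measure.measurable_rnDeriv _ _, fun f hf => ?_⟩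
  rw [← hInt_formula f hf]
  conv_lhs => rw [← Measure.withDensity_rnDeriv_eq _ _ hac]
  rw [lintegral_withDensity_eq_lintegral_mul _ (Measure.measurable_rnDeriv _ _) hf]
  exact lintegral_congr fun x => mul_comm _ _

theorem lintegral_transfer_iterate (G : GibbsSystem φ μ B θ C) {R : ℝ → ℝ≥0∞} (hR : Measurable R)
    (h : ∀ f : ℝ → ℝ≥0∞, Measurable f → ∫⁻ y, transfer φ f y ∂μ = ∫⁻ y, f y * R y ∂μ) (n : ℕ) :
    ∀ f : ℝ → ℝ≥0∞, Measurable f → ∫⁻ y, (transfer φ)^[n] f y ∂μ =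
      ∫⁻ y, f y * ∏ k ∈ Finset.range n, R (gaussMap^[k] y) ∂μ := by
  induction n with
  | zero => intro f _; simp
  | succ n ih =>
    intro f hf
    have hm := measurable_transfer_iterate G.meas hf n
    have hRn := hR.comp (measurable_gaussMap.iterate n)
    simp only [Function.iterate_succ_apply']
    rw [h _ hm]
    calc ∫⁻ y, (transfer φ)^[n] f y * R y ∂μ
        = ∫⁻ y, (transfer φ)^[n] (fun x => f x * R (gaussMap^[n] x)) y ∂μ := by
          refine lintegral_congr_ae ?_
          filter_upwards [G.ae_mem] with y hy
          rw [transfer_iterate_mul_comp f R n hy]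
      _ = _ := by
          rw [ih (fun x => f x * R (gaussMap^[n] x)) (hf.mul hRn)]
          refine lintegral_congr fun y => ?_
          rw [Finset.prod_range_succ]; ring

theorem density_bounds (G : GibbsSystem φ μ B θ C) {R : ℝ → ℝ≥0∞} (hR : Measurable R)
    (h : ∀ f : ℝ → ℝ≥0∞, Measurable f → ∫⁻ y, transfer φ f y ∂μ = ∫⁻ y, f y * R y ∂μ) (n : ℕ) :
    ∀ᵐ x ∂μ, ∏ k ∈ Finset.range n, R (gaussMap^[k] x) ≤ ENNReal.ofReal (C ^ 4) ∧
      1 ≤ ENNReal.ofReal (C ^ 4) * ∏ k ∈ Finset.range n, R (gaussMap^[k] x) := by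
  have := G.prob
  set Rn : ℝ → ℝ≥0∞ := fun x => ∏ k ∈ Finset.range n, R (gaussMap^[k] x) with hRn
  have hRm : Measurable Rn :=
    Finset.measurable_prod _ fun k _ => hR.comp (measurable_gaussMap.iterate k)
  have hit := G.lintegral_transfer_iterate hR h n
  have hfin : IsFiniteMeasure (μ.withDensity Rn) := by
    refine isFiniteMeasure_withDensity ?_
    have h1 := hit 1 measurable_one
    simp only [Pi.one_apply, one_mul] at h1
    rw [← h1, lintegral_congr_ae (g := 1) (by
      filter_upwards [G.ae_mem] using G.transfer_iterate_one n)]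
    simp
  have hcyl : ∀ l : List ℕ, n ≤ l.length → PosWord l → (μ.withDensity Rn) (cylinder l) ≤
      ENNReal.ofReal (C ^ 4) * μ (cylinder l) ∧
      μ (cylinder l) ≤ ENNReal.ofReal (C ^ 4) * (μ.withDensity Rn) (cylinder l) := by
    intro l hl hp
    have hsplit := List.take_append_drop n l
    have hlen : (l.take n).length = n := by simp [hl]
    have hc : PosWord (l.take n) := fun a ha => hp a (List.mem_of_mem_take ha)
    have he : PosWord (l.drop n) := fun a ha => hp a (List.mem_of_mem_drop ha)
    have h1 := G.lintegral_transfer_indicator (e := l.drop n) hc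
    rw [hlen, hsplit, hit _ (measurable_one.indicator (measurableSet_cylinder l))] at h1
    have h2 : (μ.withDensity Rn) (cylinder l) =
        ∫⁻ y in cylinder (l.drop n), ENNReal.ofReal (gw φ (l.take n) y) ∂μ := by
      rw [withDensity_apply _ (measurableSet_cylinder l), ← h1,
        ← lintegral_indicator (measurableSet_cylinder l)]
      refine lintegral_congr fun y => ?_
      by_cases hy : y ∈ cylinder l <;> simp [hy, hRn]
    have h3 := G.setLIntegral_gw_le hc he
    have h4 := G.le_setLIntegral_gw hc he
    rw [hsplit, ← h2] at h3 h4
    exact ⟨h3, h4⟩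
  have hX : μ gaussSetᶜ = 0 := G.ae_mem
  have hle1 : μ.withDensity Rn ≤ (C ^ 4).toNNReal • μ :=
    measure_le_of_cylinder (withDensity_absolutelyContinuous μ Rn hX) _ n
      fun l hl hp => (hcyl l hl hp).1
  have hle2 : μ ≤ (C ^ 4).toNNReal • μ.withDensity Rn :=
    measure_le_of_cylinder hX _ n fun l hl hp => (hcyl l hl hp).2
  have h1 : Rn ≤ᵐ[μ] fun _ => ENNReal.ofReal (C ^ 4) := by
    refine ae_le_of_forall_setLIntegral_le_of_sigmaFinite hRm fun s hs _ => ?_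
    rw [← withDensity_apply _ hs, setLIntegral_const]
    exact hle1 s
  have h2 : (fun _ => (1 : ℝ≥0∞)) ≤ᵐ[μ] fun x => ENNReal.ofReal (C ^ 4) * Rn x := by
    refine ae_le_of_forall_setLIntegral_le_of_sigmaFinite measurable_const fun s hs _ => ?_
    rw [lintegral_const_mul _ hRm, ← withDensity_apply Rn hs, setLIntegral_const, one_mul]
    exact hle2 s
  filter_upwards [h1, h2] with x hx1 hx2 using ⟨hx1, hx2⟩

theorem density_eq_one (G : GibbsSystem φ μ B θ C) {R : ℝ → ℝ≥0∞} (hR : Measurable R)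
    (h : ∀ f : ℝ → ℝ≥0∞, Measurable f → ∫⁻ y, transfer φ f y ∂μ = ∫⁻ y, f y * R y ∂μ) :
    ∀ᵐ x ∂μ, R x = 1 := by
  have := G.prob
  set D := C ^ 4 with hD
  have hD1 : 1 ≤ D := one_le_pow₀ G.one_le_C
  have hD0 : 0 < D := by linarith
  set r : ℝ → ℝ := fun x => (R x).toReal with hr
  have hrm : Measurable r := hR.ennreal_toReal
  have hb : ∀ n, ∀ᵐ x ∂μ, (∏ k ∈ Finset.range n, r (gaussMap^[k] x)) ≤ D ∧
      1 ≤ D * ∏ k ∈ Finset.range n, r (gaussMap^[k] x) := by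
    intro n
    filter_upwards [G.density_bounds hR h n] with x hx
    have h1 := ENNReal.toReal_mono ENNReal.ofReal_ne_top hx.1
    have h2 := ENNReal.toReal_mono
      (ENNReal.mul_ne_top ENNReal.ofReal_ne_top (hx.1.trans_lt ENNReal.ofReal_lt_top).ne) hx.2
    rw [ENNReal.toReal_mul, ENNReal.toReal_ofReal hD0.le, ENNReal.toReal_prod,
      ENNReal.toReal_one] at h2
    rw [ENNReal.toReal_ofReal hD0.le, ENNReal.toReal_prod] at h1
    exact ⟨h1, h2⟩
  have hlogb : ∀ x : ℝ, 0 < x → x ≤ D → 1 ≤ D * x → |Real.log x| ≤ Real.log D := by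
    intro x hx0 hx1 hx2
    have h1 := Real.log_le_log hx0 hx1
    have h2 := Real.log_le_log one_pos hx2
    rw [Real.log_one, Real.log_mul hD0.ne' hx0.ne'] at h2
    rw [abs_le]; constructor <;> linarith
  have hpos : ∀ᵐ x ∂μ, 0 < r x ∧ r x ≤ D ∧ 1 ≤ D * r x := by
    filter_upwards [hb 1] with x hx
    simp only [Finset.prod_range_one, Function.iterate_zero, id] at hx
    exact ⟨by by_contra! hneg; nlinarith [hx.2], hx⟩
  have hposk : ∀ᵐ x ∂μ, ∀ k : ℕ, 0 < r (gaussMap^[k] x) := by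
    rw [ae_all_iff]
    intro k
    filter_upwards [(G.mp.iterate k).quasiMeasurePreserving.ae hpos] with x hx using hx.1
  have hlogm : Measurable fun x => Real.log (r x) := Real.measurable_log.comp hrm
  have hlogint : Integrable (fun x => Real.log (r x)) μ := by
    refine Integrable.of_bound hlogm.aestronglyMeasurable (Real.log D) ?_
    filter_upwards [hpos] with x hx
    exact hlogb _ hx.1 hx.2.1 hx.2.2
  have hcomp : ∀ k : ℕ, Integrable (fun x => Real.log (r (gaussMap^[k] x))) μ ∧
      ∫ x, Real.log (r (gaussMap^[k] x)) ∂μ = ∫ x, Real.log (r x) ∂μ := by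
    intro k
    have hk := G.mp.iterate k
    refine ⟨hk.integrable_comp_of_integrable hlogint, ?_⟩
    conv_rhs => rw [← hk.map_eq]
    rw [integral_map hk.measurable.aemeasurable hlogm.aestronglyMeasurable]
  have hzero : ∫ x, Real.log (r x) ∂μ = 0 := by
    by_contra hne
    obtain ⟨n, hn⟩ := exists_nat_gt (Real.log D / |∫ x, Real.log (r x) ∂μ|)
    have hsum : ∫ x, ∑ k ∈ Finset.range n, Real.log (r (gaussMap^[k] x)) ∂μ =
        n * ∫ x, Real.log (r x) ∂μ := by
      rw [integral_finsetSum _ fun k _ => (hcomp k).1, Finset.sum_congr rfl fun k _ => (hcomp k).2]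
      simp
    have hle : ‖∫ x, ∑ k ∈ Finset.range n, Real.log (r (gaussMap^[k] x)) ∂μ‖ ≤ Real.log D := by
      refine (norm_integral_le_of_norm_le_const (C := Real.log D) ?_).trans (by simp)
      filter_upwards [hb n, hposk] with x hx hx'
      rw [← Real.log_prod fun k _ => (hx' k).ne']
      exact hlogb _ (Finset.prod_pos fun k _ => hx' k) hx.1 hx.2
    rw [hsum, Real.norm_eq_abs, abs_mul, Nat.abs_cast] at hle
    rw [div_lt_iff₀ (abs_pos.2 hne)] at hn
    linarith
  have hRone : ∫⁻ x, R x ∂μ = 1 := by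
    have h1 := h 1 measurable_one
    simp only [Pi.one_apply, one_mul] at h1
    rw [← h1, lintegral_congr_ae (g := 1) (by filter_upwards [G.ae_mem] using G.transfer_one)]
    simp
  have hRfin : ∀ᵐ x ∂μ, R x < ⊤ := ae_lt_top hR (by rw [hRone]; exact ENNReal.one_ne_top)
  have hrint : Integrable r μ := integrable_toReal_of_lintegral_ne_top hR.aemeasurable
    (by rw [hRone]; exact ENNReal.one_ne_top)
  have hr1 : ∫ x, r x ∂μ = 1 := by
    rw [hr, integral_toReal hR.aemeasurable hRfin, hRone, ENNReal.toReal_one]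
  have hnn : 0 ≤ᵐ[μ] fun x => r x - 1 - Real.log (r x) := by
    filter_upwards [hpos] with x hx
    have := Real.log_le_sub_one_of_pos hx.1
    simp only [Pi.zero_apply]; linarith
  have hint0 : ∫ x, (r x - 1 - Real.log (r x)) ∂μ = 0 := by
    have h1 : Integrable (fun x => r x - 1) μ := hrint.sub (integrable_const _)
    rw [integral_sub h1 hlogint, integral_sub hrint (integrable_const _), hr1, hzero]
    simp
  have hae := (integral_eq_zero_iff_of_nonneg_ae hnn
    ((hrint.sub (integrable_const _)).sub hlogint)).1 hint0
  filter_upwards [hae, hpos, hRfin] with x hx hx0 hxf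
  by_contra hne
  have hr_ne : r x ≠ 1 := by
    intro h1
    apply hne
    rw [← ENNReal.ofReal_toReal hxf.ne, show (R x).toReal = 1 from h1, ENNReal.ofReal_one]
  have := Real.log_lt_sub_one_of_pos hx0.1 hr_ne
  simp only [Pi.zero_apply] at hx
  linarith

/-- A Gibbs measure of a normalized potential is fixed by the dual transfer operator. -/
theorem lintegral_transfer (G : GibbsSystem φ μ B θ C) {f : ℝ → ℝ≥0∞} (hf : Measurable f) :
    ∫⁻ y, transfer φ f y ∂μ = ∫⁻ y, f y ∂μ := by
  obtain ⟨R, hR, h⟩ := G.exists_density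
  rw [h f hf]
  refine lintegral_congr_ae ?_
  filter_upwards [G.density_eq_one hR h] with x hx
  rw [hx, mul_one]

theorem lintegral_iterate_transfer (G : GibbsSystem φ μ B θ C) {f : ℝ → ℝ≥0∞} (hf : Measurable f)
    (n : ℕ) : ∫⁻ y, (transfer φ)^[n] f y ∂μ = ∫⁻ y, f y ∂μ := by
  induction n with
  | zero => rfl
  | succ n ih =>
    simp only [Function.iterate_succ_apply']
    rw [G.lintegral_transfer (measurable_transfer_iterate G.meas hf n), ih]

/-- Conformality of the Gibbs measure along the inverse branch `T_c`. -/
theorem restrict_cylinder_eq (G : GibbsSystem φ μ B θ C) {c : List ℕ} (hc : PosWord c) :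
    μ.restrict (cylinder c) =
      (μ.withDensity fun y => ENNReal.ofReal (gw φ c y)).map (invBranch c) := by
  have hgm := (measurable_gw G.meas c).ennreal_ofReal
  refine Measure.ext_of_lintegral _ fun f hf => ?_
  rw [← lintegral_indicator (measurableSet_cylinder c),
    ← G.lintegral_iterate_transfer (hf.indicator (measurableSet_cylinder c)) c.length,
    lintegral_map hf (measurable_invBranch c),
    lintegral_withDensity_eq_lintegral_mul _ hgm (g := fun a => f (invBranch c a))
      (hf.comp (measurable_invBranch c))]
  refine lintegral_congr_ae ?_
  filter_upwards [G.ae_mem] with y hy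
  exact transfer_iterate_indicator f hc hy

theorem setIntegral_cylinder_eq (G : GibbsSystem φ μ B θ C) {c : List ℕ} (hc : PosWord c)
    {g : ℝ → ℂ} (hg : Measurable g) :
    ∫ x in cylinder c, g x ∂μ = ∫ y, (gw φ c y : ℂ) * g (invBranch c y) ∂μ := by
  rw [G.restrict_cylinder_eq hc, integral_map (measurable_invBranch c).aemeasurable
    hg.aestronglyMeasurable, integral_withDensity_eq_integral_toReal_smul
    (measurable_gw G.meas c).ennreal_ofReal (by simp)]
  refine integral_congr_ae (Eventually.of_forall fun y => ?_)
  simp only [ENNReal.toReal_ofReal (gw_pos φ c y).le, Complex.real_smul]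

end GibbsSystem

/-! ### Mixing of the transfer operator -/

theorem mem_cylinder_invBranch1 {a : ℕ} (ha : 0 < a) {d : List ℕ} {x : ℝ} (hx : x ∈ cylinder d) :
    invBranch1 a x ∈ cylinder (a :: d) := by
  rw [mem_cylinder_cons, cfDigit1_invBranch1 _ hx.1, gaussMap_invBranch1 _ hx.1]
  exact ⟨invBranch1_mem ha hx.1, rfl, hx⟩

theorem wsum_singleton (φ : ℝ → ℝ) (a : ℕ) {x : ℝ} (hx : x ∈ gaussSet) :
    wsum φ [a] x = φ (invBranch1 a x) := by
  rw [wsum_cons φ a PosWord.nil hx, wsum_nil, add_zero, invBranch_nil]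

namespace GibbsSystem

variable {φ : ℝ → ℝ} {μ : Measure ℝ} {B θ C : ℝ}

theorem transfer_iterate_comparison (G : GibbsSystem φ μ B θ C) (n : ℕ) {d : List ℕ}
    {u v : ℝ → ℝ≥0∞} {x y : ℝ} (hx : x ∈ cylinder d) (hy : y ∈ cylinder d)
    (h : ∀ l : List ℕ, l.length = n + d.length → ∀ z ∈ cylinder l, ∀ z' ∈ cylinder l, u z ≤ v z') :
    (transfer φ)^[n] u x ≤
      ENNReal.ofReal (Real.exp (B * θ ^ d.length * (1 - θ ^ n))) * (transfer φ)^[n] v y := by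
  induction n generalizing d x y with
  | zero => simpa using h d (by simp) x hx y hy
  | succ n ih =>
    rw [Function.iterate_succ_apply', Function.iterate_succ_apply', transfer, transfer,
      ← ENNReal.tsum_mul_left]
    refine ENNReal.tsum_le_tsum fun a => ?_
    have hax := mem_cylinder_invBranch1 a.2 hx
    have hay := mem_cylinder_invBranch1 a.2 hy
    have h1 := ih hax hay fun l hl => h l (by rw [hl, List.length_cons]; omega)
    rw [List.length_cons] at h1
    have h2 := G.distortion [(a : ℕ)] d (posWord_cons.2 ⟨a.2, PosWord.nil⟩) x hx y hy
    rw [wsum_singleton φ a hx.1, wsum_singleton φ a hy.1, List.length_singleton] at h2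
    have h3 : Real.exp (φ (invBranch1 a x)) ≤
        Real.exp (B * θ ^ d.length * (1 - θ ^ 1)) * Real.exp (φ (invBranch1 a y)) := by
      rw [← Real.exp_add, Real.exp_le_exp]; linarith
    have h4 : Real.exp (B * θ ^ d.length * (1 - θ ^ (n + 1))) =
        Real.exp (B * θ ^ d.length * (1 - θ ^ 1)) *
          Real.exp (B * θ ^ (d.length + 1) * (1 - θ ^ n)) := by
      rw [← Real.exp_add]; congr 1; ring
    calc _ ≤ ENNReal.ofReal (Real.exp (B * θ ^ d.length * (1 - θ ^ 1)) *
          Real.exp (φ (invBranch1 a y))) *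
          (ENNReal.ofReal (Real.exp (B * θ ^ (d.length + 1) * (1 - θ ^ n))) *
            (transfer φ)^[n] v (invBranch1 a y)) := by gcongr; exact h1
      _ = _ := by
        rw [h4, ENNReal.ofReal_mul (Real.exp_pos _).le, ENNReal.ofReal_mul (Real.exp_pos _).le]
        ring

theorem transfer_iterate_add_const (G : GibbsSystem φ μ B θ C) (u : ℝ → ℝ≥0∞) (k : ℝ≥0∞) (n : ℕ) :
    ∀ y ∈ gaussSet, (transfer φ)^[n] (fun x => u x + k) y = (transfer φ)^[n] u y + k := by
  induction n with
  | zero => intro y _; rfl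
  | succ n ih =>
    intro y hy
    rw [Function.iterate_succ_apply', Function.iterate_succ_apply', transfer, transfer]
    have h1 : ∀ a : ℕ+, (transfer φ)^[n] (fun x => u x + k) (invBranch1 a y) =
        (transfer φ)^[n] u (invBranch1 a y) + k := fun a => ih _ (invBranch1_mem a.2 hy)
    simp only [h1, mul_add]
    rw [ENNReal.tsum_add, ENNReal.tsum_mul_right, G.norm y hy, one_mul]

theorem transfer_iterate_add (u v : ℝ → ℝ≥0∞) (n : ℕ) (y : ℝ) :
    (transfer φ)^[n] (fun x => u x + v x) y = (transfer φ)^[n] u y + (transfer φ)^[n] v y := by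
  induction n generalizing y with
  | zero => rfl
  | succ n ih =>
    simp only [Function.iterate_succ_apply', transfer, ih, mul_add]
    rw [ENNReal.tsum_add]

/-- The transfer operator contracts oscillations. -/
theorem transfer_iterate_osc (G : GibbsSystem φ μ B θ C) {u : ℝ → ℝ≥0∞} {O η : ℝ} (hO : 0 ≤ O)
    (hη : 0 ≤ η) (hu : ∀ x ∈ gaussSet, ∀ y ∈ gaussSet, u x ≤ u y + ENNReal.ofReal O)
    (hfin : ∀ x ∈ gaussSet, u x ≠ ⊤) {n : ℕ}
    (hn : ∀ l : List ℕ, l.length = n → ∀ z ∈ cylinder l, ∀ z' ∈ cylinder l,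
      u z ≤ u z' + ENNReal.ofReal η) :
    ∀ x ∈ gaussSet, ∀ y ∈ gaussSet, (transfer φ)^[n] u x ≤ (transfer φ)^[n] u y +
      ENNReal.ofReal ((Real.exp B - 1) / (Real.exp B + 1) * O + 2 * η) := by
  obtain ⟨x₀, hx₀⟩ := G.nonempty
  set a : ℝ≥0∞ := ⨅ y : gaussSet, u y with ha
  have hau : ∀ x ∈ gaussSet, a ≤ u x := fun x hx => iInf_le (fun y : gaussSet => u y) ⟨x, hx⟩
  have hua : ∀ x ∈ gaussSet, u x ≤ a + ENNReal.ofReal O := by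
    intro x hx
    rw [ha, ENNReal.iInf_add]
    exact le_iInf fun y => hu x hx y y.2
  have ha_top : a ≠ ⊤ := ((hau x₀ hx₀).trans_lt (hfin x₀ hx₀).lt_top).ne
  have hbt : a + ENNReal.ofReal O ≠ ⊤ := ENNReal.add_ne_top.2 ⟨ha_top, ENNReal.ofReal_ne_top⟩
  set u₁ : ℝ → ℝ≥0∞ := fun x => u x - a with hu₁
  set u₂ : ℝ → ℝ≥0∞ := fun x => a + ENNReal.ofReal O - u x with hu₂
  have hsum : ∀ x ∈ gaussSet, u₁ x + u₂ x = ENNReal.ofReal O := by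
    intro x hx
    have h1 : a + (u₁ x + u₂ x) = a + ENNReal.ofReal O := by
      rw [← add_assoc, hu₁, add_tsub_cancel_of_le (hau x hx), hu₂,
        add_tsub_cancel_of_le (hua x hx)]
    exact (ENNReal.add_right_inj ha_top).1 h1
  have hLsum : ∀ x ∈ gaussSet, (transfer φ)^[n] u₁ x + (transfer φ)^[n] u₂ x =
      ENNReal.ofReal O := by
    intro x hx
    rw [← transfer_iterate_add, transfer_iterate_congr (g := fun x => (fun _ => 0) x +
      ENNReal.ofReal O) (fun z hz => by rw [hsum z hz]; simp) n hx,
      G.transfer_iterate_add_const (fun _ => 0) _ n x hx]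
    have : (transfer φ)^[n] (fun _ => 0) x = 0 := by
      have h0 : transfer φ (fun _ => 0) = fun _ => 0 := by ext y; simp [transfer]
      have : (transfer φ)^[n] (fun _ => 0) = fun _ => 0 := by
        induction n with
        | zero => rfl
        | succ k ih => rw [Function.iterate_succ_apply, h0]; exact Function.iterate_fixed h0 k
      rw [this]
    rw [this, zero_add]
  have hLu : ∀ x ∈ gaussSet, (transfer φ)^[n] u x = (transfer φ)^[n] u₁ x + a := by
    intro x hx
    rw [← G.transfer_iterate_add_const _ _ n x hx]
    exact transfer_iterate_congr (fun z hz => (tsub_add_cancel_of_le (hau z hz)).symm) n hx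
  have hexp : ENNReal.ofReal (Real.exp (B * θ ^ ([] : List ℕ).length * (1 - θ ^ n))) ≤
      ENNReal.ofReal (Real.exp B) := by
    refine ENNReal.ofReal_le_ofReal (Real.exp_le_exp.2 ?_)
    have := pow_nonneg G.theta_pos.le n
    simp only [List.length_nil, pow_zero, mul_one]
    nlinarith [G.B_nonneg]
  have hcomp : ∀ (w : ℝ → ℝ≥0∞), (∀ l : List ℕ, l.length = n → ∀ z ∈ cylinder l,
      ∀ z' ∈ cylinder l, w z ≤ w z' + ENNReal.ofReal η) → ∀ x ∈ gaussSet, ∀ y ∈ gaussSet,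
      (transfer φ)^[n] w x ≤ ENNReal.ofReal (Real.exp B) *
        ((transfer φ)^[n] w y + ENNReal.ofReal η) := by
    intro w hw x hx y hy
    rw [← G.transfer_iterate_add_const w _ n y hy]
    refine (G.transfer_iterate_comparison n (d := []) (by rwa [cylinder_nil])
      (by rwa [cylinder_nil]) (fun l hl => hw l (by simpa using hl))).trans ?_
    gcongr
  have hc₁ := hcomp u₁ fun l hl z hz z' hz' => by
    have := hn l hl z hz z' hz'
    simp only [hu₁]
    rw [tsub_le_iff_right, add_right_comm, tsub_add_cancel_of_le (hau z' hz'.1)]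
    exact this
  have hc₂ := hcomp u₂ fun l hl z hz z' hz' => by
    have := hn l hl z' hz' z hz
    simp only [hu₂]
    rw [tsub_le_iff_right]
    calc a + ENNReal.ofReal O = (a + ENNReal.ofReal O - u z') + u z' :=
          (tsub_add_cancel_of_le (hua z' hz'.1)).symm
      _ ≤ (a + ENNReal.ofReal O - u z') + (u z + ENNReal.ofReal η) := by gcongr
      _ = _ := by ring
  intro x hx y hy
  have h1 := hc₁ x hx y hy
  have h2 := hc₂ y hy x hx
  have s1 := hLsum x hx
  have s2 := hLsum y hy
  rw [hLu x hx, hLu y hy]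
  have fin : ∀ z ∈ gaussSet, (transfer φ)^[n] u₁ z ≠ ⊤ ∧ (transfer φ)^[n] u₂ z ≠ ⊤ :=
    fun z hz => ENNReal.add_ne_top.1 ((hLsum z hz).trans_ne ENNReal.ofReal_ne_top)
  obtain ⟨p, hp⟩ : ∃ p : ℝ≥0, (transfer φ)^[n] u₁ x = p := ⟨_, (ENNReal.coe_toNNReal (fin x hx).1).symm⟩
  obtain ⟨p', hp'⟩ : ∃ p : ℝ≥0, (transfer φ)^[n] u₂ x = p :=
    ⟨_, (ENNReal.coe_toNNReal (fin x hx).2).symm⟩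
  obtain ⟨q, hq⟩ : ∃ p : ℝ≥0, (transfer φ)^[n] u₁ y = p := ⟨_, (ENNReal.coe_toNNReal (fin y hy).1).symm⟩
  obtain ⟨q', hq'⟩ : ∃ p : ℝ≥0, (transfer φ)^[n] u₂ y = p :=
    ⟨_, (ENNReal.coe_toNNReal (fin y hy).2).symm⟩
  rw [hp, hp'] at s1
  rw [hq, hq'] at s2
  rw [hp, hq] at h1
  rw [hp', hq'] at h2
  rw [hp, hq]
  have E0 : 1 ≤ Real.exp B := Real.one_le_exp G.B_nonneg
  have conv : ∀ r s : ℝ≥0, (r : ℝ≥0∞) ≤ ENNReal.ofReal (Real.exp B) * (s + ENNReal.ofReal η) →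
      (r : ℝ) ≤ Real.exp B * (s + η) := by
    intro r s h
    rw [← ENNReal.ofReal_coe_nnreal, ← ENNReal.ofReal_coe_nnreal (p := s),
      ← ENNReal.ofReal_add s.coe_nonneg hη, ← ENNReal.ofReal_mul (Real.exp_pos _).le] at h
    exact (ENNReal.ofReal_le_ofReal_iff (mul_nonneg (Real.exp_pos _).le
      (add_nonneg s.coe_nonneg hη))).1 h
  have conv2 : ∀ r s : ℝ≥0, (r : ℝ≥0∞) + s = ENNReal.ofReal O → (r : ℝ) + s = O := by
    intro r s h
    have := congrArg ENNReal.toReal h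
    rwa [ENNReal.toReal_ofReal hO, ENNReal.toReal_add ENNReal.coe_ne_top ENNReal.coe_ne_top] at this
  have r1 := conv _ _ h1
  have r2 := conv _ _ h2
  have r3 := conv2 _ _ s1
  have r4 := conv2 _ _ s2
  have key : (p : ℝ) ≤ q + ((Real.exp B - 1) / (Real.exp B + 1) * O + 2 * η) := by
    have e1 : (0 : ℝ) < Real.exp B + 1 := by linarith
    have : (p - q : ℝ) * (Real.exp B + 1) ≤ (Real.exp B - 1) * O + 2 * η * (Real.exp B + 1) := by
      nlinarith
    have h5 : (Real.exp B - 1) / (Real.exp B + 1) * O + 2 * η =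
        ((Real.exp B - 1) * O + 2 * η * (Real.exp B + 1)) / (Real.exp B + 1) := by
      field_simp
    have h6 : (p - q : ℝ) ≤ (Real.exp B - 1) / (Real.exp B + 1) * O + 2 * η := by
      rw [h5, le_div_iff₀ e1]; exact this
    linarith
  have hnn : 0 ≤ (Real.exp B - 1) / (Real.exp B + 1) * O + 2 * η := by
    have : 0 ≤ (Real.exp B - 1) / (Real.exp B + 1) := div_nonneg (by linarith) (by linarith)
    positivity
  rw [add_right_comm]
  gcongr
  rw [← ENNReal.ofReal_coe_nnreal, ← ENNReal.ofReal_coe_nnreal (p := q),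
    ← ENNReal.ofReal_add q.coe_nonneg hnn]
  exact ENNReal.ofReal_le_ofReal key

end GibbsSystem

/-! ### Large deviations -/

/-- Hypotheses on an observable: nonnegative, uniformly continuous along cylinders, with
uniformly bounded exponential moments under the transfer operator. -/
structure TameObservable (φ f : ℝ → ℝ) (ω : ℕ → ℝ) (τ Q : ℝ) : Prop where
  meas : Measurable f
  nonneg : ∀ x ∈ gaussSet, 0 ≤ f x
  osc : ∀ j : ℕ, 1 ≤ j → ∀ l : List ℕ, PosWord l → j ≤ l.length →
    ∀ x ∈ cylinder l, ∀ y ∈ cylinder l, f x ≤ f y + ω j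
  osc_tendsto : Tendsto ω atTop (𝓝 0)
  osc_nonneg : ∀ j, 0 ≤ ω j
  tau_pos : 0 < τ
  one_le_Q : 1 ≤ Q
  moment : ∀ y ∈ gaussSet,
    transfer φ (fun x => ENNReal.ofReal (Real.exp (τ * f x))) y ≤ ENNReal.ofReal Q

namespace GibbsSystem

variable {φ : ℝ → ℝ} {μ : Measure ℝ} {B θ C : ℝ} {f : ℝ → ℝ} {ω : ℕ → ℝ} {τ Q : ℝ}

theorem transfer_iterate_le_of_le (G : GibbsSystem φ μ B θ C) {F : ℝ → ℝ≥0∞} {c : ℝ≥0∞}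
    (h : ∀ y ∈ gaussSet, F y ≤ c) (n : ℕ) : ∀ y ∈ gaussSet, (transfer φ)^[n] F y ≤ c := by
  intro y hy
  refine (transfer_iterate_mono_on (g := fun x => (fun _ => 0) x + c)
    (fun x hx => by simpa using h x hx) n y hy).trans ?_
  rw [G.transfer_iterate_add_const _ _ n y hy]
  have h0 : (transfer φ)^[n] (fun _ => 0) = fun _ => 0 := by
    have h0 : transfer φ (fun _ => 0) = fun _ => 0 := by ext y; simp [transfer]
    exact Function.iterate_fixed h0 n
  rw [h0, zero_add]

theorem transfer_iterate_observable_le (G : GibbsSystem φ μ B θ C)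
    (hf : TameObservable φ f ω τ Q) (k : ℕ) : ∀ y ∈ gaussSet,
      (transfer φ)^[k + 1] (fun x => ENNReal.ofReal (f x)) y ≤ ENNReal.ofReal (Q / τ) := by
  have h1 : ∀ y ∈ gaussSet, transfer φ (fun x => ENNReal.ofReal (f x)) y ≤
      ENNReal.ofReal (Q / τ) := by
    intro y hy
    have h2 : ∀ x ∈ gaussSet, ENNReal.ofReal (f x) ≤
        ENNReal.ofReal (Real.exp (τ * f x)) * (fun _ => ENNReal.ofReal τ⁻¹) (gaussMap x) := by
      intro x _
      rw [← ENNReal.ofReal_mul (Real.exp_pos _).le]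
      refine ENNReal.ofReal_le_ofReal ?_
      rw [← div_eq_mul_inv, le_div_iff₀ hf.tau_pos]
      linarith [Real.add_one_le_exp (τ * f x)]
    refine (transfer_mono_on h2 hy).trans ?_
    refine (transfer_mul_comp (fun x => ENNReal.ofReal (Real.exp (τ * f x)))
      (fun _ => ENNReal.ofReal τ⁻¹) hy).le.trans ?_
    rw [div_eq_mul_inv, ENNReal.ofReal_mul (zero_le_one.trans hf.one_le_Q)]
    gcongr
    exact hf.moment y hy
  intro y hy
  rw [Function.iterate_succ_apply]
  exact G.transfer_iterate_le_of_le h1 k y hy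

theorem transfer_iterate_observable_osc (G : GibbsSystem φ μ B θ C)
    (hf : TameObservable φ f ω τ Q) (k : ℕ) {j : ℕ} (hj : 1 ≤ j) {l : List ℕ} (hl : l.length = j)
    {x y : ℝ} (hx : x ∈ cylinder l) (hy : y ∈ cylinder l) :
    (transfer φ)^[k + 1] (fun x => ENNReal.ofReal (f x)) x ≤
      (transfer φ)^[k + 1] (fun x => ENNReal.ofReal (f x)) y +
        ENNReal.ofReal ((Real.exp (B * θ ^ j) - 1) * (Q / τ) + Real.exp B * ω j) := by
  have h1 := G.transfer_iterate_comparison (k + 1) (u := fun x => ENNReal.ofReal (f x))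
    (v := fun x => ENNReal.ofReal (f x) + ENNReal.ofReal (ω j)) hx hy (by
      intro l' hl' z hz z' hz'
      rw [← ENNReal.ofReal_add (hf.nonneg _ hz'.1) (hf.osc_nonneg j)]
      exact ENNReal.ofReal_le_ofReal
        (hf.osc j hj l' (posWord_of_mem_cylinder hz) (by omega) z hz z' hz'))
  rw [G.transfer_iterate_add_const _ _ _ y hy.1] at h1
  refine h1.trans ?_
  have hb := G.transfer_iterate_observable_le hf k y hy.1
  set u := (transfer φ)^[k + 1] (fun x => ENNReal.ofReal (f x)) y with hu
  have hut : u ≠ ⊤ := (hb.trans_lt ENNReal.ofReal_lt_top).ne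
  obtain ⟨p, hp⟩ : ∃ p : ℝ≥0, u = p := ⟨_, (ENNReal.coe_toNNReal hut).symm⟩
  have hQτ : 0 ≤ Q / τ := div_nonneg (zero_le_one.trans hf.one_le_Q) hf.tau_pos.le
  have hpb : (p : ℝ) ≤ Q / τ := by
    rw [hp, ← ENNReal.ofReal_coe_nnreal] at hb
    exact (ENNReal.ofReal_le_ofReal_iff hQτ).1 hb
  have hθj : 0 ≤ θ ^ j := pow_nonneg G.theta_pos.le j
  have hθj1 : θ ^ j ≤ 1 := pow_le_one₀ G.theta_pos.le G.theta_lt.le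
  have hθk : 0 ≤ θ ^ (k + 1) := pow_nonneg G.theta_pos.le _
  have hB := G.B_nonneg
  have e1 : Real.exp (B * θ ^ l.length * (1 - θ ^ (k + 1))) ≤ Real.exp (B * θ ^ j) := by
    rw [hl, Real.exp_le_exp]
    nlinarith [mul_nonneg (mul_nonneg hB hθj) hθk]
  have e2 : Real.exp (B * θ ^ j) ≤ Real.exp B := by
    rw [Real.exp_le_exp]; nlinarith
  have e3 : 1 ≤ Real.exp (B * θ ^ j) := Real.one_le_exp (mul_nonneg hB hθj)
  have hω := hf.osc_nonneg j
  rw [hp, ← ENNReal.ofReal_coe_nnreal, ← ENNReal.ofReal_add p.coe_nonneg hω,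
    ← ENNReal.ofReal_mul (Real.exp_pos _).le, ← ENNReal.ofReal_add p.coe_nonneg
      (add_nonneg (mul_nonneg (by linarith) hQτ) (mul_nonneg (Real.exp_pos _).le hω))]
  refine ENNReal.ofReal_le_ofReal ?_
  have hp0 : (0 : ℝ) ≤ p := p.coe_nonneg
  calc _ ≤ Real.exp (B * θ ^ j) * (p + ω j) := by gcongr
    _ = p + (Real.exp (B * θ ^ j) - 1) * p + Real.exp (B * θ ^ j) * ω j := by ring
    _ ≤ p + (Real.exp (B * θ ^ j) - 1) * (Q / τ) + Real.exp B * ω j := by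
        have : 0 ≤ Real.exp (B * θ ^ j) - 1 := by linarith
        gcongr
    _ = _ := by ring

theorem exists_osc_le (G : GibbsSystem φ μ B θ C) (hf : TameObservable φ f ω τ Q) {ε : ℝ}
    (hε : 0 < ε) : ∃ k₀ : ℕ, ∀ k ≥ k₀, ∀ x ∈ gaussSet, ∀ y ∈ gaussSet,
      (transfer φ)^[k + 1] (fun x => ENNReal.ofReal (f x)) x ≤
        (transfer φ)^[k + 1] (fun x => ENNReal.ofReal (f x)) y + ENNReal.ofReal ε := by
  set ρ : ℝ := (Real.exp B - 1) / (Real.exp B + 1) with hρ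
  have E0 : 1 ≤ Real.exp B := Real.one_le_exp G.B_nonneg
  have hρ0 : 0 ≤ ρ := div_nonneg (by linarith) (by linarith)
  have hρ1 : ρ < 1 := by rw [hρ, div_lt_one (by linarith)]; linarith
  have hQτ : 0 ≤ Q / τ := div_nonneg (zero_le_one.trans hf.one_le_Q) hf.tau_pos.le
  set η : ℕ → ℝ := fun j => (Real.exp (B * θ ^ j) - 1) * (Q / τ) + Real.exp B * ω j with hη
  have hη0 : ∀ j, 0 ≤ η j := fun j => by
    have : 1 ≤ Real.exp (B * θ ^ j) :=
      Real.one_le_exp (mul_nonneg G.B_nonneg (pow_nonneg G.theta_pos.le j))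
    exact add_nonneg (mul_nonneg (by linarith) hQτ)
      (mul_nonneg (Real.exp_pos _).le (hf.osc_nonneg j))
  have hηt : Tendsto η atTop (𝓝 0) := by
    have h1 : Tendsto (fun j : ℕ => θ ^ j) atTop (𝓝 0) :=
      tendsto_pow_atTop_nhds_zero_of_lt_one G.theta_pos.le G.theta_lt
    have h2 := (Real.continuous_exp.tendsto _).comp (h1.const_mul B)
    have := ((h2.sub_const 1).mul_const (Q / τ)).add (hf.osc_tendsto.const_mul (Real.exp B))
    simpa using this
  obtain ⟨n, hn1, hn⟩ : ∃ n, 1 ≤ n ∧ 2 * η n / (1 - ρ) ≤ ε / 2 := by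
    have h1 : Tendsto (fun n => 2 * η n / (1 - ρ)) atTop (𝓝 0) := by
      simpa using (hηt.const_mul 2).div_const (1 - ρ)
    obtain ⟨N, hN⟩ := (((h1.eventually (ge_mem_nhds (half_pos hε))).and
      (eventually_ge_atTop 1))).exists
    exact ⟨N, hN.2, hN.1⟩
  have hρ' : 0 < 1 - ρ := by linarith
  have key : ∀ i : ℕ, ∀ k ≥ i * n, ∀ x ∈ gaussSet, ∀ y ∈ gaussSet,
      (transfer φ)^[k + 1] (fun x => ENNReal.ofReal (f x)) x ≤
        (transfer φ)^[k + 1] (fun x => ENNReal.ofReal (f x)) y +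
          ENNReal.ofReal (ρ ^ i * (Q / τ) + 2 * η n / (1 - ρ)) := by
    intro i
    induction i with
    | zero =>
      intro k _ x hx y _
      refine (G.transfer_iterate_observable_le hf k x hx).trans (le_add_left ?_)
      refine ENNReal.ofReal_le_ofReal ?_
      have := div_nonneg (mul_nonneg zero_le_two (hη0 n)) hρ'.le
      rw [pow_zero]; linarith
    | succ i ih =>
      intro k hk x hx y hy
      have hk' : k + 1 = n + (k - n + 1) := by rw [Nat.succ_mul] at hk; omega
      rw [hk', Function.iterate_add_apply]
      have h1 := G.transfer_iterate_osc (u := (transfer φ)^[k - n + 1] fun x => ENNReal.ofReal (f x))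
        (O := ρ ^ i * (Q / τ) + 2 * η n / (1 - ρ)) (η := η n) (n := n)
        (add_nonneg (by positivity) (div_nonneg (mul_nonneg zero_le_two (hη0 n)) hρ'.le))
        (hη0 n) (ih (k - n) (by rw [Nat.succ_mul] at hk; omega))
        (fun x hx => ((G.transfer_iterate_observable_le hf _ x hx).trans_lt
          ENNReal.ofReal_lt_top).ne)
        (fun l hl z hz z' hz' => G.transfer_iterate_observable_osc hf _ hn1 hl hz hz') x hx y hy
      refine h1.trans (le_of_eq ?_)
      congr 2
      rw [← hρ]
      field_simp
      ring
  obtain ⟨i, hi⟩ : ∃ i : ℕ, ρ ^ i * (Q / τ) ≤ ε / 2 := by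
    have h1 : Tendsto (fun i : ℕ => ρ ^ i * (Q / τ)) atTop (𝓝 0) := by
      simpa using (tendsto_pow_atTop_nhds_zero_of_lt_one hρ0 hρ1).mul_const (Q / τ)
    exact (h1.eventually (ge_mem_nhds (half_pos hε))).exists
  refine ⟨i * n, fun k hk x hx y hy => (key i k hk x hx y hy).trans ?_⟩
  gcongr
  linarith

theorem lintegral_observable_le (G : GibbsSystem φ μ B θ C) (hf : TameObservable φ f ω τ Q) :
    ∫⁻ x, ENNReal.ofReal (f x) ∂μ ≤ ENNReal.ofReal (Q / τ) := by
  have := G.prob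
  rw [← G.lintegral_iterate_transfer hf.meas.ennreal_ofReal 1]
  calc _ ≤ ∫⁻ _, ENNReal.ofReal (Q / τ) ∂μ := by
        refine lintegral_mono_ae ?_
        filter_upwards [G.ae_mem] with y hy using G.transfer_iterate_observable_le hf 0 y hy
    _ = _ := by simp

theorem integrable_observable (G : GibbsSystem φ μ B θ C) (hf : TameObservable φ f ω τ Q) :
    Integrable f μ := by
  refine ⟨hf.meas.aestronglyMeasurable, ?_⟩
  rw [hasFiniteIntegral_iff_ofReal]
  · exact (G.lintegral_observable_le hf).trans_lt ENNReal.ofReal_lt_top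
  · filter_upwards [G.ae_mem] with y hy using hf.nonneg y hy

theorem lintegral_observable_eq (G : GibbsSystem φ μ B θ C) (hf : TameObservable φ f ω τ Q) :
    ∫⁻ x, ENNReal.ofReal (f x) ∂μ = ENNReal.ofReal (∫ x, f x ∂μ) := by
  rw [ofReal_integral_eq_lintegral_ofReal (G.integrable_observable hf)]
  filter_upwards [G.ae_mem] with y hy using hf.nonneg y hy

theorem integral_observable_nonneg (G : GibbsSystem φ μ B θ C) (hf : TameObservable φ f ω τ Q) :
    0 ≤ ∫ x, f x ∂μ :=
  integral_nonneg_of_ae (by filter_upwards [G.ae_mem] with y hy using hf.nonneg y hy)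

/-- Bounds for iterates of the transfer operator in terms of the mean, given their oscillation. -/
theorem transfer_iterate_near_integral (G : GibbsSystem φ μ B θ C)
    (hf : TameObservable φ f ω τ Q) {k : ℕ} {ε : ℝ} (hε : 0 ≤ ε)
    (h : ∀ x ∈ gaussSet, ∀ y ∈ gaussSet,
      (transfer φ)^[k] (fun x => ENNReal.ofReal (f x)) x ≤
        (transfer φ)^[k] (fun x => ENNReal.ofReal (f x)) y + ENNReal.ofReal ε) :
    ∀ x ∈ gaussSet, (transfer φ)^[k] (fun x => ENNReal.ofReal (f x)) x ≤
        ENNReal.ofReal (∫ x, f x ∂μ + ε) ∧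
      ENNReal.ofReal (∫ x, f x ∂μ) ≤
        (transfer φ)^[k] (fun x => ENNReal.ofReal (f x)) x + ENNReal.ofReal ε := by
  have := G.prob
  intro x hx
  have hm := measurable_transfer_iterate G.meas hf.meas.ennreal_ofReal k
  have hI : ∫⁻ y, (transfer φ)^[k] (fun x => ENNReal.ofReal (f x)) y ∂μ =
      ENNReal.ofReal (∫ x, f x ∂μ) := by
    rw [G.lintegral_iterate_transfer hf.meas.ennreal_ofReal, G.lintegral_observable_eq hf]
  constructor
  · rw [ENNReal.ofReal_add (G.integral_observable_nonneg hf) hε, ← hI]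
    calc _ = ∫⁻ _, (transfer φ)^[k] (fun x => ENNReal.ofReal (f x)) x ∂μ := by simp
      _ ≤ ∫⁻ y, ((transfer φ)^[k] (fun x => ENNReal.ofReal (f x)) y + ENNReal.ofReal ε) ∂μ := by
          refine lintegral_mono_ae ?_
          filter_upwards [G.ae_mem] with y hy using h x hx y hy
      _ = _ := by rw [lintegral_add_left hm]; simp
  · rw [← hI]
    calc _ ≤ ∫⁻ _, ((transfer φ)^[k] (fun x => ENNReal.ofReal (f x)) x + ENNReal.ofReal ε) ∂μ := by
          refine lintegral_mono_ae ?_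
          filter_upwards [G.ae_mem] with y hy using h y hy x hx
      _ = _ := by simp

/-- The transfer operator applied to Birkhoff sums. -/
theorem transfer_iterate_birkhoff (G : GibbsSystem φ μ B θ C) (hf : ∀ x ∈ gaussSet, 0 ≤ f x)
    (n : ℕ) : ∀ y ∈ gaussSet,
      (transfer φ)^[n] (fun x => ENNReal.ofReal (birkhoff f n x)) y =
        ∑ j ∈ Finset.range n, (transfer φ)^[j + 1] (fun x => ENNReal.ofReal (f x)) y := by
  induction n with
  | zero => intro y _; simp [birkhoff]
  | succ n ih =>
    intro y hy
    have h1 : ∀ x ∈ gaussSet, ENNReal.ofReal (birkhoff f (n + 1) x) =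
        ENNReal.ofReal (f x) + ENNReal.ofReal (birkhoff f n (gaussMap x)) := by
      intro x hx
      rw [birkhoff_succ, ENNReal.ofReal_add (hf x hx)]
      exact Finset.sum_nonneg fun k _ => hf _ (gaussMap_iterate_mem (gaussMap_mem hx) k)
    rw [transfer_iterate_congr h1 _ hy, transfer_iterate_add, Finset.sum_range_succ, add_comm]
    congr 1
    rw [Function.iterate_succ_apply, ← ih y hy]
    refine transfer_iterate_congr (fun x hx => ?_) n hy
    have := transfer_mul_comp (φ := φ) 1 (fun x => ENNReal.ofReal (birkhoff f n x)) hx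
    simp only [Pi.one_apply, one_mul] at this
    rw [this]
    have h2 := G.transfer_one x hx
    rw [h2, one_mul]

end GibbsSystem

theorem transfer_iterate_const_mul (φ : ℝ → ℝ) (c : ℝ≥0∞) (u : ℝ → ℝ≥0∞) (n : ℕ) (y : ℝ) :
    (transfer φ)^[n] (fun x => c * u x) y = c * (transfer φ)^[n] u y := by
  induction n generalizing y with
  | zero => rfl
  | succ n ih =>
    simp only [Function.iterate_succ_apply', transfer, ih]
    rw [← ENNReal.tsum_mul_left]
    exact tsum_congr fun a => by ring

theorem birkhoff_const_mul (c : ℝ) (f : ℝ → ℝ) (n : ℕ) (x : ℝ) :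
    birkhoff (fun x => c * f x) n x = c * birkhoff f n x := by
  rw [birkhoff, birkhoff, Finset.mul_sum]

theorem birkhoff_nonneg {f : ℝ → ℝ} (hf : ∀ x ∈ gaussSet, 0 ≤ f x) (n : ℕ) {x : ℝ}
    (hx : x ∈ gaussSet) : 0 ≤ birkhoff f n x :=
  Finset.sum_nonneg fun k _ => hf _ (gaussMap_iterate_mem hx k)

theorem exp_le_quadratic {v : ℝ} (hv : 0 ≤ v) : Real.exp v ≤ 1 + v + v ^ 2 * Real.exp v := by
  have h1 : 1 - v ≤ Real.exp (-v) := by linarith [Real.add_one_le_exp (-v)]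
  have h2 : Real.exp (-v) * Real.exp v = 1 := by rw [← Real.exp_add]; simp
  have h3 := Real.exp_pos v
  nlinarith [mul_le_mul_of_nonneg_right h1 h3.le, mul_nonneg hv h3.le]

theorem exp_neg_le_quadratic {v : ℝ} (hv : 0 ≤ v) : Real.exp (-v) ≤ 1 - v + v ^ 2 := by
  have h1 : 1 + v ≤ Real.exp v := by linarith [Real.add_one_le_exp v]
  have h2 : Real.exp (-v) * Real.exp v = 1 := by rw [← Real.exp_add]; simp
  have h3 := Real.exp_pos (-v)
  have h4 : Real.exp (-v) * (1 + v) ≤ 1 := by nlinarith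
  have h5 : 1 ≤ (1 - v + v ^ 2) * (1 + v) := by nlinarith [pow_nonneg hv 3]
  by_contra! h
  nlinarith

theorem sq_mul_exp_le {τ t S : ℝ} (hτ : 0 < τ) (htτ : t ≤ τ / 2) (hS : 0 ≤ S) :
    (t * S) ^ 2 * Real.exp (t * S) ≤ t ^ 2 * (8 / τ ^ 2) * Real.exp (τ * S) := by
  have h1 : S ^ 2 ≤ 8 / τ ^ 2 * Real.exp (τ / 2 * S) := by
    have h := Real.quadratic_le_exp_of_nonneg (x := τ / 2 * S) (by positivity)
    rw [div_mul_eq_mul_div, le_div_iff₀ (by positivity)]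
    nlinarith [mul_nonneg hτ.le hS]
  have h2 : Real.exp (t * S) ≤ Real.exp (τ / 2 * S) := by gcongr
  calc (t * S) ^ 2 * Real.exp (t * S) = t ^ 2 * S ^ 2 * Real.exp (t * S) := by ring
    _ ≤ t ^ 2 * (8 / τ ^ 2 * Real.exp (τ / 2 * S)) * Real.exp (τ / 2 * S) := by gcongr
    _ = t ^ 2 * (8 / τ ^ 2) * (Real.exp (τ / 2 * S) * Real.exp (τ / 2 * S)) := by ring
    _ = _ := by rw [← Real.exp_add]; congr 2; ring

namespace GibbsSystem

variable {φ : ℝ → ℝ} {μ : Measure ℝ} {B θ C : ℝ} {f : ℝ → ℝ} {ω : ℕ → ℝ} {τ Q : ℝ}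

theorem exists_birkhoff_block (G : GibbsSystem φ μ B θ C) (hf : TameObservable φ f ω τ Q) {ε : ℝ}
    (hε : 0 < ε) : ∃ N : ℕ, 1 ≤ N ∧ ∀ y ∈ gaussSet,
      (transfer φ)^[N] (fun x => ENNReal.ofReal (birkhoff f N x)) y ≤
        ENNReal.ofReal (N * (∫ x, f x ∂μ + ε)) ∧
      ENNReal.ofReal (N * ∫ x, f x ∂μ) ≤
        (transfer φ)^[N] (fun x => ENNReal.ofReal (birkhoff f N x)) y +
          ENNReal.ofReal (N * ε) := by
  obtain ⟨k₀, hk₀⟩ := G.exists_osc_le hf (half_pos hε)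
  set D := Q / τ with hD
  have hD0 : 0 ≤ D := div_nonneg (zero_le_one.trans hf.one_le_Q) hf.tau_pos.le
  have hm := G.integral_observable_nonneg hf
  set m := ∫ x, f x ∂μ
  set o : ℕ → ℝ := fun j => (if j < k₀ then D else 0) + ε / 2 with ho
  have ho0 : ∀ j, 0 ≤ o j := fun j => by
    simp only [ho]; split_ifs <;> linarith
  have hosc : ∀ j, ∀ x ∈ gaussSet, ∀ y ∈ gaussSet,
      (transfer φ)^[j + 1] (fun x => ENNReal.ofReal (f x)) x ≤
        (transfer φ)^[j + 1] (fun x => ENNReal.ofReal (f x)) y + ENNReal.ofReal (o j) := by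
    intro j x hx y hy
    by_cases hj : j < k₀
    · refine (G.transfer_iterate_observable_le hf j x hx).trans (le_add_left ?_)
      refine ENNReal.ofReal_le_ofReal ?_
      simp only [ho, hj, if_true]; linarith
    · simpa [ho, hj] using hk₀ j (not_lt.1 hj) x hx y hy
  have hsum : ∀ N : ℕ, ∑ j ∈ Finset.range N, o j ≤ k₀ * D + N * (ε / 2) := by
    intro N
    rw [Finset.sum_add_distrib, ← Finset.sum_filter, Finset.sum_const, Finset.sum_const,
      Finset.card_range, nsmul_eq_mul, nsmul_eq_mul]
    have : ((Finset.range N).filter (· < k₀)).card ≤ k₀ := by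
      refine (Finset.card_le_card (t := Finset.range k₀) fun j hj => ?_).trans_eq
        (Finset.card_range _)
      simpa using (Finset.mem_filter.1 hj).2
    gcongr
  obtain ⟨N, hN⟩ := exists_nat_ge (k₀ * D / (ε / 2))
  refine ⟨N + 1, by omega, fun y hy => ?_⟩
  have hN' : ∑ j ∈ Finset.range (N + 1), o j ≤ (N + 1 : ℕ) * ε := by
    refine (hsum _).trans ?_
    rw [div_le_iff₀ (half_pos hε)] at hN
    push_cast
    nlinarith
  have hnear := fun j => G.transfer_iterate_near_integral hf (ho0 j) (hosc j) y hy
  rw [G.transfer_iterate_birkhoff hf.nonneg _ y hy]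
  constructor
  · calc _ ≤ ∑ j ∈ Finset.range (N + 1), ENNReal.ofReal (m + o j) :=
          Finset.sum_le_sum fun j _ => (hnear j).1
      _ = ENNReal.ofReal (∑ j ∈ Finset.range (N + 1), (m + o j)) :=
          (ENNReal.ofReal_sum_of_nonneg fun j _ => add_nonneg hm (ho0 j)).symm
      _ ≤ _ := by
          refine ENNReal.ofReal_le_ofReal ?_
          rw [Finset.sum_add_distrib, Finset.sum_const, Finset.card_range, nsmul_eq_mul]
          linarith
  · calc _ = ∑ j ∈ Finset.range (N + 1), ENNReal.ofReal m := by
          rw [Finset.sum_const, Finset.card_range, nsmul_eq_mul,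
            ENNReal.ofReal_mul (Nat.cast_nonneg _), ENNReal.ofReal_natCast]
      _ ≤ ∑ j ∈ Finset.range (N + 1), ((transfer φ)^[j + 1] (fun x => ENNReal.ofReal (f x)) y +
            ENNReal.ofReal (o j)) := Finset.sum_le_sum fun j _ => (hnear j).2
      _ ≤ _ := by
          rw [Finset.sum_add_distrib, ← ENNReal.ofReal_sum_of_nonneg fun j _ => ho0 j]
          gcongr

theorem transfer_iterate_exp_birkhoff_le {g : ℝ → ℝ} {N : ℕ}
    {A : ℝ≥0∞} (hA : ∀ y ∈ gaussSet,
      (transfer φ)^[N] (fun x => ENNReal.ofReal (Real.exp (birkhoff g N x))) y ≤ A) (q : ℕ) :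
    ∀ y ∈ gaussSet, (transfer φ)^[N * q]
      (fun x => ENNReal.ofReal (Real.exp (birkhoff g (N * q) x))) y ≤ A ^ q := by
  induction q with
  | zero => intro y _; simp [birkhoff]
  | succ q ih =>
    intro y hy
    rw [Nat.mul_succ, Function.iterate_add_apply]
    have h1 : ∀ x ∈ gaussSet, (transfer φ)^[N]
        (fun x => ENNReal.ofReal (Real.exp (birkhoff g (N * q + N) x))) x ≤
        A * ENNReal.ofReal (Real.exp (birkhoff g (N * q) x)) := by
      intro x hx
      have h2 : (fun x => ENNReal.ofReal (Real.exp (birkhoff g (N * q + N) x))) = fun x =>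
          ENNReal.ofReal (Real.exp (birkhoff g N x)) *
            (fun x => ENNReal.ofReal (Real.exp (birkhoff g (N * q) x))) (gaussMap^[N] x) := by
        ext x
        rw [← ENNReal.ofReal_mul (Real.exp_pos _).le, ← Real.exp_add, ← birkhoff_add, add_comm]
      rw [h2]
      refine (transfer_iterate_mul_comp (fun x => ENNReal.ofReal (Real.exp (birkhoff g N x)))
        (fun x => ENNReal.ofReal (Real.exp (birkhoff g (N * q) x))) N hx).le.trans ?_
      gcongr
      exact hA x hx
    refine (transfer_iterate_mono_on h1 _ y hy).trans ?_
    rw [transfer_iterate_const_mul, pow_succ']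
    gcongr
    exact ih y hy

theorem lintegral_exp_birkhoff_le (G : GibbsSystem φ μ B θ C) {g : ℝ → ℝ} (hg : Measurable g)
    {N : ℕ} (hN : 1 ≤ N) {A R : ℝ≥0∞} (hA : ∀ y ∈ gaussSet,
      (transfer φ)^[N] (fun x => ENNReal.ofReal (Real.exp (birkhoff g N x))) y ≤ A)
    (hR : ∀ r < N, ∫⁻ x, ENNReal.ofReal (Real.exp (birkhoff g r x)) ∂μ ≤ R) (n : ℕ) :
    ∫⁻ x, ENNReal.ofReal (Real.exp (birkhoff g n x)) ∂μ ≤ A ^ (n / N) * R := by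
  have hm : ∀ n, Measurable fun x => ENNReal.ofReal (Real.exp (birkhoff g n x)) := fun n =>
    (measurable_birkhoff hg n).exp.ennreal_ofReal
  rw [← G.lintegral_iterate_transfer (hm n) (N * (n / N))]
  have h2 : (fun x => ENNReal.ofReal (Real.exp (birkhoff g n x))) = fun x =>
      ENNReal.ofReal (Real.exp (birkhoff g (N * (n / N)) x)) *
        (fun x => ENNReal.ofReal (Real.exp (birkhoff g (n % N) x)))
          (gaussMap^[N * (n / N)] x) := by
    ext x
    rw [← ENNReal.ofReal_mul (Real.exp_pos _).le, ← Real.exp_add, ← birkhoff_add,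
      Nat.div_add_mod]
  calc _ ≤ ∫⁻ x, A ^ (n / N) * ENNReal.ofReal (Real.exp (birkhoff g (n % N) x)) ∂μ := by
        refine lintegral_mono_ae ?_
        filter_upwards [G.ae_mem] with y hy
        rw [h2]
        refine (transfer_iterate_mul_comp
          (fun x => ENNReal.ofReal (Real.exp (birkhoff g (N * (n / N)) x)))
          (fun x => ENNReal.ofReal (Real.exp (birkhoff g (n % N) x))) _ hy).le.trans ?_
        gcongr
        exact transfer_iterate_exp_birkhoff_le hA _ y hy
    _ = A ^ (n / N) * ∫⁻ x, ENNReal.ofReal (Real.exp (birkhoff g (n % N) x)) ∂μ :=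
        lintegral_const_mul _ (hm _)
    _ ≤ _ := by gcongr; exact hR _ (Nat.mod_lt _ hN)

theorem transfer_iterate_exp_tame_le
    (hf : TameObservable φ f ω τ Q) (n : ℕ) : ∀ y ∈ gaussSet, (transfer φ)^[n]
      (fun x => ENNReal.ofReal (Real.exp (τ * birkhoff f n x))) y ≤ ENNReal.ofReal (Q ^ n) := by
  have := transfer_iterate_exp_birkhoff_le (g := fun x => τ * f x) (N := 1)
    (A := ENNReal.ofReal Q) (fun y hy => by simpa [birkhoff] using hf.moment y hy) n
  simp only [one_mul, birkhoff_const_mul] at this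
  intro y hy
  rw [ENNReal.ofReal_pow (zero_le_one.trans hf.one_le_Q)]
  exact this y hy

theorem exists_exp_moment (G : GibbsSystem φ μ B θ C) (hf : TameObservable φ f ω τ Q) {ε : ℝ}
    (hε : 0 < ε) : ∃ t > 0, ∃ K : ℝ, 0 ≤ K ∧ ∀ n : ℕ,
      ∫⁻ x, ENNReal.ofReal (Real.exp (t * birkhoff f n x)) ∂μ ≤
        ENNReal.ofReal (K * Real.exp (t * n * (∫ x, f x ∂μ + ε))) ∧
      ∫⁻ x, ENNReal.ofReal (Real.exp (-t * birkhoff f n x)) ∂μ ≤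
        ENNReal.ofReal (K * Real.exp (-(t * n * (∫ x, f x ∂μ - ε)))) := by
  have := G.prob
  obtain ⟨N, hN, hblock⟩ := G.exists_birkhoff_block hf (half_pos hε)
  have hm := G.integral_observable_nonneg hf
  set m := ∫ x, f x ∂μ with hmdef
  have hτ := hf.tau_pos
  have hQ := hf.one_le_Q
  have hQN : 0 < Q ^ N := pow_pos (by linarith) N
  have hNr : (1 : ℝ) ≤ N := by exact_mod_cast hN
  set κ : ℝ := 8 / τ ^ 2 with hκ
  have hκ0 : 0 < κ := by positivity
  obtain ⟨t, ht, htτ, htε⟩ : ∃ t > 0, t ≤ τ / 2 ∧ t * (κ * Q ^ N) ≤ N * (ε / 2) := by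
    refine ⟨min (τ / 2) (N * (ε / 2) / (κ * Q ^ N)), lt_min (by positivity) (by positivity),
      min_le_left _ _, ?_⟩
    rw [← le_div_iff₀ (by positivity)]
    exact min_le_right _ _
  have hexp := transfer_iterate_exp_tame_le hf N
  have hup : ∀ y ∈ gaussSet, (transfer φ)^[N]
      (fun x => ENNReal.ofReal (Real.exp (birkhoff (fun x => t * f x) N x))) y ≤
      ENNReal.ofReal (Real.exp (t * N * (m + ε))) := by
    intro y hy
    have h1 : ∀ x ∈ gaussSet, ENNReal.ofReal (Real.exp (birkhoff (fun x => t * f x) N x)) ≤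
        (ENNReal.ofReal t * ENNReal.ofReal (birkhoff f N x) +
          ENNReal.ofReal (t ^ 2 * κ) * ENNReal.ofReal (Real.exp (τ * birkhoff f N x))) + 1 := by
      intro x hx
      have hS := birkhoff_nonneg hf.nonneg N hx
      rw [birkhoff_const_mul, ← ENNReal.ofReal_mul ht.le, ← ENNReal.ofReal_mul (by positivity),
        ← ENNReal.ofReal_add (by positivity) (by positivity), ← ENNReal.ofReal_one,
        ← ENNReal.ofReal_add (by positivity) zero_le_one]
      refine ENNReal.ofReal_le_ofReal ?_
      linarith [exp_le_quadratic (mul_nonneg ht.le hS), sq_mul_exp_le hτ htτ hS]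
    refine (transfer_iterate_mono_on h1 N y hy).trans ?_
    rw [G.transfer_iterate_add_const _ 1 N y hy, transfer_iterate_add, transfer_iterate_const_mul,
      transfer_iterate_const_mul]
    calc _ ≤ ENNReal.ofReal t * ENNReal.ofReal (N * (m + ε / 2)) +
          ENNReal.ofReal (t ^ 2 * κ) * ENNReal.ofReal (Q ^ N) + ENNReal.ofReal 1 := by
          rw [ENNReal.ofReal_one]
          gcongr
          · exact (hblock y hy).1
          · exact hexp y hy
      _ = ENNReal.ofReal (t * (N * (m + ε / 2)) + t ^ 2 * κ * Q ^ N + 1) := by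
          rw [← ENNReal.ofReal_mul ht.le, ← ENNReal.ofReal_mul (by positivity),
            ← ENNReal.ofReal_add (by positivity) (by positivity),
            ← ENNReal.ofReal_add (by positivity) zero_le_one]
      _ ≤ _ := by
          refine ENNReal.ofReal_le_ofReal (le_trans ?_ (Real.add_one_le_exp _))
          nlinarith
  have hlow : ∀ y ∈ gaussSet, (transfer φ)^[N]
      (fun x => ENNReal.ofReal (Real.exp (birkhoff (fun x => -t * f x) N x))) y ≤
      ENNReal.ofReal (Real.exp (-(t * N * (m - ε)))) := by
    intro y hy
    have h1 : ∀ x ∈ gaussSet, ENNReal.ofReal (Real.exp (birkhoff (fun x => -t * f x) N x)) +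
        ENNReal.ofReal t * ENNReal.ofReal (birkhoff f N x) ≤
          ENNReal.ofReal (t ^ 2 * κ) * ENNReal.ofReal (Real.exp (τ * birkhoff f N x)) + 1 := by
      intro x hx
      have hS := birkhoff_nonneg hf.nonneg N hx
      rw [birkhoff_const_mul, ← ENNReal.ofReal_mul ht.le, ← ENNReal.ofReal_mul (by positivity),
        ← ENNReal.ofReal_add (by positivity) (by positivity), ← ENNReal.ofReal_one,
        ← ENNReal.ofReal_add (by positivity) zero_le_one]
      refine ENNReal.ofReal_le_ofReal ?_
      have h3 := sq_mul_exp_le hτ htτ hS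
      have h4 := exp_neg_le_quadratic (mul_nonneg ht.le hS)
      have h5 := Real.one_le_exp (mul_nonneg ht.le hS)
      rw [neg_mul]
      nlinarith [sq_nonneg (t * birkhoff f N x)]
    have h2 := transfer_iterate_mono_on (φ := φ) h1 N y hy
    rw [G.transfer_iterate_add_const _ 1 N y hy, transfer_iterate_add, transfer_iterate_const_mul,
      transfer_iterate_const_mul] at h2
    set A := (transfer φ)^[N]
      (fun x => ENNReal.ofReal (Real.exp (birkhoff (fun x => -t * f x) N x))) y
    have h3 : A + ENNReal.ofReal (t * (N * m)) ≤
        ENNReal.ofReal (t ^ 2 * κ * Q ^ N + 1 + t * (N * (ε / 2))) := by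
      calc _ ≤ A + ENNReal.ofReal t * ((transfer φ)^[N]
            (fun x => ENNReal.ofReal (birkhoff f N x)) y + ENNReal.ofReal (N * (ε / 2))) := by
            rw [ENNReal.ofReal_mul ht.le]
            gcongr
            exact (hblock y hy).2
        _ = A + ENNReal.ofReal t * (transfer φ)^[N]
            (fun x => ENNReal.ofReal (birkhoff f N x)) y +
              ENNReal.ofReal (t * (N * (ε / 2))) := by
            rw [ENNReal.ofReal_mul ht.le, mul_add, add_assoc]
        _ ≤ ENNReal.ofReal (t ^ 2 * κ) * ENNReal.ofReal (Q ^ N) + 1 +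
              ENNReal.ofReal (t * (N * (ε / 2))) := by
            refine add_le_add (h2.trans ?_) le_rfl
            gcongr
            exact hexp y hy
        _ = _ := by
            rw [← ENNReal.ofReal_mul (by positivity), ← ENNReal.ofReal_one,
              ← ENNReal.ofReal_add (by positivity) zero_le_one,
              ← ENNReal.ofReal_add (by positivity) (by positivity)]
    have h4 := ENNReal.le_sub_of_add_le_right ENNReal.ofReal_ne_top h3
    rw [← ENNReal.ofReal_sub _ (by positivity)] at h4
    refine h4.trans (ENNReal.ofReal_le_ofReal (le_trans ?_ (Real.add_one_le_exp _)))
    nlinarith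
  have hR1 : ∀ r < N, ∫⁻ x, ENNReal.ofReal (Real.exp (birkhoff (fun x => t * f x) r x)) ∂μ ≤
      ENNReal.ofReal (Q ^ N) := by
    intro r hr
    rw [← G.lintegral_iterate_transfer
      (measurable_birkhoff (hf.meas.const_mul t) r).exp.ennreal_ofReal r]
    calc _ ≤ ∫⁻ _, ENNReal.ofReal (Q ^ N) ∂μ := by
          refine lintegral_mono_ae ?_
          filter_upwards [G.ae_mem] with y hy
          refine (transfer_iterate_mono_on (fun x hx => ?_) r y hy).trans
            ((transfer_iterate_exp_tame_le hf r y hy).trans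
              (ENNReal.ofReal_le_ofReal (pow_le_pow_right₀ hQ hr.le)))
          rw [birkhoff_const_mul]
          have hS := birkhoff_nonneg hf.nonneg r hx
          gcongr
          linarith
      _ = _ := by simp
  have hR2 : ∀ r < N, ∫⁻ x, ENNReal.ofReal (Real.exp (birkhoff (fun x => -t * f x) r x)) ∂μ ≤
      ENNReal.ofReal (Q ^ N) := by
    intro r _
    calc _ ≤ ∫⁻ _, ENNReal.ofReal (Q ^ N) ∂μ := by
          refine lintegral_mono_ae ?_
          filter_upwards [G.ae_mem] with y hy
          refine ENNReal.ofReal_le_ofReal ?_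
          rw [birkhoff_const_mul]
          have hS := birkhoff_nonneg hf.nonneg r hy
          refine le_trans ?_ (one_le_pow₀ hQ)
          rw [Real.exp_le_one_iff]
          nlinarith
      _ = _ := by simp
  refine ⟨t, ht, Q ^ N * Real.exp (t * N * m), by positivity, fun n => ?_⟩
  have hdm : (N : ℝ) * (n / N : ℕ) + (n % N : ℕ) = n := by exact_mod_cast Nat.div_add_mod n N
  have hmod : ((n % N : ℕ) : ℝ) ≤ N := by exact_mod_cast (Nat.mod_lt n hN).le
  have hmod0 : (0 : ℝ) ≤ (n % N : ℕ) := Nat.cast_nonneg _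
  have key : ∀ (s : ℝ) (g : ℝ → ℝ) (E : ℝ), ∫⁻ x, ENNReal.ofReal (Real.exp (birkhoff g n x)) ∂μ ≤
      ENNReal.ofReal (Real.exp s) ^ (n / N) * ENNReal.ofReal (Q ^ N) →
      (n / N : ℕ) * s ≤ t * N * m + E →
      ∫⁻ x, ENNReal.ofReal (Real.exp (birkhoff g n x)) ∂μ ≤
        ENNReal.ofReal (Q ^ N * Real.exp (t * N * m) * Real.exp E) := by
    intro s g E h1 h2
    refine h1.trans ?_
    rw [← ENNReal.ofReal_pow (Real.exp_pos _).le, ← ENNReal.ofReal_mul (by positivity),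
      ← Real.exp_nat_mul, mul_comm, mul_assoc, ← Real.exp_add]
    gcongr
  constructor
  · have := key _ _ (t * n * (m + ε))
      (G.lintegral_exp_birkhoff_le (hf.meas.const_mul t) hN hup hR1 n) (by
        have : t * n * (m + ε) = (n / N : ℕ) * (t * N * (m + ε)) + t * (n % N : ℕ) * (m + ε) := by
          rw [← hdm]; ring
        rw [this]
        have h1 : 0 ≤ t * (n % N : ℕ) * (m + ε) := by positivity
        have h2 : 0 ≤ t * N * m := by positivity
        linarith)
    simpa only [birkhoff_const_mul] using this
  · have := key _ _ (-(t * n * (m - ε)))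
      (G.lintegral_exp_birkhoff_le (hf.meas.const_mul (-t)) hN hlow hR2 n) (by
        have : -(t * n * (m - ε)) = (n / N : ℕ) * -(t * N * (m - ε)) -
            t * (n % N : ℕ) * m + t * (n % N : ℕ) * ε := by
          rw [← hdm]; ring
        rw [this]
        have h1 : t * (n % N : ℕ) * m ≤ t * N * m := by gcongr
        have h2 : 0 ≤ t * (n % N : ℕ) * ε := by positivity
        linarith)
    simpa only [birkhoff_const_mul] using this

/-- Exponential large deviation bound for tame observables. -/
theorem exists_deviation_bound (G : GibbsSystem φ μ B θ C) (hf : TameObservable φ f ω τ Q)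
    {ε : ℝ} (hε : 0 < ε) : ∃ t > 0, ∃ K : ℝ, 0 ≤ K ∧ ∀ (n : ℕ) (a : ℝ),
      μ.real {x | a ≤ |birkhoff f n x - n * ∫ x, f x ∂μ|} ≤
        K * Real.exp (-(t * a) + t * n * ε) := by
  have := G.prob
  obtain ⟨t, ht, K, hK, h⟩ := G.exists_exp_moment hf hε
  set m := ∫ x, f x ∂μ
  refine ⟨t, ht, K + K, by linarith, fun n a => ?_⟩
  have hmeas : ∀ s : ℝ, Measurable fun x => ENNReal.ofReal (Real.exp (s * birkhoff f n x)) :=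
    fun s => ((measurable_birkhoff hf.meas n).const_mul s).exp.ennreal_ofReal
  have markov : ∀ s b E : ℝ, ∫⁻ x, ENNReal.ofReal (Real.exp (s * birkhoff f n x)) ∂μ ≤
      ENNReal.ofReal (K * Real.exp E) →
      μ.real {x | b ≤ s * birkhoff f n x} ≤ K * Real.exp (-b + E) := by
    intro s b E hE
    have h1 := (mul_meas_ge_le_lintegral (μ := μ) (hmeas s) (ENNReal.ofReal (Real.exp b))).trans hE
    have h2 : {x | b ≤ s * birkhoff f n x} ⊆
        {x | ENNReal.ofReal (Real.exp b) ≤ ENNReal.ofReal (Real.exp (s * birkhoff f n x))} :=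
      fun x hx => ENNReal.ofReal_le_ofReal (Real.exp_le_exp.2 hx)
    have h3 := (mul_le_mul_right (measure_mono (μ := μ) h2) (ENNReal.ofReal (Real.exp b))).trans h1
    have h4 := ENNReal.toReal_mono ENNReal.ofReal_ne_top h3
    rw [ENNReal.toReal_mul, ENNReal.toReal_ofReal (Real.exp_pos _).le,
      ENNReal.toReal_ofReal (by positivity)] at h4
    rw [Real.exp_add, Real.exp_neg, measureReal_def]
    rw [← mul_le_mul_iff_right₀ (Real.exp_pos b)]
    refine h4.trans_eq ?_
    have := Real.exp_ne_zero b
    field_simp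
  have hsub : {x | a ≤ |birkhoff f n x - n * m|} ⊆
      {x | t * (a + n * m) ≤ t * birkhoff f n x} ∪
        {x | t * (a - n * m) ≤ -t * birkhoff f n x} := by
    intro x hx
    rcases le_abs.1 (show a ≤ |birkhoff f n x - n * m| from hx) with h1 | h1
    · left
      show t * (a + n * m) ≤ t * birkhoff f n x
      gcongr; linarith
    · right
      show t * (a - n * m) ≤ -t * birkhoff f n x
      rw [neg_mul, ← mul_neg]
      gcongr; linarith
  refine (measureReal_mono hsub).trans ((measureReal_union_le _ _).trans ?_)
  rw [add_mul]
  refine add_le_add ((markov _ _ _ (h n).1).trans_eq ?_) ((markov _ _ _ (h n).2).trans_eq ?_)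
  · congr 2; ring
  · congr 2; ring

end GibbsSystem

/-! ### Tameness of the Lyapunov observable and of the potential -/

theorem rpow_le_dyadic_sum {β : ℝ} (hβ : 0 < β) {n : ℕ} (hn : 0 < n) :
    ENNReal.ofReal ((n : ℝ) ^ β) ≤
      ∑' k : ℕ, ENNReal.ofReal (2 ^ ((k + 1) * β)) * (if 2 ^ k ≤ n then 1 else 0) := by
  refine le_trans ?_ (ENNReal.le_tsum (Nat.log 2 n))
  rw [if_pos (Nat.pow_log_le_self 2 hn.ne'), mul_one]
  refine ENNReal.ofReal_le_ofReal ?_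
  rw [Real.rpow_mul zero_le_two]
  refine Real.rpow_le_rpow (Nat.cast_nonneg _) ?_ hβ.le
  have := (Nat.lt_pow_succ_log_self (b := 2) one_lt_two n).le
  exact_mod_cast this

theorem lintegral_rpow_digit_lt_top {μ : Measure ℝ} [IsProbabilityMeasure μ]
    (hμ : ∀ᵐ x ∂μ, x ∈ gaussSet) {δ K : ℝ} (hδ : 0 < δ)
    (htail : ∀ n : ℕ, 0 < n →
      (μ {x | x ∈ gaussSet ∧ n ≤ cfDigit1 x}).toReal ≤ K * (n : ℝ) ^ (-δ)) :
    ∫⁻ x, ENNReal.ofReal ((cfDigit1 x : ℝ) ^ (δ / 2)) ∂μ < ⊤ := by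
  have hmeas : ∀ k : ℕ, MeasurableSet {x | 2 ^ k ≤ cfDigit1 x} := fun k =>
    measurable_cfDigit1 (measurableSet_Ici (a := 2 ^ k))
  have hm2 : ∀ k : ℕ, Measurable fun x : ℝ => (if 2 ^ k ≤ cfDigit1 x then 1 else 0 : ℝ≥0∞) :=
    fun k => Measurable.ite (hmeas k) measurable_const measurable_const
  have hK : 0 ≤ K := by
    have := htail 1 one_pos
    rw [Nat.cast_one, Real.one_rpow, mul_one] at this
    exact ENNReal.toReal_nonneg.trans this
  set r : ℝ := 2 ^ (-(δ / 2)) with hr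
  have hr0 : 0 < r := by positivity
  have hr1 : r < 1 := Real.rpow_lt_one_of_one_lt_of_neg one_lt_two (by linarith)
  calc ∫⁻ x, ENNReal.ofReal ((cfDigit1 x : ℝ) ^ (δ / 2)) ∂μ
      ≤ ∫⁻ x, ∑' k : ℕ, ENNReal.ofReal (2 ^ ((k + 1) * (δ / 2))) *
          (if 2 ^ k ≤ cfDigit1 x then 1 else 0) ∂μ := by
        refine lintegral_mono_ae ?_
        filter_upwards [hμ] with x hx
        exact rpow_le_dyadic_sum (by linarith) (cfDigit1_pos hx)
    _ = ∑' k : ℕ, ENNReal.ofReal (2 ^ ((k + 1) * (δ / 2))) *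
          ∫⁻ x, (if 2 ^ k ≤ cfDigit1 x then 1 else 0) ∂μ := by
        rw [lintegral_tsum fun k => ((hm2 k).const_mul _).aemeasurable]
        exact tsum_congr fun k => lintegral_const_mul _ (hm2 k)
    _ ≤ ∑' k : ℕ, ENNReal.ofReal (2 ^ (δ / 2) * K * r ^ k) := by
        refine ENNReal.tsum_le_tsum fun k => ?_
        have h1 : ∫⁻ x, (if 2 ^ k ≤ cfDigit1 x then 1 else 0) ∂μ =
            μ {x | x ∈ gaussSet ∧ 2 ^ k ≤ cfDigit1 x} := by
          change _ = μ (gaussSet ∩ {x | 2 ^ k ≤ cfDigit1 x})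
          rw [← lintegral_indicator_one (measurableSet_gaussSet.inter (hmeas k))]
          refine lintegral_congr_ae ?_
          filter_upwards [hμ] with x hx
          by_cases h : 2 ^ k ≤ cfDigit1 x <;> simp [h, hx, Set.indicator]
        have h2 := htail (2 ^ k) (by positivity)
        rw [h1, ← ENNReal.ofReal_toReal (measure_ne_top μ _), ← ENNReal.ofReal_mul (by positivity)]
        refine ENNReal.ofReal_le_ofReal ?_
        calc (2 : ℝ) ^ ((k + 1) * (δ / 2)) * (μ {x | x ∈ gaussSet ∧ 2 ^ k ≤ cfDigit1 x}).toReal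
            ≤ 2 ^ ((k + 1) * (δ / 2)) * (K * ((2 ^ k : ℕ) : ℝ) ^ (-δ)) := by gcongr
          _ = _ := by
            have h3 : ((2 ^ k : ℕ) : ℝ) ^ (-δ) = 2 ^ (-(k * δ)) := by
              push_cast
              rw [← Real.rpow_natCast, ← Real.rpow_mul zero_le_two]; congr 1; ring
            have h4 : r ^ k = 2 ^ (-(δ / 2) * k) := by
              rw [hr, ← Real.rpow_natCast, ← Real.rpow_mul zero_le_two]
            rw [h3, h4, mul_left_comm, ← Real.rpow_add two_pos, mul_comm _ K, mul_assoc,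
              ← Real.rpow_add two_pos]
            congr 2; ring
    _ < ⊤ := by
        have hs : Summable fun k : ℕ => 2 ^ (δ / 2) * K * r ^ k :=
          (summable_geometric_of_lt_one hr0.le hr1).mul_left _
        rw [← ENNReal.ofReal_tsum_of_nonneg (fun k => by positivity) hs]
        exact ENNReal.ofReal_lt_top

theorem logAbsDerivGauss_eq {x : ℝ} : logAbsDerivGauss x = 2 * Real.log x⁻¹ := by
  rw [logAbsDerivGauss, one_div, ← inv_pow, Real.log_pow]; norm_num

theorem logAbsDerivGauss_eq_log_add {x : ℝ} (hx : x ∈ gaussSet) :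
    logAbsDerivGauss x = 2 * Real.log (gaussMap x + cfDigit1 x) := by
  rw [logAbsDerivGauss_eq, ← invBranch1_cfDigit1 hx, invBranch1, inv_inv]
  congr 3 <;> rw [← invBranch1, invBranch1_cfDigit1 hx]

theorem measurable_logAbsDerivGauss : Measurable logAbsDerivGauss :=
  Real.measurable_log.comp (measurable_const.div (measurable_id.pow_const 2))

theorem logAbsDerivGauss_nonneg {x : ℝ} (hx : x ∈ gaussSet) : 0 ≤ logAbsDerivGauss x := by
  rw [logAbsDerivGauss_eq]
  have := Real.log_nonneg ((one_lt_inv₀ (gaussSet_pos hx)).2 (gaussSet_lt_one hx)).le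
  linarith

theorem logAbsDerivGauss_le {x : ℝ} (hx : x ∈ gaussSet) :
    logAbsDerivGauss x ≤ 2 * Real.log (2 * cfDigit1 x) := by
  have h1 : (1 : ℝ) ≤ cfDigit1 x := by exact_mod_cast cfDigit1_pos hx
  have h2 := gaussMap_mem hx
  rw [logAbsDerivGauss_eq_log_add hx]
  have := gaussSet_pos h2
  have := gaussSet_lt_one h2
  gcongr
  linarith

theorem logAbsDerivGauss_osc {j : ℕ} (hj : 1 ≤ j) {l : List ℕ} (hl : PosWord l)
    (hjl : j ≤ l.length) {x y : ℝ} (hx : x ∈ cylinder l) (hy : y ∈ cylinder l) :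
    logAbsDerivGauss x ≤ logAbsDerivGauss y + 8 / (j : ℝ) ^ 2 := by
  rcases l with _ | ⟨a, l⟩
  · simp at hjl; omega
  rw [posWord_cons] at hl
  rw [mem_cylinder_cons] at hx hy
  rw [logAbsDerivGauss_eq_log_add hx.1, logAbsDerivGauss_eq_log_add hy.1, hx.2.1, hy.2.1]
  have ha : (1 : ℝ) ≤ a := by exact_mod_cast hl.1
  have h1 := abs_sub_le_of_mem_cylinder hx.2.2 hy.2.2
  have h2 := gaussSet_pos hx.2.2.1
  have h3 := gaussSet_pos hy.2.2.1
  set u := gaussMap x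
  set v := gaussMap y
  have h4 : (j : ℝ) / 2 ≤ cfQ l := by
    have q1 : (1 : ℝ) ≤ cfQ l := by exact_mod_cast cfQ_pos hl.2
    have q2 : (l.length : ℝ) ≤ cfQ l := by exact_mod_cast length_le_cfQ hl.2
    have q3 : (j : ℝ) ≤ l.length + 1 := by rw [List.length_cons] at hjl; exact_mod_cast hjl
    linarith
  have hj0 : (0 : ℝ) < j := by exact_mod_cast hj
  have h5 : 1 / (cfQ l : ℝ) ^ 2 ≤ 4 / (j : ℝ) ^ 2 := by
    calc 1 / (cfQ l : ℝ) ^ 2 ≤ 1 / ((j : ℝ) / 2) ^ 2 := by gcongr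
      _ = _ := by field_simp; norm_num
  have h6 : Real.log (u + a) - Real.log (v + a) ≤ |u - v| := by
    rw [← Real.log_div (by linarith) (by linarith)]
    have e1 : (u + a) / (v + a) = 1 + (u - v) / (v + a) := by
      have : v + a ≠ 0 := by linarith
      field_simp; ring
    have e2 : (u - v) / (v + a) ≤ |u - v| := by
      rw [div_le_iff₀ (by linarith)]
      nlinarith [le_abs_self (u - v), abs_nonneg (u - v)]
    have e3 := Real.log_le_sub_one_of_pos (x := (u + a) / (v + a)) (by positivity)
    linarith
  have e8 : 8 / (j : ℝ) ^ 2 = 2 * (4 / (j : ℝ) ^ 2) := by ring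
  linarith

namespace GibbsSystem

variable {φ : ℝ → ℝ} {μ : Measure ℝ} {B θ C : ℝ}

theorem exists_transfer_digit_le (G : GibbsSystem φ μ B θ C) {β : ℝ}
    (h : ∫⁻ x, ENNReal.ofReal ((cfDigit1 x : ℝ) ^ β) ∂μ < ⊤) :
    ∃ M : ℝ, 1 ≤ M ∧ ∀ y ∈ gaussSet,
      transfer φ (fun x => ENNReal.ofReal ((cfDigit1 x : ℝ) ^ β)) y ≤ ENNReal.ofReal M := by
  have := G.prob
  have hm : Measurable fun x => ENNReal.ofReal ((cfDigit1 x : ℝ) ^ β) :=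
    ((measurable_from_nat (f := fun n : ℕ => ENNReal.ofReal ((n : ℝ) ^ β))).comp
      measurable_cfDigit1)
  set F := fun x => ENNReal.ofReal ((cfDigit1 x : ℝ) ^ β) with hF
  have hfin : ENNReal.ofReal (Real.exp B) * ∫⁻ x, F x ∂μ ≠ ⊤ :=
    ENNReal.mul_ne_top ENNReal.ofReal_ne_top h.ne
  refine ⟨max 1 (ENNReal.ofReal (Real.exp B) * ∫⁻ x, F x ∂μ).toReal, le_max_left _ _,
    fun y hy => ?_⟩
  refine le_trans ?_ (ENNReal.ofReal_le_ofReal (le_max_right _ _))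
  rw [ENNReal.ofReal_toReal hfin, ← G.lintegral_transfer hm,
    ← lintegral_const_mul _ (measurable_transfer G.meas hm)]
  calc transfer φ F y = ∫⁻ _, transfer φ F y ∂μ := by simp
    _ ≤ _ := by
      refine lintegral_mono_ae ?_
      filter_upwards [G.ae_mem] with z hz
      have h1 := G.transfer_iterate_comparison 1 (d := []) (u := F) (v := F) (x := y) (y := z)
        (by rwa [cylinder_nil]) (by rwa [cylinder_nil]) (by
          intro l hl w hw w' hw'
          rcases l with _ | ⟨a, l⟩
          · simp at hl
          rw [mem_cylinder_cons] at hw hw'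
          simp only [hF]
          rw [hw.2.1, hw'.2.1])
      simp only [Function.iterate_one] at h1
      refine h1.trans ?_
      gcongr
      simp only [List.length_nil, pow_zero, mul_one, pow_one]
      nlinarith [G.B_nonneg, G.theta_pos]

theorem exists_tame_logAbsDerivGauss (G : GibbsSystem φ μ B θ C) {β : ℝ} (hβ : 0 < β)
    (h : ∫⁻ x, ENNReal.ofReal ((cfDigit1 x : ℝ) ^ β) ∂μ < ⊤) :
    ∃ ω τ Q, TameObservable φ logAbsDerivGauss ω τ Q := by
  obtain ⟨M, hM, hMy⟩ := G.exists_transfer_digit_le h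
  have h2β : (1 : ℝ) ≤ 2 ^ β := Real.one_le_rpow one_le_two hβ.le
  refine ⟨fun j => 8 / (j : ℝ) ^ 2, β / 2, 2 ^ β * M, measurable_logAbsDerivGauss,
    fun x hx => logAbsDerivGauss_nonneg hx,
    fun j hj l hl hjl x hx y hy => logAbsDerivGauss_osc hj hl hjl hx hy, ?_,
    fun j => by positivity, by linarith, by nlinarith, fun y hy => ?_⟩
  · exact Tendsto.const_div_atTop
      ((tendsto_pow_atTop two_ne_zero).comp tendsto_natCast_atTop_atTop) 8
  · have h1 : ∀ x ∈ gaussSet, ENNReal.ofReal (Real.exp (β / 2 * logAbsDerivGauss x)) ≤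
        ENNReal.ofReal (2 ^ β) * ENNReal.ofReal ((cfDigit1 x : ℝ) ^ β) := by
      intro x hx
      have ha : (0 : ℝ) < cfDigit1 x := by exact_mod_cast cfDigit1_pos hx
      rw [← ENNReal.ofReal_mul (by positivity), ← Real.mul_rpow zero_le_two ha.le,
        Real.rpow_def_of_pos (by positivity)]
      refine ENNReal.ofReal_le_ofReal (Real.exp_le_exp.2 ?_)
      nlinarith [logAbsDerivGauss_le hx]
    refine (transfer_mono_on h1 hy).trans ?_
    have h2 := transfer_iterate_const_mul φ (ENNReal.ofReal (2 ^ β))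
      (fun x => ENNReal.ofReal ((cfDigit1 x : ℝ) ^ β)) 1 y
    rw [Function.iterate_one] at h2
    rw [h2, ENNReal.ofReal_mul (by positivity)]
    gcongr
    exact hMy y hy

theorem exists_tame_neg (G : GibbsSystem φ μ B θ C)
    (hH : ∀ l : List ℕ, l ≠ [] → PosWord l → ∀ x ∈ cylinder l, ∀ y ∈ cylinder l,
      |φ x - φ y| ≤ B * θ ^ l.length) {β : ℝ} (hβ : 0 < β)
    (h : ∫⁻ x, ENNReal.ofReal ((cfDigit1 x : ℝ) ^ β) ∂μ < ⊤) :
    ∃ ω τ Q, TameObservable φ (fun x => -φ x) ω τ Q := by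
  obtain ⟨M, hM, hMy⟩ := G.exists_transfer_digit_le h
  set τ : ℝ := min (1 / 2) (β / 4) with hτ
  have hτ0 : 0 < τ := lt_min (by norm_num) (by linarith)
  have hτ1 : τ ≤ 1 / 2 := min_le_left _ _
  have hτβ : τ ≤ β / 4 := min_le_right _ _
  have hs : Summable fun a : ℕ+ => ((a : ℕ) : ℝ) ^ (-2 : ℝ) :=
    (Real.summable_nat_rpow.2 (by norm_num)).comp_injective PNat.coe_injective
  set Z := ∑' a : ℕ+, ((a : ℕ) : ℝ) ^ (-2 : ℝ) with hZ
  have hZ0 : 0 ≤ Z := tsum_nonneg fun a => by positivity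
  refine ⟨fun j => B * θ ^ j, τ, M + Z, G.meas.neg, fun x _ => neg_nonneg.2 (G.nonpos x),
    fun j hj l hl hjl x hx y hy => ?_, ?_,
    fun j => mul_nonneg G.B_nonneg (pow_nonneg G.theta_pos.le j), hτ0, by linarith,
    fun y hy => ?_⟩
  · have h1 := hH l (by rintro rfl; simp at hjl; omega) hl x hx y hy
    have h2 : B * θ ^ l.length ≤ B * θ ^ j :=
      mul_le_mul_of_nonneg_left (pow_le_pow_of_le_one G.theta_pos.le G.theta_lt.le hjl) G.B_nonneg
    linarith [(abs_le.1 h1).1]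
  · simpa using (tendsto_pow_atTop_nhds_zero_of_lt_one G.theta_pos.le G.theta_lt).const_mul B
  · have key : ∀ a : ℕ+, ENNReal.ofReal (Real.exp (φ (invBranch1 a y))) *
        ENNReal.ofReal (Real.exp (τ * -φ (invBranch1 a y))) ≤
        ENNReal.ofReal (Real.exp (φ (invBranch1 a y))) *
          ENNReal.ofReal ((cfDigit1 (invBranch1 a y) : ℝ) ^ β) +
          ENNReal.ofReal (((a : ℕ) : ℝ) ^ (-2 : ℝ)) := by
      intro a
      have ha : (1 : ℝ) ≤ (a : ℕ) := by exact_mod_cast a.2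
      rw [cfDigit1_invBranch1 _ hy]
      set s := φ (invBranch1 a y)
      rw [← ENNReal.ofReal_mul (Real.exp_pos _).le, ← ENNReal.ofReal_mul (Real.exp_pos _).le,
        ← ENNReal.ofReal_add (by positivity) (by positivity)]
      refine ENNReal.ofReal_le_ofReal ?_
      have hlog : 0 ≤ Real.log (a : ℕ) := Real.log_nonneg ha
      rw [Real.rpow_def_of_pos (by linarith), Real.rpow_def_of_pos (by linarith)]
      by_cases hc : τ * -s ≤ Real.log (a : ℕ) * β
      · have : Real.exp (τ * -s) ≤ Real.exp (Real.log (a : ℕ) * β) := Real.exp_le_exp.2 hc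
        nlinarith [Real.exp_pos s, Real.exp_pos (Real.log (a : ℕ) * -2)]
      · have h3 : Real.exp s * Real.exp (τ * -s) ≤ Real.exp (Real.log (a : ℕ) * -2) := by
          rw [← Real.exp_add, Real.exp_le_exp]
          push Not at hc
          have h5 : Real.log (a : ℕ) * 4 ≤ -s := by
            by_contra! h6
            nlinarith
          nlinarith
        have := mul_pos (Real.exp_pos s) (Real.exp_pos (Real.log (a : ℕ) * β))
        linarith
    calc _ ≤ ∑' a : ℕ+, (ENNReal.ofReal (Real.exp (φ (invBranch1 a y))) *
          ENNReal.ofReal ((cfDigit1 (invBranch1 a y) : ℝ) ^ β) +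
          ENNReal.ofReal (((a : ℕ) : ℝ) ^ (-2 : ℝ))) := ENNReal.tsum_le_tsum key
      _ = transfer φ (fun x => ENNReal.ofReal ((cfDigit1 x : ℝ) ^ β)) y + ENNReal.ofReal Z := by
          rw [ENNReal.tsum_add, hZ,
            ENNReal.ofReal_tsum_of_nonneg (fun a => by positivity) hs]
          rfl
      _ ≤ _ := by
          rw [ENNReal.ofReal_add (by linarith) hZ0]
          gcongr
          exact hMy y hy

/-! ### Entropy -/

theorem measureReal_cylinder_pos (G : GibbsSystem φ μ B θ C) {c : List ℕ} (hc : PosWord c) :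
    0 < μ.real (cylinder c) := by
  obtain ⟨x, hx⟩ := G.nonempty
  have := G.le_gibbs c hc x hx
  have h1 := gw_pos φ c x
  have := G.C_pos
  by_contra! h2
  nlinarith

theorem gw_cfWord {x : ℝ} (hx : x ∈ gaussSet) (n : ℕ) :
    gw φ (cfWord n x) (gaussMap^[n] x) = Real.exp (birkhoff φ n x) := by
  have h := invBranch_gaussMap_iterate (mem_cylinder_cfWord hx n)
  rw [cfWord_length] at h
  rw [gw, wsum, h, cfWord_length]

theorem abs_log_cylinder_sub_le (G : GibbsSystem φ μ B θ C) {x : ℝ} (hx : x ∈ gaussSet) (n : ℕ) :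
    |Real.log (μ.real (cylinder (cfWord n x))) - birkhoff φ n x| ≤ Real.log C := by
  have hp := cfWord_pos hx n
  have h1 := G.gibbs_le _ hp _ (gaussMap_iterate_mem hx n)
  have h2 := G.le_gibbs _ hp _ (gaussMap_iterate_mem hx n)
  rw [gw_cfWord hx] at h1 h2
  have h3 := G.measureReal_cylinder_pos hp
  have hC := G.C_pos
  have h4 := Real.log_le_log h3 h1
  have h5 := Real.log_le_log (Real.exp_pos _) h2
  rw [Real.log_mul hC.ne' (Real.exp_pos _).ne', Real.log_exp] at h4
  rw [Real.log_mul hC.ne' h3.ne', Real.log_exp] at h5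
  rw [abs_le]; constructor <;> linarith

theorem integrable_comp_iterate (G : GibbsSystem φ μ B θ C) {f : ℝ → ℝ} (hf : Integrable f μ)
    (k : ℕ) : Integrable (fun x => f (gaussMap^[k] x)) μ :=
  (G.mp.iterate k).integrable_comp_of_integrable hf

theorem integral_comp_iterate (G : GibbsSystem φ μ B θ C) {f : ℝ → ℝ} (hf : Measurable f)
    (k : ℕ) : ∫ x, f (gaussMap^[k] x) ∂μ = ∫ x, f x ∂μ := by
  conv_rhs => rw [← (G.mp.iterate k).map_eq]
  rw [integral_map (G.mp.iterate k).measurable.aemeasurable hf.aestronglyMeasurable]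

theorem integrable_birkhoff (G : GibbsSystem φ μ B θ C) {f : ℝ → ℝ} (hf : Integrable f μ)
    (n : ℕ) : Integrable (birkhoff f n) μ :=
  integrable_finsetSum _ fun k _ => G.integrable_comp_iterate hf k

theorem integral_birkhoff (G : GibbsSystem φ μ B θ C) {f : ℝ → ℝ} (hfm : Measurable f)
    (hf : Integrable f μ) (n : ℕ) : ∫ x, birkhoff f n x ∂μ = n * ∫ x, f x ∂μ := by
  unfold birkhoff
  rw [integral_finsetSum _ fun k _ => G.integrable_comp_iterate hf k]
  simp [G.integral_comp_iterate hfm]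

theorem entropy_eq (G : GibbsSystem φ μ B θ C) (hφ : Integrable φ μ) {h : ℝ}
    (hent : HasEntropy μ h) : h = -∫ x, φ x ∂μ := by
  have := G.prob
  have bound : ∀ n : ℕ, |∑' l : Word n, Real.negMulLog (μ (cylinder l.1)).toReal +
      n * ∫ x, φ x ∂μ| ≤ Real.log C := by
    intro n
    set H : ℝ → ℝ := fun x => Real.log (μ.real (cylinder (cfWord n x))) with hH
    have hHm : Measurable H := measurable_comp_cfWord n fun l => Real.log (μ.real (cylinder l))
    have hbI := G.integrable_birkhoff hφ n
    have hdI : Integrable (fun x => H x - birkhoff φ n x) μ := by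
      refine Integrable.of_bound (hHm.sub (measurable_birkhoff G.meas n)).aestronglyMeasurable
        (Real.log C) ?_
      filter_upwards [G.ae_mem] with x hx using G.abs_log_cylinder_sub_le hx n
    have hHI : Integrable H μ := by
      have := hdI.add hbI
      refine this.congr (ae_of_all _ fun x => ?_)
      simp
    have hsum : ∑' l : Word n, Real.negMulLog (μ (cylinder l.1)).toReal = -∫ x, H x ∂μ := by
      have : Countable (Word n) := by unfold Word; infer_instance
      have h1 := hasSum_integral_iUnion (μ := μ) (f := H) (s := fun l : Word n => cylinder l.1)
        (fun l => measurableSet_cylinder _) (fun l m hlm => cylinder_disjoint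
          (l.2.1.trans m.2.1.symm) fun h => hlm (Subtype.ext h)) hHI.integrableOn
      have h2 : (⋃ l : Word n, cylinder l.1) =ᵐ[μ] (Set.univ : Set ℝ) := by
        rw [ae_eq_univ]
        refine measure_mono_null (fun x hx => ?_) G.ae_mem
        intro hxX
        exact hx (mem_iUnion.2 ⟨⟨cfWord n x, cfWord_length n x, cfWord_pos hxX n⟩,
          mem_cylinder_cfWord hxX n⟩)
      rw [setIntegral_congr_set h2, setIntegral_univ] at h1
      rw [← h1.tsum_eq, ← tsum_neg]
      refine tsum_congr fun l => ?_
      have h3 : ∫ x in cylinder l.1, H x ∂μ =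
          ∫ _ in cylinder l.1, Real.log (μ.real (cylinder l.1)) ∂μ := by
        refine setIntegral_congr_fun (measurableSet_cylinder _) fun x hx => ?_
        rw [mem_cylinder_iff, l.2.1] at hx
        simp only [hH]
        rw [hx.2]
      rw [h3, setIntegral_const, Real.negMulLog, smul_eq_mul, measureReal_def]
      ring
    rw [hsum, ← G.integral_birkhoff G.meas hφ n, neg_add_eq_sub, abs_sub_comm,
      ← integral_sub hHI hbI]
    calc |∫ x, (H x - birkhoff φ n x) ∂μ| ≤ ∫ x, |H x - birkhoff φ n x| ∂μ :=
          abs_integral_le_integral_abs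
      _ ≤ ∫ _, Real.log C ∂μ := by
          refine integral_mono_ae hdI.abs (integrable_const _) ?_
          filter_upwards [G.ae_mem] with x hx using G.abs_log_cylinder_sub_le hx n
      _ = Real.log C := by simp
  refine tendsto_nhds_unique hent ?_
  rw [tendsto_iff_norm_sub_tendsto_zero]
  refine squeeze_zero' (Eventually.of_forall fun _ => norm_nonneg _) ?_
    (tendsto_const_div_atTop_nhds_zero_nat (Real.log C))
  filter_upwards [eventually_gt_atTop 0] with n hn
  have hn' : (0 : ℝ) < n := by exact_mod_cast hn
  rw [Real.norm_eq_abs, le_div_iff₀ hn']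
  refine le_trans (le_of_eq ?_) (bound n)
  rw [← abs_of_pos hn', ← abs_mul, abs_of_pos hn']
  congr 1
  field_simp
  ring

end GibbsSystem

/-! ### Typical points and counting of words -/

/-- The Birkhoff sums of `log |T'|` are logarithms of continuants. -/
theorem birkhoff_logAbsDerivGauss {c : List ℕ} {x : ℝ} (hx : x ∈ cylinder c) :
    birkhoff logAbsDerivGauss c.length x =
      2 * Real.log (cfQ c + cfQ' c * gaussMap^[c.length] x) := by
  induction c generalizing x with
  | nil => simp [birkhoff]
  | cons a l ih =>
    have hpos := posWord_of_mem_cylinder hx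
    have hx' := (mem_cylinder_cons.1 hx).2.2
    have hinv := invBranch_gaussMap_iterate hx
    have hy := gaussMap_iterate_mem hx.1 (a :: l).length
    rw [List.length_cons, birkhoff_succ, ih hx', ← Function.iterate_succ_apply] at *
    set y := gaussMap^[l.length + 1] x
    have h1 := cfDen_pos hpos hy.1.1
    have h2 := cfDen_pos (posWord_cons.1 hpos).2 hy.1.1
    rw [invBranch_eq hpos hy.1.1, cfP_cons, cfP'_cons] at hinv
    rw [logAbsDerivGauss_eq, ← hinv, inv_div, Real.log_div h1.ne' h2.ne']
    ring

/-- Points whose Birkhoff sums of `log |T'|` and of `φ` at time `k` are within `b` of their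
expected values. -/
def typicalSet (φ : ℝ → ℝ) (lam h b : ℝ) (k : ℕ) : Set ℝ :=
  {x | x ∈ gaussSet ∧ |birkhoff logAbsDerivGauss k x - k * lam| ≤ b ∧
    |birkhoff φ k x + k * h| ≤ b}

theorem measurableSet_typicalSet {φ : ℝ → ℝ} (hφ : Measurable φ) (lam h b : ℝ) (k : ℕ) :
    MeasurableSet (typicalSet φ lam h b k) := by
  refine measurableSet_gaussSet.inter (MeasurableSet.inter ?_ ?_)
  · exact measurableSet_le
      ((measurable_birkhoff measurable_logAbsDerivGauss k).sub_const _).abs measurable_const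
  · exact measurableSet_le ((measurable_birkhoff hφ k).add_const _).abs measurable_const

theorem cfQ_sq_le_of_typical {φ : ℝ → ℝ} {lam h b : ℝ} {k : ℕ} {c : List ℕ} {x : ℝ}
    (hc : c.length = k) (hx : x ∈ cylinder c) (ht : x ∈ typicalSet φ lam h b k) :
    (cfQ c : ℝ) ^ 2 ≤ Real.exp (k * lam + b) := by
  have h1 := (abs_le.1 ht.2.1).2
  have hq : (0 : ℝ) < cfQ c := by exact_mod_cast cfQ_pos (posWord_of_mem_cylinder hx)
  have hy := (gaussMap_iterate_mem hx.1 c.length).1.1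
  have h2 := Real.log_le_log hq (cfQ_le_cfDen (l := c) hy)
  rw [← hc, birkhoff_logAbsDerivGauss hx] at h1
  rw [← Real.log_le_iff_le_exp (by positivity), Real.log_pow, ← hc]
  push_cast
  linarith

theorem le_cfQ_sq_of_typical {φ : ℝ → ℝ} {lam h b : ℝ} {k : ℕ} {c : List ℕ} {x : ℝ}
    (hc : c.length = k) (hx : x ∈ cylinder c) (ht : x ∈ typicalSet φ lam h b k) :
    Real.exp (k * lam - b) ≤ 4 * (cfQ c : ℝ) ^ 2 := by
  have h1 := (abs_le.1 ht.2.1).1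
  have hp := posWord_of_mem_cylinder hx
  have hq : (0 : ℝ) < cfQ c := by exact_mod_cast cfQ_pos hp
  have hy := (gaussMap_iterate_mem hx.1 c.length).1
  have h2 := Real.log_le_log (cfDen_pos hp hy.1) (cfDen_le hp hy.2)
  rw [← hc, birkhoff_logAbsDerivGauss hx] at h1
  rw [← Real.le_log_iff_exp_le (by positivity),
    show 4 * (cfQ c : ℝ) ^ 2 = (2 * cfQ c) ^ 2 by ring, Real.log_pow, ← hc]
  push_cast
  linarith

/-- If at most `N` of the sets `g d` are needed, each of measure at most `m`, the measure of their
union is at most `N * m`. -/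
theorem measureReal_le_of_card_le {α ι : Type*} [MeasurableSpace α] {μ : Measure α}
    [IsFiniteMeasure μ] {W : Set ι} {g : ι → Set α} {N m : ℝ} (hm : 0 ≤ m)
    (hcard : ∀ F : Finset ι, ↑F ⊆ W → (F.card : ℝ) ≤ N) (hg : ∀ d ∈ W, μ.real (g d) ≤ m)
    {S : Set α} (hS : S ⊆ ⋃ d ∈ W, g d) : μ.real S ≤ N * m := by
  have hfin : W.Finite := by
    by_contra hinf
    obtain ⟨F, hF, hc⟩ := Set.Infinite.exists_subset_card_eq hinf (⌊N⌋₊ + 1)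
    have := hcard F hF
    rw [hc] at this
    have h2 := Nat.lt_floor_add_one N
    push_cast at this
    linarith
  have hsub : S ⊆ ⋃ d ∈ hfin.toFinset, g d := by simpa using hS
  calc μ.real S ≤ μ.real (⋃ d ∈ hfin.toFinset, g d) := measureReal_mono hsub (measure_ne_top _ _)
    _ ≤ ∑ d ∈ hfin.toFinset, μ.real (g d) := measureReal_biUnion_finset_le _ _
    _ ≤ ∑ d ∈ hfin.toFinset, m := Finset.sum_le_sum fun d hd => hg d (by simpa using hd)
    _ = hfin.toFinset.card * m := by rw [Finset.sum_const, nsmul_eq_mul]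
    _ ≤ N * m := by gcongr; exact hcard _ (by simp)

/-- A packing bound for intervals of length at least `η` near a given point. -/
theorem card_mul_le_of_disjoint_Ioo {ι : Type*} {F : Finset ι} {lo hi : ι → ℝ} {u r η : ℝ}
    (hr : 0 ≤ r) (hη : 0 < η)
    (hdisj : ∀ i ∈ F, ∀ j ∈ F, i ≠ j → Disjoint (Ioo (lo i) (hi i)) (Ioo (lo j) (hi j)))
    (hlen : ∀ i ∈ F, lo i + η ≤ hi i)
    (hnear : ∀ i ∈ F, ∃ p ∈ Icc (lo i) (hi i), |p - u| ≤ r) :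
    F.card * η ≤ 2 * r + 2 * η := by
  choose! p hp hpu using hnear
  set a : ι → ℝ := fun i => max (lo i) (p i - η) with ha
  have hsub : ∀ i ∈ F, Ioo (a i) (a i + η) ⊆ Ioo (lo i) (hi i) := by
    intro i hi'
    refine Ioo_subset_Ioo (le_max_left _ _) ?_
    rw [ha]
    simp only
    rw [max_add, sub_add_cancel]
    exact max_le (hlen i hi') (hp i hi').2
  have hvol : volume (⋃ i ∈ F, Ioo (a i) (a i + η)) = ∑ i ∈ F, volume (Ioo (a i) (a i + η)) := by
    refine measure_biUnion_finset ?_ fun i _ => measurableSet_Ioo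
    intro i hi' j hj hij
    exact (hdisj i hi' j hj hij).mono (hsub i hi') (hsub j hj)
  have hin : (⋃ i ∈ F, Ioo (a i) (a i + η)) ⊆ Icc (u - r - η) (u + r + η) := by
    simp only [Set.iUnion_subset_iff]
    intro i hi' y hy
    have h1 := abs_le.1 (hpu i hi')
    have h2 : p i - η ≤ a i := le_max_right _ _
    have h3 : a i ≤ p i := max_le (hp i hi').1 (by linarith)
    exact ⟨by linarith [hy.1], by linarith [hy.2]⟩
  have := measure_mono (μ := volume) hin
  rw [hvol, Real.volume_Icc] at this
  simp only [Real.volume_Ioo, add_sub_cancel_left, Finset.sum_const, nsmul_eq_mul] at this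
  rw [← ENNReal.ofReal_natCast, ← ENNReal.ofReal_mul (by positivity),
    ENNReal.ofReal_le_ofReal_iff (by linarith)] at this
  linarith

theorem invBranch_rational {d : List ℕ} {s : ℝ} (hs : ¬ Irrational s) :
    ¬ Irrational (invBranch d s) := by
  induction d with
  | nil => exact hs
  | cons a l ih =>
    rw [invBranch_cons, invBranch1, irrational_inv_iff]
    exact fun h => ih (h.of_add_natCast a)

theorem continuousOn_invBranch {d : List ℕ} (hd : PosWord d) :
    ContinuousOn (invBranch d) (Icc 0 1) := by
  have : ContinuousOn (fun x : ℝ => (cfP d + cfP' d * x) / (cfQ d + cfQ' d * x)) (Icc 0 1) := by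
    refine ContinuousOn.div (by fun_prop) (by fun_prop) fun x hx => (cfDen_pos hd hx.1).ne'
  exact this.congr fun x hx => invBranch_eq hd hx.1

/-- Irrational points strictly between the images of `0` and `1` belong to the cylinder. -/
theorem mem_cylinder_of_mem_uIcc {d : List ℕ} (hd : PosWord d) {y : ℝ} (hy : Irrational y)
    (h : y ∈ uIcc (invBranch d 0) (invBranch d 1)) : y ∈ cylinder d := by
  have hc : ContinuousOn (invBranch d) (uIcc 0 1) := by
    rw [uIcc_of_le zero_le_one]; exact continuousOn_invBranch hd
  obtain ⟨s, hs, rfl⟩ := intermediate_value_uIcc hc h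
  rw [uIcc_of_le zero_le_one] at hs
  refine invBranch_mem_cylinder hd ⟨hs, ?_⟩
  by_contra hir
  exact invBranch_rational hir hy

theorem invBranch_mem_uIcc {d : List ℕ} (hd : PosWord d) {s : ℝ} (hs : s ∈ Icc (0 : ℝ) 1) :
    invBranch d s ∈ uIcc (invBranch d 0) (invBranch d 1) := by
  have h0 := invBranch_sub hd hs.1 le_rfl
  have h1 := invBranch_sub hd hs.1 zero_le_one
  have p := cfDen_pos hd hs.1
  have p0 := cfDen_pos hd le_rfl
  have p1 := cfDen_pos hd zero_le_one
  rcases neg_one_pow_eq_or ℝ d.length with he | he <;> rw [he] at h0 h1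
  · refine mem_uIcc.2 (.inl ⟨?_, ?_⟩)
    · have : 0 ≤ 1 * (s - 0) / ((cfQ d + cfQ' d * s) * (cfQ d + cfQ' d * 0)) := by
        have := hs.1
        rw [sub_zero]; positivity
      linarith
    · have : 1 * (s - 1) / ((cfQ d + cfQ' d * s) * (cfQ d + cfQ' d * 1)) ≤ 0 :=
        div_nonpos_of_nonpos_of_nonneg (by linarith [hs.2]) (by positivity)
      linarith
  · refine mem_uIcc.2 (.inr ⟨?_, ?_⟩)
    · have : 0 ≤ -1 * (s - 1) / ((cfQ d + cfQ' d * s) * (cfQ d + cfQ' d * 1)) :=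
        div_nonneg (by linarith [hs.2]) (by positivity)
      linarith
    · have : -1 * (s - 0) / ((cfQ d + cfQ' d * s) * (cfQ d + cfQ' d * 0)) ≤ 0 :=
        div_nonpos_of_nonpos_of_nonneg (by linarith [hs.1]) (by positivity)
      linarith

theorem le_abs_invBranch_one_sub {d : List ℕ} (hd : PosWord d) :
    1 / (2 * (cfQ d : ℝ) ^ 2) ≤ |invBranch d 1 - invBranch d 0| := by
  have hq : (0 : ℝ) < cfQ d := by exact_mod_cast cfQ_pos hd
  have h1 := cfDen_le hd (le_refl (1 : ℝ))
  have h2 := cfDen_pos hd zero_le_one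
  rw [invBranch_sub hd zero_le_one le_rfl, abs_div, abs_mul, abs_pow, abs_neg, abs_one, one_pow,
    sub_zero, abs_one, mul_zero, add_zero, mul_one, abs_of_pos (by positivity)]
  refine one_div_le_one_div_of_le (by positivity) ?_
  rw [sq, ← mul_assoc]
  gcongr

/-- The number of words of given length with bounded continuant whose cylinder comes close to a
given point. -/
theorem card_words_near_le {k : ℕ} {u r Q : ℝ} (hr : 0 ≤ r) (hQ : 0 < Q) {F : Finset (List ℕ)}
    (hF : ∀ d ∈ F, d.length = k ∧ PosWord d ∧ (cfQ d : ℝ) ^ 2 ≤ Q ∧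
      ∃ s ∈ Icc (0 : ℝ) 1, |invBranch d s - u| ≤ r) :
    (F.card : ℝ) ≤ 4 * r * Q + 2 := by
  set lo : List ℕ → ℝ := fun d => min (invBranch d 0) (invBranch d 1)
  set hi : List ℕ → ℝ := fun d => max (invBranch d 0) (invBranch d 1)
  have key := card_mul_le_of_disjoint_Ioo (F := F) (lo := lo) (hi := hi) (u := u) (r := r)
    (η := 1 / (2 * Q)) hr (by positivity) ?_ ?_ ?_
  · rw [mul_one_div, mul_one_div, div_le_iff₀ (by positivity)] at key
    calc (F.card : ℝ) ≤ _ := key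
      _ = 4 * r * Q + 2 := by field_simp; ring
  · intro c hc d hd hcd
    by_contra hne
    obtain ⟨y, hy⟩ := Set.not_disjoint_iff_nonempty_inter.1 hne
    obtain ⟨z, hz1, hz2⟩ := dense_irrational.exists_mem_open
      ((isOpen_Ioo (a := lo c) (b := hi c)).inter (isOpen_Ioo (a := lo d) (b := hi d))) ⟨y, hy⟩
    obtain ⟨hc1, hc2, -⟩ := hF c hc
    obtain ⟨hd1, hd2, -⟩ := hF d hd
    refine Set.disjoint_left.1 (cylinder_disjoint (hc1.trans hd1.symm) hcd)
      (mem_cylinder_of_mem_uIcc hc2 hz1 ?_) (mem_cylinder_of_mem_uIcc hd2 hz1 ?_)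
    · exact Ioo_subset_Icc_self hz2.1
    · exact Ioo_subset_Icc_self hz2.2
  · intro d hd
    obtain ⟨-, h1, h2, -⟩ := hF d hd
    have hq : (0 : ℝ) < cfQ d := by exact_mod_cast cfQ_pos h1
    have h3 := le_abs_invBranch_one_sub h1
    have h4 : 1 / (2 * Q) ≤ 1 / (2 * (cfQ d : ℝ) ^ 2) :=
      one_div_le_one_div_of_le (by positivity) (by linarith)
    have h5 := max_sub_min_eq_abs (invBranch d 0) (invBranch d 1)
    simp only [lo, hi]
    linarith
  · intro d hd
    obtain ⟨-, h1, -, s, hs, h2⟩ := hF d hd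
    exact ⟨_, invBranch_mem_uIcc h1 hs, h2⟩

namespace GibbsSystem

variable {φ : ℝ → ℝ} {μ : Measure ℝ} {B θ C : ℝ}

theorem measure_cylinder_le_of_typical (G : GibbsSystem φ μ B θ C) {lam h b : ℝ} {k : ℕ}
    {c : List ℕ} {x : ℝ} (hc : c.length = k) (hx : x ∈ cylinder c)
    (ht : x ∈ typicalSet φ lam h b k) : μ.real (cylinder c) ≤ C * Real.exp (-(k * h) + b) := by
  have h1 := (abs_le.1 ht.2.2).2
  have h2 := G.gibbs_le c (posWord_of_mem_cylinder hx) _ (gaussMap_iterate_mem hx.1 c.length)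
  rw [gw, wsum, invBranch_gaussMap_iterate hx, hc] at h2
  refine h2.trans ?_
  have := G.C_pos
  gcongr
  linarith

end GibbsSystem

/-- Gallagher's inequality, a one-dimensional Sobolev bound. -/
theorem normSq_le_integral_of_hasDerivAt {F F' : ℝ → ℂ} (hF : ∀ x, HasDerivAt F (F' x) x)
    (hF' : Continuous F') {δ : ℝ} (hδ : 0 < δ) (y : ℝ) :
    ‖F y‖ ^ 2 ≤ ∫ z in y..(y + δ), (2 / δ * ‖F z‖ ^ 2 + δ * ‖F' z‖ ^ 2) := by
  have hFc : Continuous F := continuous_iff_continuousAt.2 fun x => (hF x).continuousAt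
  have hN : ∀ x, HasDerivAt (fun x => ‖F x‖ ^ 2) (2 * inner ℝ (F x) (F' x)) x :=
    fun x => (hF x).norm_sq
  have hinner : Continuous fun x => inner ℝ (F x) (F' x) := hFc.inner hF'
  have hH : ∀ x, HasDerivAt (fun x => (y + δ - x) * ‖F x‖ ^ 2)
      (-1 * ‖F x‖ ^ 2 + (y + δ - x) * (2 * inner ℝ (F x) (F' x))) x := by
    intro x
    have := ((hasDerivAt_id x).const_sub (y + δ)).mul (hN x)
    exact this
  have hftc := intervalIntegral.integral_eq_sub_of_hasDerivAt (a := y) (b := y + δ)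
    (fun x _ => hH x) (by
      apply Continuous.intervalIntegrable
      fun_prop)
  have hle : ∫ z in y..(y + δ), -(-1 * ‖F z‖ ^ 2 + (y + δ - z) * (2 * inner ℝ (F z) (F' z))) ≤
      ∫ z in y..(y + δ), δ * (2 / δ * ‖F z‖ ^ 2 + δ * ‖F' z‖ ^ 2) := by
    refine intervalIntegral.integral_mono_on (by linarith) ?_ ?_ ?_
    · apply Continuous.intervalIntegrable; fun_prop
    · apply Continuous.intervalIntegrable; fun_prop
    · intro z hz
      have h1 : |inner ℝ (F z) (F' z)| ≤ ‖F z‖ * ‖F' z‖ := abs_real_inner_le_norm _ _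
      have h2 : -((y + δ - z) * inner ℝ (F z) (F' z)) ≤ δ * (‖F z‖ * ‖F' z‖) := by
        calc _ ≤ |(y + δ - z) * inner ℝ (F z) (F' z)| := neg_le_abs _
          _ = (y + δ - z) * |inner ℝ (F z) (F' z)| := by
            rw [abs_mul, abs_of_nonneg (by linarith [hz.2])]
          _ ≤ _ := by gcongr; linarith [hz.1]
      have h3 : δ * (2 / δ * ‖F z‖ ^ 2 + δ * ‖F' z‖ ^ 2) =
          2 * ‖F z‖ ^ 2 + (δ * ‖F' z‖) ^ 2 := by field_simp
      nlinarith [sq_nonneg (‖F z‖ - δ * ‖F' z‖)]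
  rw [intervalIntegral.integral_neg, hftc, intervalIntegral.integral_const_mul] at hle
  have : δ * ‖F y‖ ^ 2 ≤ δ * ∫ z in y..(y + δ), (2 / δ * ‖F z‖ ^ 2 + δ * ‖F' z‖ ^ 2) := by
    refine le_trans (le_of_eq ?_) hle
    ring
  exact le_of_mul_le_mul_left this hδ

theorem norm_integral_exp_mul_gaussian (s x₀ : ℝ) {ℓ : ℝ} (hℓ : 0 < ℓ) :
    ‖∫ z : ℝ, Complex.exp ((2 * π * s * z : ℝ) * Complex.I) *
      (Real.exp (-π * (z - x₀) ^ 2 / ℓ ^ 2) : ℂ)‖ = ℓ * Real.exp (-π * ℓ ^ 2 * s ^ 2) := by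
  have hb : 0 < ((π / ℓ ^ 2 : ℝ) : ℂ).re := by rw [Complex.ofReal_re]; positivity
  have key := fourierIntegral_gaussian hb ((2 * π * s : ℝ) : ℂ)
  rw [← integral_add_right_eq_self _ x₀]
  have h1 : ∀ z : ℝ, Complex.exp ((2 * π * s * (z + x₀) : ℝ) * Complex.I) *
      (Real.exp (-π * (z + x₀ - x₀) ^ 2 / ℓ ^ 2) : ℂ) =
      Complex.exp ((2 * π * s * x₀ : ℝ) * Complex.I) *
        (Complex.exp (Complex.I * ((2 * π * s : ℝ) : ℂ) * z) *
          Complex.exp (-((π / ℓ ^ 2 : ℝ) : ℂ) * z ^ 2)) := by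
    intro z
    rw [Complex.ofReal_exp, ← Complex.exp_add, ← Complex.exp_add, ← Complex.exp_add]
    congr 1
    push_cast
    ring
  simp_rw [h1]
  rw [integral_const_mul, key, norm_mul, norm_mul, Complex.norm_exp_ofReal_mul_I, one_mul,
    Complex.norm_exp]
  congr 1
  · rw [← Complex.ofReal_div, show ((1 / 2 : ℂ)) = ((1 / 2 : ℝ) : ℂ) by norm_num,
      ← Complex.ofReal_cpow (by positivity), Complex.norm_real, ← Real.sqrt_eq_rpow,
      show π / (π / ℓ ^ 2) = ℓ ^ 2 by field_simp, Real.sqrt_sq hℓ.le]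
    exact abs_of_pos hℓ
  · rw [show (-((2 * π * s : ℝ) : ℂ) ^ 2 / (4 * ((π / ℓ ^ 2 : ℝ) : ℂ))) =
      ((-π * ℓ ^ 2 * s ^ 2 : ℝ) : ℂ) by push_cast; field_simp; ring, Complex.ofReal_re]

theorem integrable_gaussian_window (x₀ : ℝ) {ℓ : ℝ} (hℓ : 0 < ℓ) :
    Integrable fun z : ℝ => Real.exp (-π * (z - x₀) ^ 2 / ℓ ^ 2) := by
  have := (integrable_exp_neg_mul_sq (b := π / ℓ ^ 2) (by positivity)).comp_sub_right x₀
  refine this.congr (Eventually.of_forall fun z => ?_)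
  simp only
  congr 1; ring

/-- The mean square of an exponential sum against a Gaussian window. -/
theorem integral_normSq_expSum_gaussian_le {ι : Type*} (s : Finset ι) {γ : ι → ℂ} {β t : ι → ℝ}
    {m : ℝ} (hγ : ∀ i ∈ s, ‖γ i‖ ≤ m * β i) (x₀ : ℝ) {ℓ : ℝ} (hℓ : 0 < ℓ) :
    Integrable (fun z : ℝ => ‖∑ i ∈ s, γ i * Complex.exp ((2 * π * t i * z : ℝ) * Complex.I)‖ ^ 2 *
      Real.exp (-π * (z - x₀) ^ 2 / ℓ ^ 2)) ∧
    ∫ z : ℝ, ‖∑ i ∈ s, γ i * Complex.exp ((2 * π * t i * z : ℝ) * Complex.I)‖ ^ 2 *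
      Real.exp (-π * (z - x₀) ^ 2 / ℓ ^ 2) ≤
    m ^ 2 * ℓ * ∑ i ∈ s, ∑ j ∈ s, β i * β j * Real.exp (-π * ℓ ^ 2 * (t i - t j) ^ 2) := by
  have hexp : ∀ z : ℝ,
      ((‖∑ i ∈ s, γ i * Complex.exp ((2 * π * t i * z : ℝ) * Complex.I)‖ ^ 2 *
        Real.exp (-π * (z - x₀) ^ 2 / ℓ ^ 2) : ℝ) : ℂ) =
      ∑ i ∈ s, ∑ j ∈ s, γ i * (starRingEnd ℂ) (γ j) *
        (Complex.exp ((2 * π * (t i - t j) * z : ℝ) * Complex.I) *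
          (Real.exp (-π * (z - x₀) ^ 2 / ℓ ^ 2) : ℂ)) := by
    intro z
    rw [Complex.ofReal_mul, Complex.ofReal_pow, ← Complex.mul_conj', map_sum, Finset.sum_mul_sum,
      Finset.sum_mul]
    refine Finset.sum_congr rfl fun i _ => ?_
    rw [Finset.sum_mul]
    refine Finset.sum_congr rfl fun j _ => ?_
    rw [map_mul, ← Complex.exp_conj, map_mul, Complex.conj_I, Complex.conj_ofReal]
    have : Complex.exp ((2 * π * (t i - t j) * z : ℝ) * Complex.I) =
        Complex.exp ((2 * π * t i * z : ℝ) * Complex.I) *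
          Complex.exp ((2 * π * t j * z : ℝ) * -Complex.I) := by
      rw [← Complex.exp_add]; congr 1; push_cast; ring
    rw [this]; ring
  have hInt_formula : ∀ r : ℝ, Integrable fun z : ℝ =>
      Complex.exp ((2 * π * r * z : ℝ) * Complex.I) *
        (Real.exp (-π * (z - x₀) ^ 2 / ℓ ^ 2) : ℂ) := by
    intro r
    refine (integrable_gaussian_window x₀ hℓ).ofReal.bdd_mul (c := 1) ?_ ?_
    · exact Continuous.aestronglyMeasurable (by fun_prop)
    · exact Eventually.of_forall fun z => (Complex.norm_exp_ofReal_mul_I _).le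
  have hInt : Integrable fun z : ℝ =>
      ((‖∑ i ∈ s, γ i * Complex.exp ((2 * π * t i * z : ℝ) * Complex.I)‖ ^ 2 *
        Real.exp (-π * (z - x₀) ^ 2 / ℓ ^ 2) : ℝ) : ℂ) := by
    simp_rw [hexp]
    exact integrable_finsetSum _ fun i _ => integrable_finsetSum _ fun j _ =>
      (hInt_formula _).const_mul _
  refine ⟨hInt.re.congr (Eventually.of_forall fun z => Complex.ofReal_re _), ?_⟩
  refine le_trans (le_abs_self _) ?_
  rw [← Real.norm_eq_abs, ← Complex.norm_real, ← integral_complex_ofReal]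
  simp_rw [hexp]
  rw [integral_finsetSum _ fun i _ => integrable_finsetSum _ fun j _ => (hInt_formula _).const_mul _,
    Finset.mul_sum]
  refine (norm_sum_le _ _).trans (Finset.sum_le_sum fun i hi => ?_)
  rw [integral_finsetSum _ fun j _ => (hInt_formula _).const_mul _, Finset.mul_sum]
  refine (norm_sum_le _ _).trans (Finset.sum_le_sum fun j hj => ?_)
  rw [integral_const_mul, norm_mul, norm_integral_exp_mul_gaussian _ _ hℓ, norm_mul,
    RCLike.norm_conj]
  calc ‖γ i‖ * ‖γ j‖ * (ℓ * Real.exp (-π * ℓ ^ 2 * (t i - t j) ^ 2))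
      ≤ (m * β i) * (m * β j) * (ℓ * Real.exp (-π * ℓ ^ 2 * (t i - t j) ^ 2)) := by
        gcongr
        · exact (norm_nonneg _).trans (hγ i hi)
        · exact hγ i hi
        · exact hγ j hj
    _ = _ := by ring

/-- A large sieve inequality for a measure supported in a short interval and satisfying a
non-concentration bound at the scale of the inverse maximal frequency. -/
theorem integral_normSq_expSum_le {ι : Type*} (s : Finset ι) {α : ι → ℂ} {β t : ι → ℝ} {ρ : Measure ℝ}
    [IsFiniteMeasure ρ] {x₀ ℓ T κ : ℝ} (hT : 0 < T) (hℓ : 1 / T ≤ ℓ) (hκ : 0 ≤ κ)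
    (hα : ∀ i ∈ s, ‖α i‖ ≤ β i) (ht : ∀ i ∈ s, |t i| ≤ T) (hρ : ∀ᵐ y ∂ρ, |y - x₀| ≤ ℓ)
    (hconc : ∀ z : ℝ, ρ.real (Icc (z - 1 / T) z) ≤ κ) :
    ∫ y, ‖∑ i ∈ s, α i * Complex.exp ((2 * π * t i * y : ℝ) * Complex.I)‖ ^ 2 ∂ρ ≤
      Real.exp (4 * π) * (2 + 4 * π ^ 2) * (κ * (T * ℓ)) *
        ∑ i ∈ s, ∑ j ∈ s, β i * β j * Real.exp (-π * ℓ ^ 2 * (t i - t j) ^ 2) := by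
  have hℓ0 : 0 < ℓ := lt_of_lt_of_le (by positivity) hℓ
  set F : ℝ → ℂ := fun y => ∑ i ∈ s, α i * Complex.exp ((2 * π * t i * y : ℝ) * Complex.I)
  set γ : ι → ℂ := fun i => α i * ((2 * π * t i : ℝ) * Complex.I) with hγ
  set F' : ℝ → ℂ := fun y => ∑ i ∈ s, γ i * Complex.exp ((2 * π * t i * y : ℝ) * Complex.I)
  have hF : ∀ x, HasDerivAt F (F' x) x := by
    intro x
    refine HasDerivAt.fun_sum fun i _ => ?_
    have hc : γ i * Complex.exp ((2 * π * t i * x : ℝ) * Complex.I) = α i *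
        (Complex.exp ((2 * π * t i * x : ℝ) * Complex.I) * ((2 * π * t i : ℝ) * Complex.I)) := by
      rw [hγ]; ring
    rw [hc]
    refine HasDerivAt.const_mul _ (HasDerivAt.cexp ?_)
    have := ((hasDerivAt_id x).const_mul (2 * π * t i)).ofReal_comp.mul_const Complex.I
    simpa using this
  have hFc : Continuous F := continuous_iff_continuousAt.2 fun x => (hF x).continuousAt
  have hF'c : Continuous F' := by fun_prop
  set D : ℝ := ∑ i ∈ s, ∑ j ∈ s, β i * β j * Real.exp (-π * ℓ ^ 2 * (t i - t j) ^ 2)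
  obtain ⟨i1, b1⟩ := integral_normSq_expSum_gaussian_le s (γ := α) (β := β)
    (t := t) (m := 1) (fun i hi => by rw [one_mul]; exact hα i hi) x₀ hℓ0
  obtain ⟨i2, b2⟩ := integral_normSq_expSum_gaussian_le s (γ := γ) (β := β)
    (t := t) (m := 2 * π * T) (fun i hi => by
      rw [hγ]
      simp only
      rw [norm_mul, norm_mul, Complex.norm_I, Complex.norm_real, Real.norm_eq_abs, abs_mul,
        abs_of_pos (by positivity : 0 < 2 * π), mul_one, mul_comm]
      have := hα i hi
      have := ht i hi
      gcongr) x₀ hℓ0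
  set W : ℝ → ℝ := fun z => Real.exp (-π * (z - x₀) ^ 2 / ℓ ^ 2)
  set H : ℝ → ℝ := fun z => 2 / (1 / T) * ‖F z‖ ^ 2 + 1 / T * ‖F' z‖ ^ 2 with hH
  have hHc : Continuous H := by fun_prop
  have hH0 : ∀ z, 0 ≤ H z := fun z => by positivity
  have hHint : Integrable fun z => H z * W z := by
    have := (i1.const_mul (2 / (1 / T))).add (i2.const_mul (1 / T))
    refine this.congr (Eventually.of_forall fun z => ?_)
    simp only [Pi.add_apply, hH]; ring
  have hHle : ∫ z, H z * W z ≤ (2 + 4 * π ^ 2) * (T * ℓ) * D := by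
    have : ∫ z, H z * W z = 2 / (1 / T) * (∫ z, ‖F z‖ ^ 2 * W z) +
        1 / T * ∫ z, ‖F' z‖ ^ 2 * W z := by
      rw [← integral_const_mul, ← integral_const_mul, ← integral_add (i1.const_mul _)
        (i2.const_mul _)]
      refine integral_congr_ae (Eventually.of_forall fun z => ?_)
      simp only [hH]; ring
    rw [this]
    calc _ ≤ 2 / (1 / T) * (1 ^ 2 * ℓ * D) + 1 / T * ((2 * π * T) ^ 2 * ℓ * D) := by
          gcongr
      _ = _ := by field_simp; ring
  have hmain : ∫⁻ y, ENNReal.ofReal (‖F y‖ ^ 2) ∂ρ ≤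
      ENNReal.ofReal (Real.exp (4 * π) * κ * ∫ z, H z * W z) := by
    have hmeasE : MeasurableSet {p : ℝ × ℝ | p.1 ≤ p.2 ∧ p.2 ≤ p.1 + 1 / T ∧ |p.1 - x₀| ≤ ℓ} :=
      (measurableSet_le measurable_fst measurable_snd).inter
        ((measurableSet_le measurable_snd (measurable_fst.add_const _)).inter
          (measurableSet_le (measurable_fst.sub_const _).abs measurable_const))
    set E : Set (ℝ × ℝ) := {p | p.1 ≤ p.2 ∧ p.2 ≤ p.1 + 1 / T ∧ |p.1 - x₀| ≤ ℓ} with hE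
    calc ∫⁻ y, ENNReal.ofReal (‖F y‖ ^ 2) ∂ρ
        ≤ ∫⁻ y, (∫⁻ z, E.indicator (fun p => ENNReal.ofReal (H p.2)) (y, z)) ∂ρ := by
          refine lintegral_mono_ae ?_
          filter_upwards [hρ] with y hy
          have h1 := normSq_le_integral_of_hasDerivAt hF hF'c (by positivity : 0 < 1 / T) y
          have h2 : (fun z => E.indicator (fun p => ENNReal.ofReal (H p.2)) (y, z)) =
              (Icc y (y + 1 / T)).indicator fun z => ENNReal.ofReal (H z) := by
            ext z
            simp only [hE, Set.indicator, Set.mem_ofPred_eq, Set.mem_Icc, hy, and_true]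
          rw [h2, lintegral_indicator measurableSet_Icc,
            ← ofReal_integral_eq_lintegral_ofReal (hHc.integrableOn_Icc)
              (Eventually.of_forall hH0)]
          refine ENNReal.ofReal_le_ofReal (h1.trans (le_of_eq ?_))
          rw [intervalIntegral.integral_of_le (by linarith [(by positivity : 0 < 1 / T)]),
            integral_Icc_eq_integral_Ioc]
      _ = ∫⁻ z, ∫⁻ y, E.indicator (fun p => ENNReal.ofReal (H p.2)) (y, z) ∂ρ := by
          refine lintegral_lintegral_swap ?_
          refine Measurable.aemeasurable ?_
          exact (Measurable.ennreal_ofReal (hHc.measurable.comp measurable_snd)).indicator hmeasE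
      _ ≤ ∫⁻ z, ENNReal.ofReal (Real.exp (4 * π) * κ * (H z * W z)) := by
          refine lintegral_mono fun z => ?_
          by_cases hz : |z - x₀| ≤ 2 * ℓ
          · calc ∫⁻ y, E.indicator (fun p => ENNReal.ofReal (H p.2)) (y, z) ∂ρ
                ≤ ∫⁻ y, (Icc (z - 1 / T) z).indicator (fun _ => ENNReal.ofReal (H z)) y ∂ρ := by
                  refine lintegral_mono fun y => ?_
                  simp only [hE, Set.indicator, Set.mem_ofPred_eq, Set.mem_Icc]
                  split_ifs with h1 h2 h2
                  · exact le_rfl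
                  · exact absurd ⟨by linarith [h1.2.1], h1.1⟩ h2
                  · exact zero_le
                  · exact le_rfl
              _ = ENNReal.ofReal (H z) * ρ (Icc (z - 1 / T) z) := by
                  rw [lintegral_indicator measurableSet_Icc, setLIntegral_const]
              _ ≤ ENNReal.ofReal (H z) * ENNReal.ofReal κ := by
                  gcongr
                  rw [← ofReal_measureReal]
                  exact ENNReal.ofReal_le_ofReal (hconc z)
              _ = ENNReal.ofReal (H z * κ) := (ENNReal.ofReal_mul (hH0 z)).symm
              _ ≤ _ := by
                  refine ENNReal.ofReal_le_ofReal ?_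
                  have hW : 1 ≤ Real.exp (4 * π) * W z := by
                    rw [← Real.exp_add]
                    refine Real.one_le_exp ?_
                    have : (z - x₀) ^ 2 ≤ (2 * ℓ) ^ 2 := sq_le_sq' (abs_le.1 hz).1 (abs_le.1 hz).2
                    have h3 : (z - x₀) ^ 2 / ℓ ^ 2 ≤ 4 := by
                      rw [div_le_iff₀ (by positivity)]; linarith
                    have : π * ((z - x₀) ^ 2 / ℓ ^ 2) ≤ π * 4 := by gcongr
                    have h4 : -π * (z - x₀) ^ 2 / ℓ ^ 2 = -(π * ((z - x₀) ^ 2 / ℓ ^ 2)) := by ring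
                    rw [h4]; linarith
                  calc H z * κ = H z * κ * 1 := (mul_one _).symm
                    _ ≤ H z * κ * (Real.exp (4 * π) * W z) := by
                      have := hH0 z
                      gcongr
                    _ = _ := by ring
          · have : ∀ y, E.indicator (fun p => ENNReal.ofReal (H p.2)) (y, z) = 0 := by
              intro y
              refine Set.indicator_of_notMem ?_ _
              rintro ⟨h1, h2, h3⟩
              refine hz ?_
              simp only at h1 h2 h3
              have := abs_le.1 h3
              exact abs_le.2 ⟨by linarith, by linarith⟩
            simp [this]
      _ = ENNReal.ofReal (Real.exp (4 * π) * κ * ∫ z, H z * W z) := by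
          rw [← integral_const_mul, ofReal_integral_eq_lintegral_ofReal (hHint.const_mul _)]
          exact Eventually.of_forall fun z => by
            have := hH0 z
            positivity
  rw [integral_eq_lintegral_of_nonneg_ae (Eventually.of_forall fun y => by positivity)
    (by fun_prop)]
  refine (ENNReal.toReal_mono ENNReal.ofReal_ne_top hmain).trans ?_
  have hI : 0 ≤ ∫ z, H z * W z := integral_nonneg fun z => mul_nonneg (hH0 z) (Real.exp_pos _).le
  rw [ENNReal.toReal_ofReal (by positivity)]
  calc _ ≤ Real.exp (4 * π) * κ * ((2 + 4 * π ^ 2) * (T * ℓ) * D) := by gcongr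
    _ = _ := by ring

theorem exp_half_sq (x : ℝ) : Real.exp (x / 2) ^ 2 = Real.exp x := by
  rw [← Real.exp_nat_mul]; congr 1; push_cast; ring

theorem cfQ_le_of_typical {φ : ℝ → ℝ} {lam h b : ℝ} {k : ℕ} {c : List ℕ} {x : ℝ}
    (hc : c.length = k) (hx : x ∈ cylinder c) (ht : x ∈ typicalSet φ lam h b k) :
    (cfQ c : ℝ) ≤ Real.exp ((k * lam + b) / 2) := by
  have := cfQ_sq_le_of_typical hc hx ht
  rw [← exp_half_sq] at this
  exact (pow_le_pow_iff_left₀ (by positivity) (Real.exp_pos _).le two_ne_zero).1 this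

theorem le_cfQ_of_typical {φ : ℝ → ℝ} {lam h b : ℝ} {k : ℕ} {c : List ℕ} {x : ℝ}
    (hc : c.length = k) (hx : x ∈ cylinder c) (ht : x ∈ typicalSet φ lam h b k) :
    Real.exp ((k * lam - b) / 2) ≤ 2 * (cfQ c : ℝ) := by
  have := le_cfQ_sq_of_typical hc hx ht
  rw [← exp_half_sq, show 4 * (cfQ c : ℝ) ^ 2 = (2 * cfQ c) ^ 2 by ring] at this
  exact (pow_le_pow_iff_left₀ (Real.exp_pos _).le (by positivity) two_ne_zero).1 this

namespace GibbsSystem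

variable {φ : ℝ → ℝ} {μ : Measure ℝ} {B θ C : ℝ}

theorem sum_measure_cylinder (G : GibbsSystem φ μ B θ C) {A : Finset (List ℕ)} {n : ℕ}
    (hA : ∀ a ∈ A, a.length = n) :
    ∑ a ∈ A, μ.real (cylinder a) = μ.real (⋃ a ∈ A, cylinder a) := by
  have := G.prob
  rw [measureReal_biUnion_finset]
  · intro a ha a' ha' hne
    exact cylinder_disjoint ((hA a ha).trans (hA a' ha').symm) hne
  · exact fun a _ => measurableSet_cylinder a

theorem sum_measure_cylinder_le_one (G : GibbsSystem φ μ B θ C) {A : Finset (List ℕ)} {n : ℕ}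
    (hA : ∀ a ∈ A, a.length = n) : ∑ a ∈ A, μ.real (cylinder a) ≤ 1 := by
  have := G.prob
  rw [G.sum_measure_cylinder hA]
  exact measureReal_le_one

/-- The mass of typical cylinders near a given point. -/
theorem sum_measure_near_le (G : GibbsSystem φ μ B θ C) {lam h b v r : ℝ} (hr : 0 ≤ r) {n j : ℕ}
    (hj : j ≤ n) {A : Finset (List ℕ)} {x : List ℕ → ℝ}
    (hA : ∀ a ∈ A, a.length = n ∧ x a ∈ cylinder a ∧ x a ∈ typicalSet φ lam h b j ∧
      |x a - v| ≤ r) :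
    ∑ a ∈ A, μ.real (cylinder a) ≤
      (4 * r * Real.exp (j * lam + b) + 2) * (C * Real.exp (-(j * h) + b)) := by
  have := G.prob
  have hC := G.C_pos
  rw [G.sum_measure_cylinder fun a ha => (hA a ha).1]
  set W : Set (List ℕ) := {d | d.length = j ∧ ∃ a ∈ A, x a ∈ cylinder d} with hW
  refine measureReal_le_of_card_le (W := W) (g := fun d => cylinder d) (by positivity) ?_ ?_ ?_
  · intro F hF
    refine card_words_near_le (k := j) (u := v) hr (Real.exp_pos _) fun d hd => ?_
    obtain ⟨h1, a, ha, had⟩ := hF hd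
    obtain ⟨-, -, h4, h5⟩ := hA a ha
    refine ⟨h1, posWord_of_mem_cylinder had, cfQ_sq_le_of_typical h1 had h4,
      gaussMap^[d.length] (x a), (gaussMap_iterate_mem had.1 _).1, ?_⟩
    rwa [invBranch_gaussMap_iterate had]
  · rintro d ⟨h1, a, ha, had⟩
    exact G.measure_cylinder_le_of_typical h1 had (hA a ha).2.2.1
  · simp only [Set.iUnion_subset_iff]
    intro a ha y hy
    obtain ⟨h1, h2, -, -⟩ := hA a ha
    rw [Set.mem_iUnion₂]
    have hlen : (a.take j).length = j := by rw [List.length_take]; omega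
    have hya : y ∈ cylinder (a.take j ++ a.drop j) := by rwa [List.take_append_drop]
    have hxa : x a ∈ cylinder (a.take j ++ a.drop j) := by rwa [List.take_append_drop]
    exact ⟨a.take j, ⟨hlen, a, ha, (mem_cylinder_append.1 hxa).1⟩, (mem_cylinder_append.1 hya).1⟩

/-- The mass of cylinders with typical ends whose ratio of continuants is near a given point. -/
theorem sum_measure_cfRatio_near_le (G : GibbsSystem φ μ B θ C) {lam h b v r : ℝ} (hr : 0 ≤ r)
    {n k : ℕ} (hk : k ≤ n) {A : Finset (List ℕ)} {x : List ℕ → ℝ}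
    (hA : ∀ a ∈ A, a.length = n ∧ x a ∈ cylinder a ∧
      gaussMap^[n - k] (x a) ∈ typicalSet φ lam h b k ∧ |cfRatio a - v| ≤ r) :
    ∑ a ∈ A, μ.real (cylinder a) ≤
      (4 * r * Real.exp (k * lam + b) + 2) * (C * Real.exp (-(k * h) + b)) := by
  have := G.prob
  have hC := G.C_pos
  rw [G.sum_measure_cylinder fun a ha => (hA a ha).1]
  have hsplit : ∀ a ∈ A, ∀ y ∈ cylinder a, y ∈ cylinder (a.take (n - k)) ∧
      gaussMap^[n - k] y ∈ cylinder (a.drop (n - k)) := by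
    intro a ha y hy
    have h1 := (hA a ha).1
    have hlen : (a.take (n - k)).length = n - k := by rw [List.length_take]; omega
    have hya : y ∈ cylinder (a.take (n - k) ++ a.drop (n - k)) := by rwa [List.take_append_drop]
    rw [mem_cylinder_append, hlen] at hya
    exact hya
  have hdl : ∀ a ∈ A, (a.drop (n - k)).length = k := by
    intro a ha
    rw [List.length_drop, (hA a ha).1]; omega
  set W : Set (List ℕ) := {d | ∃ a ∈ A, d = (a.drop (n - k)).reverse} with hW
  refine measureReal_le_of_card_le (W := W)
    (g := fun d => gaussMap^[n - k] ⁻¹' cylinder d.reverse) (by positivity) ?_ ?_ ?_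
  · intro F hF
    refine card_words_near_le (k := k) (u := v) hr (Real.exp_pos _) fun d hd => ?_
    obtain ⟨a, ha, rfl⟩ := hF hd
    obtain ⟨-, h3, h4, h5⟩ := hA a ha
    have hs := hsplit a ha _ h3
    have p1 := posWord_of_mem_cylinder hs.1
    have p2 := posWord_of_mem_cylinder hs.2
    refine ⟨by rw [List.length_reverse, hdl a ha], p2.reverse, ?_, cfRatio (a.take (n - k)),
      ⟨cfRatio_nonneg _, cfRatio_le_one p1⟩, ?_⟩
    · rw [cfQ_reverse]
      exact cfQ_sq_le_of_typical (hdl a ha) hs.2 h4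
    · rwa [← cfRatio_append p1 p2, List.take_append_drop]
  · rintro d ⟨a, ha, rfl⟩
    obtain ⟨-, h3, h4, h5⟩ := hA a ha
    have hs := hsplit a ha _ h3
    simp only [List.reverse_reverse]
    rw [(G.mp.iterate (n - k)).measureReal_preimage (measurableSet_cylinder _).nullMeasurableSet]
    exact G.measure_cylinder_le_of_typical (hdl a ha) hs.2 h4
  · simp only [Set.iUnion_subset_iff]
    intro a ha y hy
    rw [Set.mem_iUnion₂]
    refine ⟨(a.drop (n - k)).reverse, ⟨a, ha, rfl⟩, ?_⟩
    simp only [List.reverse_reverse]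
    exact (hsplit a ha y hy).2

end GibbsSystem

/-! ### Typical words -/

/-- The points `x` of `[0, 1]` where an affine function `A + B x` is small lie in a short
interval. -/
theorem exists_abs_sub_le_of_abs_add_mul_le {p q u : ℝ} (hu : 0 ≤ u) (hpq : 0 < max |p| |q|) :
    ∃ v, ∀ x ∈ Icc (0 : ℝ) 1, |p + q * x| ≤ u → |x - v| ≤ 2 * u / max |p| |q| := by
  by_cases hq : |q| ≤ max |p| |q| / 2
  · have hp : max |p| |q| = |p| := by
      rcases max_choice |p| |q| with h | h
      · exact h
      · rw [h] at hq hpq; linarith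
    rw [hp] at hpq hq ⊢
    refine ⟨0, fun x hx h => ?_⟩
    have h1 : |p| ≤ |p + q * x| + |q * x| := by
      have := abs_sub (p + q * x) (q * x)
      simpa using this
    have h2 : |q * x| ≤ |q| := by
      rw [abs_mul, abs_of_nonneg hx.1]
      exact mul_le_of_le_one_right (abs_nonneg _) hx.2
    rw [sub_zero, abs_of_nonneg hx.1]
    refine hx.2.trans ?_
    rw [le_div_iff₀ hpq]
    linarith
  · push Not at hq
    have hq0 : 0 < |q| := lt_trans (by positivity) hq
    have hq1 : q ≠ 0 := abs_pos.1 hq0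
    refine ⟨-p / q, fun x _ h => ?_⟩
    have h1 : x - -p / q = (p + q * x) / q := by field_simp; ring
    rw [h1, abs_div, div_le_div_iff₀ hq0 hpq]
    nlinarith [abs_nonneg (p + q * x)]

theorem abs_cfRatio_sub_le {c d : List ℕ} (hc : PosWord c) (hd : PosWord d) :
    |cfRatio d - cfRatio c| ≤
      2 * max |(cfQ c : ℝ) - cfQ d| |(cfQ' c : ℝ) - cfQ' d| / cfQ c := by
  have hqc : (0 : ℝ) < cfQ c := by exact_mod_cast cfQ_pos hc
  have hqd : (0 : ℝ) < cfQ d := by exact_mod_cast cfQ_pos hd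
  have h1 : cfRatio d - cfRatio c =
      (cfRatio d * ((cfQ c : ℝ) - cfQ d) - ((cfQ' c : ℝ) - cfQ' d)) / cfQ c := by
    rw [cfRatio, cfRatio]; field_simp; ring
  rw [h1, abs_div, abs_of_pos hqc]
  gcongr
  refine (abs_sub _ _).trans ?_
  rw [abs_mul, abs_of_nonneg (cfRatio_nonneg d)]
  have h2 := cfRatio_le_one hd
  have h3 := le_max_left |(cfQ c : ℝ) - cfQ d| |(cfQ' c : ℝ) - cfQ' d|
  have h4 := le_max_right |(cfQ c : ℝ) - cfQ d| |(cfQ' c : ℝ) - cfQ' d|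
  nlinarith [mul_le_of_le_one_left (abs_nonneg ((cfQ c : ℝ) - cfQ d)) h2]

/-- The distance between the continuants of two words. -/
noncomputable def cfGap (c d : List ℕ) : ℝ :=
  max |(cfQ c : ℝ) - cfQ d| |(cfQ' c : ℝ) - cfQ' d|

theorem one_le_cfGap {c d : List ℕ} (hc : PosWord c) (hd : PosWord d) (hlen : c.length = d.length)
    (hne : c ≠ d) : 1 ≤ cfGap c d := by
  have key : ∀ m n : ℕ, m ≠ n → (1 : ℝ) ≤ |(m : ℝ) - n| := by
    intro m n hmn
    have : (1 : ℤ) ≤ |(m : ℤ) - n| := Int.one_le_abs (by omega)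
    exact_mod_cast this
  by_cases h : cfQ c = cfQ d
  · have h' : cfQ' c ≠ cfQ' d := fun h' => hne (eq_of_cfQ_eq hc hd hlen h h')
    exact (key _ _ h').trans (le_max_right _ _)
  · exact (key _ _ h).trans (le_max_left _ _)

theorem cfGap_le {c d : List ℕ} (hc : PosWord c) (hd : PosWord d) {Q : ℝ} (h1 : (cfQ c : ℝ) ≤ Q)
    (h2 : (cfQ d : ℝ) ≤ Q) : cfGap c d ≤ Q := by
  have h3 : (cfQ' c : ℝ) ≤ cfQ c := by exact_mod_cast cfQ'_le_cfQ hc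
  have h4 : (cfQ' d : ℝ) ≤ cfQ d := by exact_mod_cast cfQ'_le_cfQ hd
  have h5 : (0 : ℝ) ≤ cfQ c := by positivity
  have h6 : (0 : ℝ) ≤ cfQ d := by positivity
  have h7 : (0 : ℝ) ≤ cfQ' c := by positivity
  have h8 : (0 : ℝ) ≤ cfQ' d := by positivity
  exact max_le (abs_le.2 ⟨by linarith, by linarith⟩) (abs_le.2 ⟨by linarith, by linarith⟩)

/-- Finite families of typical words: heads `a ∈ A` of length `2 M` with sample points `x a`, and
tails `c ∈ E` of length `M` with sample points `y c`. -/
structure TypicalWords (φ : ℝ → ℝ) (lam h b : ℝ) (M : ℕ) (A E : Finset (List ℕ))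
    (x y : List ℕ → ℝ) : Prop where
  lam_pos : 0 < lam
  h_pos : 0 < h
  b_nonneg : 0 ≤ b
  b_le : b ≤ lam * M
  head_length : ∀ a ∈ A, a.length = 2 * M
  head_mem : ∀ a ∈ A, x a ∈ cylinder a
  head_typical : ∀ a ∈ A, ∀ j ≤ 2 * M, x a ∈ typicalSet φ lam h b j
  tail_length : ∀ c ∈ E, c.length = M
  tail_mem : ∀ c ∈ E, y c ∈ cylinder c
  tail_typical : ∀ c ∈ E, ∀ k ≤ M, gaussMap^[M - k] (y c) ∈ typicalSet φ lam h b k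

namespace TypicalWords

variable {φ : ℝ → ℝ} {μ : Measure ℝ} {B θ C lam h b : ℝ} {M : ℕ} {A E : Finset (List ℕ)}
  {x y : List ℕ → ℝ}

theorem tail_pos (S : TypicalWords φ lam h b M A E x y) {c : List ℕ} (hc : c ∈ E) : PosWord c :=
  posWord_of_mem_cylinder (S.tail_mem c hc)

theorem tail_cfQ_le (S : TypicalWords φ lam h b M A E x y) {c : List ℕ} (hc : c ∈ E) :
    (cfQ c : ℝ) ≤ Real.exp ((M * lam + b) / 2) := by
  have := S.tail_typical c hc M le_rfl
  rw [Nat.sub_self] at this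
  exact cfQ_le_of_typical (S.tail_length c hc) (S.tail_mem c hc) this

theorem le_tail_cfQ (S : TypicalWords φ lam h b M A E x y) {c : List ℕ} (hc : c ∈ E) :
    Real.exp ((M * lam - b) / 2) ≤ 2 * cfQ c := by
  have := S.tail_typical c hc M le_rfl
  rw [Nat.sub_self] at this
  exact le_cfQ_of_typical (S.tail_length c hc) (S.tail_mem c hc) this

theorem measure_tail_le (S : TypicalWords φ lam h b M A E x y) (G : GibbsSystem φ μ B θ C)
    {c : List ℕ} (hc : c ∈ E) : μ.real (cylinder c) ≤ C * Real.exp (-(M * h) + b) := by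
  have := S.tail_typical c hc M le_rfl
  rw [Nat.sub_self] at this
  exact G.measure_cylinder_le_of_typical (S.tail_length c hc) (S.tail_mem c hc) this

/-- The mass of the heads at which two given tails resonate. -/
theorem sum_heads_le (S : TypicalWords φ lam h b M A E x y) (G : GibbsSystem φ μ B θ C)
    {c d : List ℕ} {j : ℕ} (hj : j ≤ 2 * M) (hgap0 : 0 < cfGap c d)
    (hgap : Real.exp (j * lam) ≤ cfGap c d * Real.exp (M * lam / 2)) :
    ∑ a ∈ A, (if |((cfQ c : ℝ) - cfQ d) + ((cfQ' c : ℝ) - cfQ' d) * x a| ≤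
        Real.exp (-(M * lam / 2) + 2 * b) then μ.real (cylinder a) else 0) ≤
      10 * C * Real.exp (4 * b - j * h) := by
  have hC := G.C_pos
  have hb := S.b_nonneg
  obtain ⟨v, hv⟩ := exists_abs_sub_le_of_abs_add_mul_le (p := (cfQ c : ℝ) - cfQ d)
    (q := (cfQ' c : ℝ) - cfQ' d) (Real.exp_pos (-(M * lam / 2) + 2 * b)).le hgap0
  rw [← Finset.sum_filter]
  refine (G.sum_measure_near_le (lam := lam) (h := h) (b := b) (v := v)
    (r := 2 * Real.exp (-(M * lam / 2) + 2 * b) / cfGap c d) (by positivity) hj (x := x) ?_).trans ?_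
  · intro a ha
    obtain ⟨ha, hle⟩ := Finset.mem_filter.1 ha
    exact ⟨S.head_length a ha, S.head_mem a ha, S.head_typical a ha j hj,
      hv _ (S.head_mem a ha).1.1 hle⟩
  · have h1 : 4 * (2 * Real.exp (-(M * lam / 2) + 2 * b) / cfGap c d) * Real.exp (j * lam + b) ≤
        8 * Real.exp (3 * b) := by
      have h2 : Real.exp (j * lam + b) ≤ cfGap c d * Real.exp (M * lam / 2) * Real.exp b := by
        rw [Real.exp_add]; gcongr
      calc _ ≤ 4 * (2 * Real.exp (-(M * lam / 2) + 2 * b) / cfGap c d) *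
            (cfGap c d * Real.exp (M * lam / 2) * Real.exp b) := by gcongr
        _ = 8 * (Real.exp (-(M * lam / 2) + 2 * b) * Real.exp (M * lam / 2) * Real.exp b) := by
            field_simp; ring
        _ = _ := by rw [← Real.exp_add, ← Real.exp_add]; ring_nf
    have h3 : 1 ≤ Real.exp (3 * b) := Real.one_le_exp (by positivity)
    calc _ ≤ (8 * Real.exp (3 * b) + 2 * Real.exp (3 * b)) * (C * Real.exp (-(j * h) + b)) := by
          gcongr; linarith
      _ = 10 * C * (Real.exp (3 * b) * Real.exp (-(j * h) + b)) := by ring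
      _ = _ := by rw [← Real.exp_add]; ring_nf

/-- The mass of the tails whose continuants are at a given distance from those of a given tail. -/
theorem sum_tails_le (S : TypicalWords φ lam h b M A E x y) (G : GibbsSystem φ μ B θ C)
    {c : List ℕ} (hc : c ∈ E) (j : ℕ) :
    ∑ d ∈ E, (if cfGap c d * Real.exp (M * lam / 2) ≤ Real.exp ((j + 1) * lam) then
        μ.real (cylinder d) else 0) ≤
      18 * C * Real.exp (lam + 3 * b - (M - j) * h) := by
  have hC := G.C_pos
  have hb := S.b_nonneg
  have hlam := S.lam_pos
  have hh := S.h_pos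
  rw [← Finset.sum_filter]
  rcases le_or_gt j M with hj | hj
  · have hqc : (0 : ℝ) < cfQ c := by exact_mod_cast cfQ_pos (S.tail_pos hc)
    refine (G.sum_measure_cfRatio_near_le (lam := lam) (h := h) (b := b) (v := cfRatio c)
      (r := 4 * Real.exp ((j + 1) * lam - M * lam + b / 2)) (by positivity) (n := M) (k := M - j)
      (Nat.sub_le _ _) (x := y) ?_).trans ?_
    · intro d hd
      obtain ⟨hd, hle⟩ := Finset.mem_filter.1 hd
      refine ⟨S.tail_length d hd, S.tail_mem d hd, S.tail_typical d hd _ (Nat.sub_le _ _), ?_⟩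
      refine (abs_cfRatio_sub_le (S.tail_pos hc) (S.tail_pos hd)).trans ?_
      rw [div_le_iff₀ hqc]
      have h1 := S.le_tail_cfQ hc
      have h2 : cfGap c d ≤ Real.exp ((j + 1) * lam - M * lam / 2) := by
        rw [Real.exp_sub, le_div_iff₀ (Real.exp_pos _)]; exact hle
      calc 2 * cfGap c d ≤ 2 * Real.exp ((j + 1) * lam - M * lam / 2) := by gcongr
        _ = 2 * (Real.exp ((j + 1) * lam - M * lam + b / 2) * Real.exp ((M * lam - b) / 2)) := by
          rw [← Real.exp_add]; ring_nf
        _ ≤ 2 * (Real.exp ((j + 1) * lam - M * lam + b / 2) * (2 * cfQ c)) := by gcongr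
        _ = _ := by ring
    · rw [Nat.cast_sub hj]
      have h1 : 4 * (4 * Real.exp ((j + 1) * lam - M * lam + b / 2)) *
          Real.exp ((M - j) * lam + b) ≤ 16 * Real.exp (lam + 2 * b) := by
        calc _ = 16 * (Real.exp ((j + 1) * lam - M * lam + b / 2) *
              Real.exp ((M - j) * lam + b)) := by ring
          _ ≤ _ := by
            rw [← Real.exp_add]
            refine mul_le_mul_of_nonneg_left (Real.exp_le_exp.2 ?_) (by norm_num)
            linarith
      have h3 : 1 ≤ Real.exp (lam + 2 * b) := Real.one_le_exp (by positivity)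
      calc _ ≤ (16 * Real.exp (lam + 2 * b) + 2 * Real.exp (lam + 2 * b)) *
            (C * Real.exp (-((M - j) * h) + b)) := by gcongr; linarith
        _ = 18 * C * (Real.exp (lam + 2 * b) * Real.exp (-((M - j) * h) + b)) := by ring
        _ = _ := by rw [← Real.exp_add]; ring_nf
  · refine (G.sum_measure_cylinder_le_one (n := M) fun d hd =>
      S.tail_length d (Finset.mem_filter.1 hd).1).trans ?_
    have hj' : (M : ℝ) < j := by exact_mod_cast hj
    have h1 : 1 ≤ Real.exp (lam + 3 * b - (M - j) * h) := by
      refine Real.one_le_exp ?_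
      nlinarith
    have := G.one_le_C
    nlinarith

/-- The energy estimate: pairs of distinct tails rarely resonate. -/
theorem sum_offDiag_le (S : TypicalWords φ lam h b M A E x y) (G : GibbsSystem φ μ B θ C)
    {c : List ℕ} (hc : c ∈ E) :
    ∑ d ∈ E.erase c, μ.real (cylinder d) *
      ∑ a ∈ A, (if |((cfQ c : ℝ) - cfQ d) + ((cfQ' c : ℝ) - cfQ' d) * x a| ≤
        Real.exp (-(M * lam / 2) + 2 * b) then μ.real (cylinder a) else 0) ≤
      (2 * M + 1) * (180 * C ^ 2 * Real.exp (lam + 7 * b - M * h)) := by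
  have hC := G.C_pos
  have hlam := S.lam_pos
  have hb := S.b_nonneg
  set J : List ℕ → ℕ := fun d => ⌊(Real.log (cfGap c d) + M * lam / 2) / lam⌋₊ with hJ
  have hgap : ∀ d ∈ E.erase c, 1 ≤ cfGap c d := by
    intro d hd
    obtain ⟨h1, h2⟩ := Finset.mem_erase.1 hd
    exact one_le_cfGap (S.tail_pos hc) (S.tail_pos h2)
      ((S.tail_length c hc).trans (S.tail_length d h2).symm) h1.symm
  have hJnn : ∀ d ∈ E.erase c, 0 ≤ (Real.log (cfGap c d) + M * lam / 2) / lam := by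
    intro d hd
    have := Real.log_nonneg (hgap d hd)
    positivity
  have hJle : ∀ d ∈ E.erase c, J d ≤ 2 * M := by
    intro d hd
    have h2 := (Finset.mem_erase.1 hd).2
    have h3 := cfGap_le (S.tail_pos hc) (S.tail_pos h2) (S.tail_cfQ_le hc) (S.tail_cfQ_le h2)
    have h4 : Real.log (cfGap c d) ≤ (M * lam + b) / 2 := by
      rw [Real.log_le_iff_le_exp (by linarith [hgap d hd])]; exact h3
    refine Nat.floor_le_of_le ?_
    rw [div_le_iff₀ hlam]
    push_cast
    have := S.b_le
    nlinarith
  have hJ1 : ∀ d ∈ E.erase c, Real.exp (J d * lam) ≤ cfGap c d * Real.exp (M * lam / 2) := by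
    intro d hd
    have h1 := Nat.floor_le (hJnn d hd)
    rw [le_div_iff₀ hlam] at h1
    have h0 : 0 < cfGap c d := by linarith [hgap d hd]
    calc _ ≤ Real.exp (Real.log (cfGap c d) + M * lam / 2) := Real.exp_le_exp.2 h1
      _ = _ := by rw [Real.exp_add, Real.exp_log h0]
  have hJ2 : ∀ d ∈ E.erase c, cfGap c d * Real.exp (M * lam / 2) ≤ Real.exp ((J d + 1) * lam) := by
    intro d hd
    have h1 := (Nat.lt_floor_add_one ((Real.log (cfGap c d) + M * lam / 2) / lam)).le
    rw [div_le_iff₀ hlam] at h1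
    have h0 : 0 < cfGap c d := by linarith [hgap d hd]
    calc _ = Real.exp (Real.log (cfGap c d) + M * lam / 2) := by
          rw [Real.exp_add, Real.exp_log h0]
      _ ≤ _ := Real.exp_le_exp.2 h1
  rw [← Finset.sum_fiberwise_of_maps_to (t := Finset.range (2 * M + 1)) (g := J)
    fun d hd => Finset.mem_range.2 (Nat.lt_succ_of_le (hJle d hd))]
  refine (Finset.sum_le_card_nsmul _ _ (180 * C ^ 2 * Real.exp (lam + 7 * b - M * h)) ?_).trans
    (le_of_eq (by rw [Finset.card_range, nsmul_eq_mul]; push_cast; ring))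
  intro j hj
  calc _ ≤ ∑ d ∈ E.erase c with J d = j,
        μ.real (cylinder d) * (10 * C * Real.exp (4 * b - j * h)) := by
        refine Finset.sum_le_sum fun d hd => ?_
        obtain ⟨hdE, hdj⟩ := Finset.mem_filter.1 hd
        rw [← hdj]
        exact mul_le_mul_of_nonneg_left (S.sum_heads_le G (hJle d hdE)
          (by linarith [hgap d hdE]) (hJ1 d hdE)) measureReal_nonneg
    _ = (∑ d ∈ E.erase c with J d = j, μ.real (cylinder d)) *
          (10 * C * Real.exp (4 * b - j * h)) := by rw [Finset.sum_mul]
    _ ≤ (18 * C * Real.exp (lam + 3 * b - (M - j) * h)) *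
          (10 * C * Real.exp (4 * b - j * h)) := by
        gcongr
        refine le_trans ?_ (S.sum_tails_le G hc j)
        rw [← Finset.sum_filter]
        refine Finset.sum_le_sum_of_subset_of_nonneg ?_ fun _ _ _ => measureReal_nonneg
        intro d hd
        obtain ⟨hdE, hdj⟩ := Finset.mem_filter.1 hd
        rw [← hdj]
        exact Finset.mem_filter.2 ⟨(Finset.mem_erase.1 hdE).2, hJ2 d hdE⟩
    _ = 180 * C ^ 2 * (Real.exp (lam + 3 * b - (M - j) * h) * Real.exp (4 * b - j * h)) := by ring
    _ = _ := by rw [← Real.exp_add]; ring_nf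

end TypicalWords

theorem le_abs_div_sq_sub_div_sq {D D' R ξ : ℝ} (hD : 0 < D) (hD' : 0 < D') (hDR : D ≤ R)
    (hDR' : D' ≤ R) (hξ : 0 ≤ ξ) : 2 * ξ * |D - D'| / R ^ 3 ≤ |ξ / D ^ 2 - ξ / D' ^ 2| := by
  have h1 : ξ / D ^ 2 - ξ / D' ^ 2 = -(ξ * (D - D') * ((1 / D + 1 / D') * (1 / (D * D')))) := by
    field_simp; ring
  have hR : 0 < R := by linarith
  rw [h1, abs_neg, abs_mul, abs_mul, abs_of_nonneg hξ,
    abs_of_pos (by positivity : 0 < (1 / D + 1 / D') * (1 / (D * D')))]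
  calc 2 * ξ * |D - D'| / R ^ 3 = ξ * |D - D'| * ((1 / R + 1 / R) * (1 / (R * R))) := by
        field_simp; ring
    _ ≤ _ := by gcongr

theorem exp_neg_sq_le_of_lt_abs_sub {D D' M lam h b ξ : ℝ} (hb : 0 ≤ b) (hD : 0 < D) (hD' : 0 < D')
    (hDR : D ≤ 2 * Real.exp ((M * lam + b) / 2)) (hDR' : D' ≤ 2 * Real.exp ((M * lam + b) / 2))
    (hξ : Real.exp (4 * lam * M) ≤ ξ) (hh : M * h ≤ Real.exp (2 * b))
    (hgap : Real.exp (-(M * lam / 2) + 2 * b) ≤ |D - D'|) :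
    Real.exp (-π * (4 * Real.exp (-(2 * M * lam) + b)) ^ 2 * (ξ / D ^ 2 - ξ / D' ^ 2) ^ 2) ≤
      Real.exp (-(M * h)) := by
  have hξ0 : 0 < ξ := lt_of_lt_of_le (Real.exp_pos _) hξ
  have h1 := le_abs_div_sq_sub_div_sq hD hD' hDR hDR' hξ0.le
  have h2 : Real.exp b ≤ 4 * Real.exp (-(2 * M * lam) + b) * |ξ / D ^ 2 - ξ / D' ^ 2| := by
    calc Real.exp b ≤ Real.exp (3 / 2 * b) := Real.exp_le_exp.2 (by linarith)
      _ = 4 * Real.exp (-(2 * M * lam) + b) * (2 * Real.exp (4 * lam * M) *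
          Real.exp (-(M * lam / 2) + 2 * b) / (2 * Real.exp ((M * lam + b) / 2)) ^ 3) := by
        rw [mul_pow, ← Real.exp_nat_mul]
        have : Real.exp (3 / 2 * b) * Real.exp ((3 : ℕ) * ((M * lam + b) / 2)) =
            Real.exp (-(2 * M * lam) + b) * Real.exp (4 * lam * M) *
              Real.exp (-(M * lam / 2) + 2 * b) := by
          rw [← Real.exp_add, ← Real.exp_add, ← Real.exp_add]
          congr 1; push_cast; ring
        have h0 := (Real.exp_pos ((3 : ℕ) * ((M * lam + b) / 2))).ne'
        rw [show 4 * Real.exp (-(2 * M * lam) + b) * (2 * Real.exp (4 * lam * M) *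
          Real.exp (-(M * lam / 2) + 2 * b) /
            (2 ^ 3 * Real.exp ((3 : ℕ) * ((M * lam + b) / 2)))) =
          Real.exp (-(2 * M * lam) + b) * Real.exp (4 * lam * M) *
            Real.exp (-(M * lam / 2) + 2 * b) / Real.exp ((3 : ℕ) * ((M * lam + b) / 2)) by ring,
          ← this, mul_div_cancel_right₀ _ h0]
      _ ≤ 4 * Real.exp (-(2 * M * lam) + b) * (2 * ξ * |D - D'| /
          (2 * Real.exp ((M * lam + b) / 2)) ^ 3) := by gcongr
      _ ≤ _ := by gcongr
  have h3 : Real.exp (2 * b) ≤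
      (4 * Real.exp (-(2 * M * lam) + b)) ^ 2 * (ξ / D ^ 2 - ξ / D' ^ 2) ^ 2 := by
    rw [← sq_abs (ξ / D ^ 2 - ξ / D' ^ 2), ← mul_pow]
    calc Real.exp (2 * b) = Real.exp b ^ 2 := by rw [← Real.exp_nat_mul]; norm_num
      _ ≤ _ := by gcongr
  refine Real.exp_le_exp.2 ?_
  have h4 := mul_le_mul_of_nonneg_left h3 Real.pi_pos.le
  have h5 : Real.exp (2 * b) ≤ π * Real.exp (2 * b) := by
    have := Real.exp_pos (2 * b)
    nlinarith [Real.pi_gt_three]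
  linarith

namespace TypicalWords

variable {φ : ℝ → ℝ} {μ : Measure ℝ} {B θ C lam h b : ℝ} {M : ℕ} {A E : Finset (List ℕ)}
  {x y : List ℕ → ℝ}

theorem tail_cfDen_le (S : TypicalWords φ lam h b M A E x y) {c : List ℕ} (hc : c ∈ E) {z : ℝ}
    (hz : z ≤ 1) : (cfQ c : ℝ) + cfQ' c * z ≤ 2 * Real.exp ((M * lam + b) / 2) :=
  (cfDen_le (S.tail_pos hc) hz).trans (by have := S.tail_cfQ_le hc; linarith)

/-- The energy of the frequencies attached to the tails, averaged over the heads. -/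
theorem sum_energy_le (S : TypicalWords φ lam h b M A E x y) (G : GibbsSystem φ μ B θ C)
    {ξ σ : ℝ} (hσ : σ ^ 2 = 1) (hξ : Real.exp (4 * lam * M) ≤ ξ) (hh : M * h ≤ Real.exp (2 * b)) :
    ∑ a ∈ A, μ.real (cylinder a) * ∑ c ∈ E, ∑ d ∈ E,
      (C * μ.real (cylinder c)) * (C * μ.real (cylinder d)) *
        Real.exp (-π * (4 * Real.exp (-(2 * M * lam) + b)) ^ 2 *
          (σ * (ξ / (cfQ c + cfQ' c * x a) ^ 2) - σ * (ξ / (cfQ d + cfQ' d * x a) ^ 2)) ^ 2) ≤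
      182 * C ^ 4 * (2 * M + 1) * Real.exp (lam + 7 * b - M * h) := by
  have hC := G.C_pos
  have hC1 := G.one_le_C
  have hb := S.b_nonneg
  have hlam := S.lam_pos
  set I : List ℕ → List ℕ → List ℕ → ℝ := fun c d a =>
    if |((cfQ c : ℝ) - cfQ d) + ((cfQ' c : ℝ) - cfQ' d) * x a| ≤
        Real.exp (-(M * lam / 2) + 2 * b) then 1 else 0 with hI
  have hI1 : ∀ c d a, I c d a ≤ 1 := fun c d a => by simp only [hI]; split_ifs <;> norm_num
  have key : ∀ a ∈ A, ∀ c ∈ E, ∀ d ∈ E, Real.exp (-π * (4 * Real.exp (-(2 * M * lam) + b)) ^ 2 *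
      (σ * (ξ / (cfQ c + cfQ' c * x a) ^ 2) - σ * (ξ / (cfQ d + cfQ' d * x a) ^ 2)) ^ 2) ≤
      I c d a + Real.exp (-(M * h)) := by
    intro a ha c hc d hd
    have hx0 := (gaussSet_pos (S.head_mem a ha).1).le
    have hx1 := (gaussSet_lt_one (S.head_mem a ha).1).le
    rw [← mul_sub, mul_pow σ, hσ, one_mul]
    simp only [hI]
    split_ifs with hle
    · refine (Real.exp_le_one_iff.2 ?_).trans (by linarith [Real.exp_pos (-(M * h))])
      rw [neg_mul, neg_mul]
      exact neg_nonpos.2 (by positivity)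
    · rw [zero_add]
      refine exp_neg_sq_le_of_lt_abs_sub hb (cfDen_pos (S.tail_pos hc) hx0)
        (cfDen_pos (S.tail_pos hd) hx0) (S.tail_cfDen_le hc hx1) (S.tail_cfDen_le hd hx1) hξ hh ?_
      have : (cfQ c : ℝ) + cfQ' c * x a - (cfQ d + cfQ' d * x a) =
          ((cfQ c : ℝ) - cfQ d) + ((cfQ' c : ℝ) - cfQ' d) * x a := by ring
      rw [this]
      exact (not_le.1 hle).le
  have hA1 : ∑ a ∈ A, μ.real (cylinder a) ≤ 1 := G.sum_measure_cylinder_le_one S.head_length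
  have hE1 : ∑ c ∈ E, μ.real (cylinder c) ≤ 1 := G.sum_measure_cylinder_le_one S.tail_length
  have hA0 : 0 ≤ ∑ a ∈ A, μ.real (cylinder a) := Finset.sum_nonneg fun _ _ => measureReal_nonneg
  have hE0 : 0 ≤ ∑ c ∈ E, μ.real (cylinder c) := Finset.sum_nonneg fun _ _ => measureReal_nonneg
  set U : ℝ := ∑ c ∈ E, μ.real (cylinder c) * ∑ d ∈ E, μ.real (cylinder d) *
    ∑ a ∈ A, μ.real (cylinder a) * I c d a
  have hU : U ≤ C * Real.exp (-(M * h) + b) +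
      (2 * M + 1) * (180 * C ^ 2 * Real.exp (lam + 7 * b - M * h)) := by
    calc U ≤ ∑ c ∈ E, μ.real (cylinder c) * (C * Real.exp (-(M * h) + b) +
          (2 * M + 1) * (180 * C ^ 2 * Real.exp (lam + 7 * b - M * h))) := by
          refine Finset.sum_le_sum fun c hc => ?_
          refine mul_le_mul_of_nonneg_left ?_ measureReal_nonneg
          rw [← Finset.add_sum_erase _ _ hc]
          refine add_le_add ?_ (le_trans (le_of_eq ?_) (S.sum_offDiag_le G hc))
          · calc _ ≤ μ.real (cylinder c) * ∑ a ∈ A, μ.real (cylinder a) * 1 := by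
                  gcongr with a _
                  exact hI1 _ _ _
              _ ≤ μ.real (cylinder c) * 1 := by
                  gcongr
                  simpa using hA1
              _ ≤ _ := by rw [mul_one]; exact S.measure_tail_le G hc
          · refine Finset.sum_congr rfl fun d _ => ?_
            congr 1
            refine Finset.sum_congr rfl fun a _ => ?_
            simp only [hI]
            split_ifs <;> simp
      _ ≤ 1 * _ := by
          rw [← Finset.sum_mul]
          gcongr
      _ = _ := one_mul _
  calc _ ≤ ∑ a ∈ A, μ.real (cylinder a) * ∑ c ∈ E, ∑ d ∈ E,
        (C * μ.real (cylinder c)) * (C * μ.real (cylinder d)) *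
          (I c d a + Real.exp (-(M * h))) := by
        refine Finset.sum_le_sum fun a ha => mul_le_mul_of_nonneg_left
          (Finset.sum_le_sum fun c hc => Finset.sum_le_sum fun d hd => ?_) measureReal_nonneg
        have := key a ha c hc d hd
        gcongr
    _ = C ^ 2 * U + C ^ 2 * Real.exp (-(M * h)) * ((∑ a ∈ A, μ.real (cylinder a)) *
          ((∑ c ∈ E, μ.real (cylinder c)) * ∑ d ∈ E, μ.real (cylinder d))) := by
        simp only [U, mul_add, Finset.sum_add_distrib, Finset.mul_sum, Finset.sum_mul]
        congr 1
        · rw [Finset.sum_comm]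
          refine Finset.sum_congr rfl fun c _ => ?_
          rw [Finset.sum_comm]
          refine Finset.sum_congr rfl fun d _ => Finset.sum_congr rfl fun a _ => ?_
          ring
        · rw [Finset.sum_comm]
          refine Finset.sum_congr rfl fun c _ => ?_
          rw [Finset.sum_comm]
          refine Finset.sum_congr rfl fun d _ => Finset.sum_congr rfl fun a _ => ?_
          ring
    _ ≤ C ^ 2 * (C * Real.exp (-(M * h) + b) +
          (2 * M + 1) * (180 * C ^ 2 * Real.exp (lam + 7 * b - M * h))) +
        C ^ 2 * Real.exp (-(M * h)) * (1 * (1 * 1)) := by gcongr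
    _ ≤ C ^ 2 * (C ^ 2 * ((2 * M + 1) * Real.exp (lam + 7 * b - M * h)) +
          (2 * M + 1) * (180 * C ^ 2 * Real.exp (lam + 7 * b - M * h))) +
        C ^ 2 * (C ^ 2 * ((2 * M + 1) * Real.exp (lam + 7 * b - M * h))) := by
        have e1 : Real.exp (-(M * h) + b) ≤ Real.exp (lam + 7 * b - M * h) :=
          Real.exp_le_exp.2 (by linarith)
        have e2 : Real.exp (-(M * h)) ≤ Real.exp (lam + 7 * b - M * h) :=
          Real.exp_le_exp.2 (by linarith)
        have e3 : Real.exp (lam + 7 * b - M * h) ≤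
            (2 * M + 1) * Real.exp (lam + 7 * b - M * h) :=
          le_mul_of_one_le_left (Real.exp_pos _).le (by
            have : (0 : ℝ) ≤ M := Nat.cast_nonneg M
            linarith)
        have e4 : C ≤ C ^ 2 := by nlinarith
        have e5 : (1 : ℝ) ≤ C ^ 2 := by nlinarith
        have f1 : C * Real.exp (-(M * h) + b) ≤
            C ^ 2 * ((2 * M + 1) * Real.exp (lam + 7 * b - M * h)) := by
          have := e1.trans e3
          gcongr
        have f2 : C ^ 2 * Real.exp (-(M * h)) * (1 * (1 * 1)) ≤
            C ^ 2 * (C ^ 2 * ((2 * M + 1) * Real.exp (lam + 7 * b - M * h))) := by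
          have e6 := e2.trans e3
          rw [mul_one, mul_one, mul_one]
          refine mul_le_mul_of_nonneg_left ?_ (by positivity)
          nlinarith [Real.exp_pos (-(M * h))]
        gcongr
    _ = _ := by ring

end TypicalWords

/-! ### Linearization of the Fourier transform -/

theorem abs_invBranch_sub_sub_le {l : List ℕ} (hl : PosWord l) {x y : ℝ} (hx : 0 ≤ x)
    (hy : 0 ≤ y) :
    |invBranch l y - invBranch l x - (-1) ^ l.length * (y - x) / (cfQ l + cfQ' l * x) ^ 2| ≤
      |y - x| ^ 2 / (cfQ l : ℝ) ^ 2 := by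
  have h1 := cfDen_pos hl hx
  have h2 := cfDen_pos hl hy
  have h0 : (0 : ℝ) < cfQ l := by exact_mod_cast cfQ_pos hl
  have h3 : (cfQ' l : ℝ) ≤ cfQ l := by exact_mod_cast cfQ'_le_cfQ hl
  have h4 : (cfQ l : ℝ) ≤ cfQ l + cfQ' l * x := cfQ_le_cfDen hx
  have h5 : (cfQ l : ℝ) ≤ cfQ l + cfQ' l * y := cfQ_le_cfDen hy
  have h6 : (1 : ℝ) ≤ cfQ l := by exact_mod_cast cfQ_pos hl
  rw [invBranch_sub hl hy hx]
  have : (-1 : ℝ) ^ l.length * (y - x) / ((cfQ l + cfQ' l * y) * (cfQ l + cfQ' l * x)) -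
      (-1) ^ l.length * (y - x) / (cfQ l + cfQ' l * x) ^ 2 =
      (-1) ^ l.length * (-((y - x) ^ 2 * (cfQ' l / ((cfQ l + cfQ' l * y) *
        (cfQ l + cfQ' l * x) ^ 2)))) := by
    field_simp; ring
  rw [this, abs_mul, abs_pow, abs_neg, abs_one, one_pow, one_mul, abs_neg, abs_mul, abs_pow,
    abs_of_nonneg (by positivity : (0 : ℝ) ≤ cfQ' l / ((cfQ l + cfQ' l * y) *
        (cfQ l + cfQ' l * x) ^ 2)), div_eq_mul_one_div (|y - x| ^ 2)]
  refine mul_le_mul_of_nonneg_left ?_ (by positivity)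
  calc (cfQ' l : ℝ) / ((cfQ l + cfQ' l * y) * (cfQ l + cfQ' l * x) ^ 2)
      ≤ cfQ l / (cfQ l * (cfQ l) ^ 2) := by gcongr
    _ = _ := by field_simp

theorem norm_exp_ofReal_mul_I_sub_le (u v : ℝ) :
    ‖Complex.exp (u * Complex.I) - Complex.exp (v * Complex.I)‖ ≤ |u - v| := by
  have h1 : Complex.exp (u * Complex.I) - Complex.exp (v * Complex.I) =
      Complex.exp (v * Complex.I) * (Complex.exp (Complex.I * ((u - v : ℝ) : ℂ)) - 1) := by
    rw [mul_sub, ← Complex.exp_add, mul_one]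
    congr 2
    push_cast; ring
  rw [h1, norm_mul, Complex.norm_exp_ofReal_mul_I, one_mul, ← Real.norm_eq_abs]
  exact Real.norm_exp_I_mul_ofReal_sub_one_le

theorem abs_exp_sub_one_le_mul_exp {s u v : ℝ} (h1 : |s| ≤ u) (h2 : u ≤ v) :
    |Real.exp s - 1| ≤ u * Real.exp v := by
  obtain ⟨h3, h4⟩ := abs_le.1 h1
  have h0 : 0 ≤ u := (abs_nonneg s).trans h1
  have h5 : 1 ≤ Real.exp v := Real.one_le_exp (h0.trans h2)
  have h6 : Real.exp u * (1 - u) ≤ 1 := by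
    have := Real.add_one_le_exp (-u)
    calc Real.exp u * (1 - u) ≤ Real.exp u * Real.exp (-u) := by gcongr; linarith
      _ = 1 := by rw [← Real.exp_add]; simp
  have h7 : Real.exp u ≤ Real.exp v := Real.exp_le_exp.2 h2
  have h8 : Real.exp s ≤ Real.exp u := Real.exp_le_exp.2 h4
  have h9 := Real.add_one_le_exp s
  refine abs_le.2 ⟨by nlinarith, by nlinarith⟩

/-- Points whose orbit segments starting at the origin are typical. -/
def headSet (φ : ℝ → ℝ) (lam h b : ℝ) (M : ℕ) : Set ℝ :=
  {x | (∀ k ≤ 3 * M, x ∈ typicalSet φ lam h b k) ∧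
    gaussMap^[2 * M] x ∈ typicalSet φ lam h b M}

/-- Points whose orbit segments ending at time `M` are typical. -/
def tailSet (φ : ℝ → ℝ) (lam h b : ℝ) (M : ℕ) : Set ℝ :=
  {x | ∀ k ≤ M, gaussMap^[M - k] x ∈ typicalSet φ lam h b k}

theorem headSet_subset (φ : ℝ → ℝ) (lam h b : ℝ) (M : ℕ) : headSet φ lam h b M ⊆ gaussSet :=
  fun _ hx => (hx.1 0 (Nat.zero_le _)).1

theorem measurableSet_headSet {φ : ℝ → ℝ} (hφ : Measurable φ) (lam h b : ℝ) (M : ℕ) :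
    MeasurableSet (headSet φ lam h b M) := by
  have h1 : headSet φ lam h b M = (⋂ k ∈ Finset.range (3 * M + 1), typicalSet φ lam h b k) ∩
      gaussMap^[2 * M] ⁻¹' typicalSet φ lam h b M := by
    ext x; simp [headSet]
  rw [h1]
  exact (Finset.measurableSet_biInter _ fun k _ => measurableSet_typicalSet hφ _ _ _ _).inter
    (measurable_gaussMap.iterate _ (measurableSet_typicalSet hφ _ _ _ _))

namespace GibbsSystem

variable {φ : ℝ → ℝ} {μ : Measure ℝ} {B θ C : ℝ}

theorem abs_gw_sub_le (G : GibbsSystem φ μ B θ C) {c d : List ℕ} (hc : PosWord c) {x y : ℝ}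
    (hx : x ∈ cylinder d) (hy : y ∈ cylinder d) :
    |gw φ c y - gw φ c x| ≤ C * μ.real (cylinder c) * (B * Real.exp B * θ ^ d.length) := by
  have hB := G.B_nonneg
  have hθ := G.theta_pos.le
  have hle : ∀ u ∈ cylinder d, ∀ v ∈ cylinder d, wsum φ c u - wsum φ c v ≤ B * θ ^ d.length := by
    intro u hu v hv
    refine (G.distortion c d hc u hu v hv).trans ?_
    have : 0 ≤ θ ^ c.length := by positivity
    have h2 : 0 ≤ B * θ ^ d.length := by positivity
    nlinarith
  have h1 : |wsum φ c y - wsum φ c x| ≤ B * θ ^ d.length :=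
    abs_le.2 ⟨by linarith [hle x hx y hy], hle y hy x hx⟩
  have h2 : B * θ ^ d.length ≤ B := mul_le_of_le_one_right hB (pow_le_one₀ hθ G.theta_lt.le)
  have h3 := abs_exp_sub_one_le_mul_exp h1 h2
  have h4 : gw φ c y - gw φ c x = gw φ c x * (Real.exp (wsum φ c y - wsum φ c x) - 1) := by
    rw [gw, gw, mul_sub, ← Real.exp_add]; ring_nf
  rw [h4, abs_mul, abs_of_pos (gw_pos φ c x)]
  have h5 := G.le_gibbs c hc x hx.1
  have h6 := (gw_pos φ c x).le
  have h7 := h6.trans h5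
  calc _ ≤ C * μ.real (cylinder c) * (B * θ ^ d.length * Real.exp B) := by gcongr
    _ = _ := by ring

theorem measure_headSet_inter_Icc_le (G : GibbsSystem φ μ B θ C) {lam h b w : ℝ} {M : ℕ}
    {a : List ℕ} (ha : a.length = 2 * M) (hw : 0 ≤ w) (hw1 : 2 * w * Real.exp (3 * M * lam + b) ≤ 1)
    (z : ℝ) :
    μ.real (headSet φ lam h b M ∩ cylinder a ∩ Icc (z - w) z) ≤
      3 * (C ^ 4 * μ.real (cylinder a) * Real.exp (-(M * h) + b)) := by
  have := G.prob
  have hC := G.C_pos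
  set W : Set (List ℕ) := {e | e.length = M ∧
    ∃ x ∈ headSet φ lam h b M, x ∈ cylinder (a ++ e) ∧ x ∈ Icc (z - w) z} with hW
  refine measureReal_le_of_card_le (W := W) (g := fun e => cylinder (a ++ e)) (by positivity)
    ?_ ?_ ?_
  · intro F hF
    have hinj : Function.Injective fun e : List ℕ => a ++ e := List.append_right_injective a
    rw [← Finset.card_image_of_injective F hinj]
    refine (card_words_near_le (k := 3 * M) (u := z - w / 2) (r := w / 2)
      (Q := Real.exp (3 * M * lam + b)) (by positivity) (Real.exp_pos _) fun d hd => ?_).trans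
      (by linarith)
    obtain ⟨e, he, rfl⟩ := Finset.mem_image.1 hd
    obtain ⟨hl, x, hx, hxc, hxI⟩ := hF he
    have hlen : (a ++ e).length = 3 * M := by rw [List.length_append, ha, hl]; ring
    refine ⟨hlen, posWord_of_mem_cylinder hxc, ?_, gaussMap^[(a ++ e).length] x, ?_, ?_⟩
    · have := cfQ_sq_le_of_typical hlen hxc (hx.1 _ le_rfl)
      push_cast at this
      exact this
    · have hm := gaussMap_iterate_mem hxc.1 (a ++ e).length
      exact ⟨(gaussSet_pos hm).le, (gaussSet_lt_one hm).le⟩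
    · rw [invBranch_gaussMap_iterate hxc]
      exact abs_le.2 ⟨by linarith [hxI.1], by linarith [hxI.2]⟩
  · rintro e ⟨hl, x, hx, hxc, -⟩
    obtain ⟨h1, h2⟩ := mem_cylinder_append.1 hxc
    rw [ha] at h2
    have h3 := G.measure_cylinder_le_of_typical hl h2 hx.2
    refine (G.measure_cylinder_append_le (posWord_of_mem_cylinder h1)
      (posWord_of_mem_cylinder h2)).trans ?_
    calc C ^ 3 * (μ.real (cylinder a) * μ.real (cylinder e)) ≤
          C ^ 3 * (μ.real (cylinder a) * (C * Real.exp (-(M * h) + b))) := by gcongr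
      _ = _ := by ring
  · rintro x ⟨⟨hx, hxa⟩, hxI⟩
    refine Set.mem_biUnion (x := cfWord M (gaussMap^[a.length] x)) ⟨cfWord_length _ _, x, hx, ?_,
      hxI⟩ ?_ <;>
    exact mem_cylinder_append.2 ⟨hxa, mem_cylinder_cfWord (gaussMap_iterate_mem hxa.1 _) _⟩

end GibbsSystem

/-- The sum over tails `c` of the weights at `y` times the characters at the points `T_c y`. -/
noncomputable def tailSum (φ : ℝ → ℝ) (E : Finset (List ℕ)) (ξ y : ℝ) : ℂ :=
  ∑ c ∈ E, (gw φ c y : ℂ) * Complex.exp (-(2 * π * ξ * invBranch c y : ℝ) * Complex.I)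

theorem measurable_tailSum {φ : ℝ → ℝ} (hφ : Measurable φ) (E : Finset (List ℕ)) (ξ : ℝ) :
    Measurable (tailSum φ E ξ) := by
  refine Finset.measurable_fun_sum _ fun c _ => ?_
  have h1 := measurable_gw hφ c
  have h2 := measurable_invBranch c
  fun_prop

/-- The frequency of the linearization at `x` of the phase attached to the tail `c`. -/
noncomputable def tailFreq (ξ : ℝ) (M : ℕ) (c : List ℕ) (x : ℝ) : ℝ :=
  -(-1) ^ M * (ξ / (cfQ c + cfQ' c * x) ^ 2)

/-- The coefficient of the linearization at `x` of the summand attached to the tail `c`. -/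
noncomputable def tailCoeff (φ : ℝ → ℝ) (ξ : ℝ) (M : ℕ) (c : List ℕ) (x : ℝ) : ℂ :=
  (gw φ c x : ℂ) * Complex.exp
    ((-(2 * π * ξ * invBranch c x) - 2 * π * tailFreq ξ M c x * x : ℝ) * Complex.I)

theorem norm_tailCoeff (φ : ℝ → ℝ) (ξ : ℝ) (M : ℕ) (c : List ℕ) (x : ℝ) :
    ‖tailCoeff φ ξ M c x‖ = gw φ c x := by
  rw [tailCoeff, norm_mul, Complex.norm_exp_ofReal_mul_I, mul_one, Complex.norm_real,
    Real.norm_eq_abs, abs_of_pos (gw_pos φ c x)]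

theorem norm_integral_le_of_normSq {α : Type*} [MeasurableSpace α] {ρ : Measure α}
    [IsFiniteMeasure ρ] {f : α → ℂ} (hf : Integrable (fun y => ‖f y‖ ^ 2) ρ) {s : ℝ} (hs : 0 < s) :
    ‖∫ y, f y ∂ρ‖ ≤ s / 2 * ρ.real univ + 1 / (2 * s) * ∫ y, ‖f y‖ ^ 2 ∂ρ := by
  have h1 : Integrable (fun y => s / 2 + 1 / (2 * s) * ‖f y‖ ^ 2) ρ :=
    (integrable_const _).add (hf.const_mul _)
  have h2 := norm_integral_le_of_norm_le h1 (f := f) (Eventually.of_forall fun y => by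
    have : s / 2 + 1 / (2 * s) * ‖f y‖ ^ 2 - ‖f y‖ = (s - ‖f y‖) ^ 2 / (2 * s) := by
      field_simp; ring
    have h3 : 0 ≤ (s - ‖f y‖) ^ 2 / (2 * s) := by positivity
    linarith)
  rw [integral_add (integrable_const _) (hf.const_mul _), integral_const, integral_const_mul,
    smul_eq_mul] at h2
  linarith

namespace GibbsSystem

variable {φ : ℝ → ℝ} {μ : Measure ℝ} {B θ C : ℝ}

theorem norm_tailSum_le (G : GibbsSystem φ μ B θ C) {E : Finset (List ℕ)} {M : ℕ}
    (hE : ∀ c ∈ E, c.length = M) (hpos : ∀ c ∈ E, PosWord c) (ξ : ℝ) {y : ℝ} (hy : y ∈ gaussSet) :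
    ‖tailSum φ E ξ y‖ ≤ C := by
  have hC := G.C_pos
  calc ‖tailSum φ E ξ y‖ ≤ ∑ c ∈ E, C * μ.real (cylinder c) := by
        refine norm_sum_le_of_le _ fun c hc => ?_
        rw [norm_mul, ← Complex.ofReal_neg, Complex.norm_exp_ofReal_mul_I, mul_one,
          Complex.norm_real, Real.norm_eq_abs, abs_of_pos (gw_pos φ c y)]
        exact G.le_gibbs c (hpos c hc) y hy
    _ = C * ∑ c ∈ E, μ.real (cylinder c) := by rw [Finset.mul_sum]
    _ ≤ C * 1 := by gcongr; exact G.sum_measure_cylinder_le_one hE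
    _ = C := mul_one C

/-- Linearization of one summand of `tailSum` on a cylinder. -/
theorem norm_summand_sub_le (G : GibbsSystem φ μ B θ C) {c a : List ℕ} (hc : PosWord c) {x y ξ : ℝ}
    (hξ : 0 ≤ ξ) (hx : x ∈ cylinder a) (hy : y ∈ cylinder a) :
    ‖(gw φ c y : ℂ) * Complex.exp (-(2 * π * ξ * invBranch c y : ℝ) * Complex.I) -
      tailCoeff φ ξ c.length c x *
        Complex.exp ((2 * π * tailFreq ξ c.length c x * y : ℝ) * Complex.I)‖ ≤
      C * μ.real (cylinder c) * (B * Real.exp B * θ ^ a.length +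
        2 * π * ξ * (|y - x| ^ 2 / (cfQ c : ℝ) ^ 2)) := by
  have h1 := G.abs_gw_sub_le hc hx hy
  have h2 := abs_invBranch_sub_sub_le hc (gaussSet_pos hx.1).le (gaussSet_pos hy.1).le
  have h3 := G.le_gibbs c hc x hx.1
  have h4 := (gw_pos φ c x).le
  set u : ℝ := -(2 * π * ξ * invBranch c y) with hu
  set v : ℝ := -(2 * π * ξ * invBranch c x) + 2 * π * tailFreq ξ c.length c x * (y - x) with hv
  have h5 : tailCoeff φ ξ c.length c x *
      Complex.exp ((2 * π * tailFreq ξ c.length c x * y : ℝ) * Complex.I) =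
      (gw φ c x : ℂ) * Complex.exp (v * Complex.I) := by
    rw [tailCoeff, mul_assoc, ← Complex.exp_add, ← add_mul, ← Complex.ofReal_add, hv]
    congr 4; ring
  have h6 : |u - v| ≤ 2 * π * ξ * (|y - x| ^ 2 / (cfQ c : ℝ) ^ 2) := by
    have : u - v = -(2 * π * ξ * (invBranch c y - invBranch c x -
        (-1) ^ c.length * (y - x) / (cfQ c + cfQ' c * x) ^ 2)) := by
      rw [hu, hv, tailFreq]; ring
    rw [this, abs_neg, abs_mul, abs_of_nonneg (by positivity : 0 ≤ 2 * π * ξ)]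
    gcongr
  rw [h5, ← Complex.ofReal_neg, ← hu]
  have h7 : (gw φ c y : ℂ) * Complex.exp (u * Complex.I) -
      (gw φ c x : ℂ) * Complex.exp (v * Complex.I) =
      ((gw φ c y - gw φ c x : ℝ) : ℂ) * Complex.exp (u * Complex.I) +
      (gw φ c x : ℂ) * (Complex.exp (u * Complex.I) - Complex.exp (v * Complex.I)) := by
    push_cast; ring
  rw [h7]
  refine (norm_add_le _ _).trans ?_
  rw [norm_mul, norm_mul, Complex.norm_exp_ofReal_mul_I, mul_one, Complex.norm_real,
    Complex.norm_real, Real.norm_eq_abs, Real.norm_eq_abs, abs_of_nonneg h4, mul_add]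
  have h8 := (norm_exp_ofReal_mul_I_sub_le u v).trans h6
  exact add_le_add h1 (mul_le_mul h3 h8 (norm_nonneg _) (h4.trans h3))

end GibbsSystem

namespace TypicalWords

variable {φ : ℝ → ℝ} {μ : Measure ℝ} {B θ C lam h b : ℝ} {M : ℕ} {A E : Finset (List ℕ)}
  {x y : List ℕ → ℝ}

theorem abs_sub_head_le (S : TypicalWords φ lam h b M A E x y) {a : List ℕ} (ha : a ∈ A) {z : ℝ}
    (hz : z ∈ cylinder a) : |z - x a| ≤ 4 * Real.exp (-(2 * M * lam) + b) := by
  have h1 := le_cfQ_sq_of_typical (S.head_length a ha) (S.head_mem a ha)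
    (S.head_typical a ha _ le_rfl)
  have hq : (0 : ℝ) < cfQ a := by exact_mod_cast cfQ_pos (posWord_of_mem_cylinder hz)
  refine (abs_sub_le_of_mem_cylinder hz (S.head_mem a ha)).trans ?_
  rw [div_le_iff₀ (by positivity)]
  push_cast at h1
  calc (1 : ℝ) = Real.exp (-(2 * M * lam) + b) * Real.exp (2 * M * lam - b) := by
        rw [← Real.exp_add]; simp
    _ ≤ Real.exp (-(2 * M * lam) + b) * (4 * (cfQ a : ℝ) ^ 2) := by gcongr
    _ = _ := by ring

theorem one_div_tail_cfQ_sq_le (S : TypicalWords φ lam h b M A E x y) {c : List ℕ} (hc : c ∈ E) :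
    1 / (cfQ c : ℝ) ^ 2 ≤ 4 * Real.exp (-(M * lam) + b) := by
  have ht := S.tail_typical c hc M le_rfl
  rw [Nat.sub_self] at ht
  have h1 := le_cfQ_sq_of_typical (S.tail_length c hc) (S.tail_mem c hc) ht
  have hq : (0 : ℝ) < cfQ c := by exact_mod_cast cfQ_pos (S.tail_pos hc)
  rw [div_le_iff₀ (by positivity)]
  calc (1 : ℝ) = Real.exp (-(M * lam) + b) * Real.exp (M * lam - b) := by
        rw [← Real.exp_add]; simp
    _ ≤ Real.exp (-(M * lam) + b) * (4 * (cfQ c : ℝ) ^ 2) := by gcongr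
    _ = _ := by ring

theorem norm_tailSum_sub_le (S : TypicalWords φ lam h b M A E x y) (G : GibbsSystem φ μ B θ C)
    {a : List ℕ} (ha : a ∈ A) {ξ z : ℝ} (hξ0 : 0 ≤ ξ) (hξ : ξ ≤ Real.exp (4 * lam * (M + 1)))
    (hz : z ∈ cylinder a) :
    ‖tailSum φ E ξ z - ∑ c ∈ E, tailCoeff φ ξ M c (x a) *
        Complex.exp ((2 * π * tailFreq ξ M c (x a) * z : ℝ) * Complex.I)‖ ≤
      C * (B * Real.exp B * θ ^ (2 * M) +
        128 * π * Real.exp (4 * lam) * Real.exp (-(M * lam) + 3 * b)) := by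
  have hC := G.C_pos
  have hB := G.B_nonneg
  have hθ := G.theta_pos.le
  rw [tailSum, ← Finset.sum_sub_distrib]
  have herr : ∀ c ∈ E, 2 * π * ξ * (|z - x a| ^ 2 / (cfQ c : ℝ) ^ 2) ≤
      128 * π * Real.exp (4 * lam) * Real.exp (-(M * lam) + 3 * b) := by
    intro c hc
    have h1 := S.abs_sub_head_le ha hz
    have h2 := S.one_div_tail_cfQ_sq_le hc
    rw [div_eq_mul_one_div]
    calc _ ≤ 2 * π * Real.exp (4 * lam * (M + 1)) * ((4 * Real.exp (-(2 * M * lam) + b)) ^ 2 *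
          (4 * Real.exp (-(M * lam) + b))) := by gcongr
      _ = 128 * π * (Real.exp (4 * lam * (M + 1)) * (Real.exp (-(2 * M * lam) + b)) ^ 2 *
          Real.exp (-(M * lam) + b)) := by ring
      _ = 128 * π * (Real.exp (4 * lam) * Real.exp (-(M * lam) + 3 * b)) := by
        rw [← Real.exp_nat_mul, ← Real.exp_add, ← Real.exp_add, ← Real.exp_add]
        congr 2; push_cast; ring
      _ = _ := by ring
  calc _ ≤ ∑ c ∈ E, C * μ.real (cylinder c) * (B * Real.exp B * θ ^ (2 * M) +
        128 * π * Real.exp (4 * lam) * Real.exp (-(M * lam) + 3 * b)) := by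
        refine norm_sum_le_of_le _ fun c hc => ?_
        have h1 := G.norm_summand_sub_le (S.tail_pos hc) hξ0 (S.head_mem a ha) hz
        rw [S.tail_length c hc, S.head_length a ha] at h1
        refine h1.trans (mul_le_mul_of_nonneg_left ?_ (by positivity))
        linarith [herr c hc]
    _ = C * (B * Real.exp B * θ ^ (2 * M) +
        128 * π * Real.exp (4 * lam) * Real.exp (-(M * lam) + 3 * b)) *
          ∑ c ∈ E, μ.real (cylinder c) := by
        rw [Finset.mul_sum]
        exact Finset.sum_congr rfl fun c _ => by ring
    _ ≤ _ := mul_le_of_le_one_right (by positivity) (G.sum_measure_cylinder_le_one S.tail_length)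

/-- The large sieve bound for the linearized sum over the tails, on one head. -/
theorem setIntegral_normSq_le (S : TypicalWords φ lam h b M A E x y) (G : GibbsSystem φ μ B θ C)
    {a : List ℕ} (ha : a ∈ A) {ξ : ℝ} (hξ1 : Real.exp (4 * lam * M) ≤ ξ)
    (hξ2 : ξ ≤ Real.exp (4 * lam * (M + 1))) :
    ∫ z in headSet φ lam h b M ∩ cylinder a, ‖∑ c ∈ E, tailCoeff φ ξ M c (x a) *
        Complex.exp ((2 * π * tailFreq ξ M c (x a) * z : ℝ) * Complex.I)‖ ^ 2 ∂μ ≤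
      Real.exp (4 * π) * (2 + 4 * π ^ 2) * (48 * C ^ 4 * Real.exp (4 * lam)) *
        Real.exp (M * lam - M * h + 3 * b) *
        (μ.real (cylinder a) * ∑ c ∈ E, ∑ d ∈ E, (C * μ.real (cylinder c)) *
          (C * μ.real (cylinder d)) * Real.exp (-π * (4 * Real.exp (-(2 * M * lam) + b)) ^ 2 *
            (tailFreq ξ M c (x a) - tailFreq ξ M d (x a)) ^ 2)) := by
  have := G.prob
  have hC := G.C_pos
  have hlam := S.lam_pos
  have hb := S.b_nonneg
  have hξ0 : 0 < ξ := lt_of_lt_of_le (Real.exp_pos _) hξ1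
  have hM : (0 : ℝ) ≤ M := Nat.cast_nonneg M
  set T : ℝ := 4 * ξ * Real.exp (-(M * lam) + b) with hT
  have hT0 : 0 < T := by positivity
  have hTinv : 2 * (1 / T) * Real.exp (3 * M * lam + b) ≤ 1 := by
    rw [mul_one_div, div_mul_eq_mul_div, div_le_one hT0]
    calc 2 * Real.exp (3 * M * lam + b) = 2 * (Real.exp (4 * lam * M) *
          Real.exp (-(M * lam) + b)) := by rw [← Real.exp_add]; ring_nf
      _ ≤ 4 * (ξ * Real.exp (-(M * lam) + b)) := by gcongr; norm_num
      _ = T := by rw [hT]; ring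
  have hTℓ : 1 / T ≤ 4 * Real.exp (-(2 * M * lam) + b) := by
    rw [div_le_iff₀ hT0, hT]
    calc (1 : ℝ) ≤ 16 * 1 := by norm_num
      _ ≤ 16 * Real.exp (M * lam + 2 * b) := by gcongr; exact Real.one_le_exp (by positivity)
      _ = 16 * (Real.exp (-(2 * M * lam) + b) * Real.exp (4 * lam * M) *
          Real.exp (-(M * lam) + b)) := by rw [← Real.exp_add, ← Real.exp_add]; ring_nf
      _ ≤ 16 * (Real.exp (-(2 * M * lam) + b) * ξ * Real.exp (-(M * lam) + b)) := by gcongr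
      _ = _ := by ring
  have hfreq : ∀ c ∈ E, |tailFreq ξ M c (x a)| ≤ T := by
    intro c hc
    have h1 := S.one_div_tail_cfQ_sq_le hc
    have hq : (0 : ℝ) < cfQ c := by exact_mod_cast cfQ_pos (S.tail_pos hc)
    have h2 : (cfQ c : ℝ) ≤ cfQ c + cfQ' c * x a := cfQ_le_cfDen (gaussSet_pos (S.head_mem a ha).1).le
    rw [tailFreq, abs_mul, abs_neg, abs_pow, abs_neg, abs_one, one_pow, one_mul,
      abs_of_nonneg (by positivity), div_eq_mul_one_div]
    calc _ ≤ ξ * (1 / (cfQ c : ℝ) ^ 2) := by gcongr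
      _ ≤ ξ * (4 * Real.exp (-(M * lam) + b)) := by gcongr
      _ = T := by rw [hT]; ring
  have hmeas : MeasurableSet (headSet φ lam h b M ∩ cylinder a) :=
    (measurableSet_headSet G.meas _ _ _ _).inter (measurableSet_cylinder a)
  have key := integral_normSq_expSum_le E (α := fun c => tailCoeff φ ξ M c (x a))
    (β := fun c => C * μ.real (cylinder c)) (t := fun c => tailFreq ξ M c (x a))
    (ρ := μ.restrict (headSet φ lam h b M ∩ cylinder a)) (x₀ := x a) hT0 hTℓ
    (κ := 3 * (C ^ 4 * μ.real (cylinder a) * Real.exp (-(M * h) + b))) (by positivity)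
    (fun c hc => by
      rw [norm_tailCoeff]; exact G.le_gibbs c (S.tail_pos hc) _ (S.head_mem a ha).1) hfreq
    ((ae_restrict_iff' hmeas).2 (Eventually.of_forall fun z hz => S.abs_sub_head_le ha hz.2))
    (fun z => by
      rw [measureReal_restrict_apply measurableSet_Icc, Set.inter_comm]
      exact G.measure_headSet_inter_Icc_le (S.head_length a ha) (by positivity) hTinv z)
  refine key.trans ?_
  have hTl : T * (4 * Real.exp (-(2 * M * lam) + b)) ≤
      16 * Real.exp (4 * lam) * Real.exp (M * lam + 2 * b) := by
    calc _ = 16 * (ξ * (Real.exp (-(M * lam) + b) * Real.exp (-(2 * M * lam) + b))) := by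
          rw [hT]; ring
      _ ≤ 16 * (Real.exp (4 * lam * (M + 1)) * (Real.exp (-(M * lam) + b) *
          Real.exp (-(2 * M * lam) + b))) := by gcongr
      _ = 16 * (Real.exp (4 * lam) * Real.exp (M * lam + 2 * b)) := by
        rw [← Real.exp_add, ← Real.exp_add, ← Real.exp_add]
        congr 2; ring
      _ = _ := by ring
  have hsum : 0 ≤ ∑ c ∈ E, ∑ d ∈ E, (C * μ.real (cylinder c)) * (C * μ.real (cylinder d)) *
      Real.exp (-π * (4 * Real.exp (-(2 * M * lam) + b)) ^ 2 *
        (tailFreq ξ M c (x a) - tailFreq ξ M d (x a)) ^ 2) :=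
    Finset.sum_nonneg fun _ _ => Finset.sum_nonneg fun _ _ => by positivity
  have hexp : Real.exp (M * lam - M * h + 3 * b) =
      Real.exp (-(M * h) + b) * Real.exp (M * lam + 2 * b) := by
    rw [← Real.exp_add]; ring_nf
  calc _ ≤ Real.exp (4 * π) * (2 + 4 * π ^ 2) *
        (3 * (C ^ 4 * μ.real (cylinder a) * Real.exp (-(M * h) + b)) *
          (16 * Real.exp (4 * lam) * Real.exp (M * lam + 2 * b))) * _ := by gcongr
    _ = _ := by rw [hexp]; ring

/-- The contribution of the heads to the Fourier transform. -/
theorem sum_norm_setIntegral_le (S : TypicalWords φ lam h b M A E x y) (G : GibbsSystem φ μ B θ C)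
    {ξ : ℝ} (hξ1 : Real.exp (4 * lam * M) ≤ ξ) (hξ2 : ξ ≤ Real.exp (4 * lam * (M + 1)))
    (hh : M * h ≤ Real.exp (2 * b)) :
    ∑ a ∈ A, ‖∫ z in headSet φ lam h b M ∩ cylinder a, tailSum φ E ξ z ∂μ‖ ≤
      C * (B * Real.exp B * θ ^ (2 * M) +
        128 * π * Real.exp (4 * lam) * Real.exp (-(M * lam) + 3 * b)) +
      (1 + Real.exp (4 * π) * (2 + 4 * π ^ 2) * (4368 * C ^ 8 * Real.exp (5 * lam))) *
        (2 * M + 1) * Real.exp (M * (lam - 2 * h) / 2 + 5 * b) := by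
  have := G.prob
  have hC := G.C_pos
  have hB := G.B_nonneg
  have hθ := G.theta_pos.le
  have hξ0 : 0 < ξ := lt_of_lt_of_le (Real.exp_pos _) hξ1
  set Err : ℝ := C * (B * Real.exp B * θ ^ (2 * M) +
    128 * π * Real.exp (4 * lam) * Real.exp (-(M * lam) + 3 * b)) with hErr
  have hErr0 : 0 ≤ Err := by positivity
  set K : ℝ := Real.exp (4 * π) * (2 + 4 * π ^ 2) * (48 * C ^ 4 * Real.exp (4 * lam)) *
        Real.exp (M * lam - M * h + 3 * b) with hK
  set En : List ℕ → ℝ := fun a => ∑ c ∈ E, ∑ d ∈ E, (C * μ.real (cylinder c)) *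
    (C * μ.real (cylinder d)) * Real.exp (-π * (4 * Real.exp (-(2 * M * lam) + b)) ^ 2 *
      (tailFreq ξ M c (x a) - tailFreq ξ M d (x a)) ^ 2) with hEn
  set s : ℝ := Real.exp (M * (lam - 2 * h) / 2 + 5 * b) with hs
  have hs0 : 0 < s := Real.exp_pos _
  have hEnergy : ∑ a ∈ A, μ.real (cylinder a) * En a ≤
      182 * C ^ 4 * (2 * M + 1) * Real.exp (lam + 7 * b - M * h) :=
    S.sum_energy_le G (σ := -(-1) ^ M) (by rw [neg_sq, ← pow_mul, mul_comm, pow_mul]; simp) hξ1 hh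
  have hA1 : ∑ a ∈ A, μ.real (cylinder a) ≤ 1 := G.sum_measure_cylinder_le_one S.head_length
  have key : ∀ a ∈ A, ‖∫ z in headSet φ lam h b M ∩ cylinder a, tailSum φ E ξ z ∂μ‖ ≤
      (Err + s / 2) * μ.real (cylinder a) + 1 / (2 * s) * K * (μ.real (cylinder a) * En a) := by
    intro a ha
    have hmeas : MeasurableSet (headSet φ lam h b M ∩ cylinder a) :=
      (measurableSet_headSet G.meas _ _ _ _).inter (measurableSet_cylinder a)
    have hmono : μ.real (headSet φ lam h b M ∩ cylinder a) ≤ μ.real (cylinder a) :=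
      measureReal_mono Set.inter_subset_right
    set F : ℝ → ℂ := fun z => ∑ c ∈ E, tailCoeff φ ξ M c (x a) *
        Complex.exp ((2 * π * tailFreq ξ M c (x a) * z : ℝ) * Complex.I) with hF
    have hFc : Continuous F := by fun_prop
    have hFb : ∀ z, ‖F z‖ ≤ ∑ c ∈ E, gw φ c (x a) := fun z =>
      norm_sum_le_of_le _ fun c _ => by
        rw [norm_mul, Complex.norm_exp_ofReal_mul_I, mul_one, norm_tailCoeff]
    have hFi : IntegrableOn F (headSet φ lam h b M ∩ cylinder a) μ :=
      Integrable.of_bound hFc.aestronglyMeasurable _ (Eventually.of_forall hFb)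
    have hF2 : IntegrableOn (fun z => ‖F z‖ ^ 2) (headSet φ lam h b M ∩ cylinder a) μ :=
      Integrable.of_bound (C := (∑ c ∈ E, gw φ c (x a)) ^ 2)
        (by fun_prop) (Eventually.of_forall fun z => by
          rw [Real.norm_eq_abs, abs_of_nonneg (by positivity)]
          have := hFb z
          gcongr)
    have hTi : IntegrableOn (tailSum φ E ξ) (headSet φ lam h b M ∩ cylinder a) μ :=
      Integrable.of_bound (measurable_tailSum G.meas E ξ).aestronglyMeasurable C
        ((ae_restrict_iff' hmeas).2 (Eventually.of_forall fun z hz =>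
          G.norm_tailSum_le S.tail_length (fun c hc => S.tail_pos hc) ξ hz.2.1))
    have hsplit : ∫ z in headSet φ lam h b M ∩ cylinder a, tailSum φ E ξ z ∂μ =
        (∫ z in headSet φ lam h b M ∩ cylinder a, (tailSum φ E ξ z - F z) ∂μ) +
          ∫ z in headSet φ lam h b M ∩ cylinder a, F z ∂μ := by
      rw [integral_sub hTi hFi]; ring
    have h1 : ‖∫ z in headSet φ lam h b M ∩ cylinder a, (tailSum φ E ξ z - F z) ∂μ‖ ≤
        Err * μ.real (cylinder a) := by
      refine (norm_setIntegral_le_of_norm_le_const (C := Err) (measure_lt_top _ _)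
        fun z hz => S.norm_tailSum_sub_le G ha hξ0.le hξ2 hz.2).trans ?_
      gcongr
    have h2 := norm_integral_le_of_normSq hF2 hs0
    have h3 := S.setIntegral_normSq_le G ha hξ1 hξ2
    rw [measureReal_restrict_apply_univ] at h2
    rw [hsplit]
    calc _ ≤ Err * μ.real (cylinder a) + (s / 2 * μ.real (headSet φ lam h b M ∩ cylinder a) +
          1 / (2 * s) * ∫ z in headSet φ lam h b M ∩ cylinder a, ‖F z‖ ^ 2 ∂μ) :=
          (norm_add_le _ _).trans (add_le_add h1 h2)
      _ ≤ Err * μ.real (cylinder a) + (s / 2 * μ.real (cylinder a) +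
          1 / (2 * s) * (K * (μ.real (cylinder a) * En a))) := by gcongr
      _ = _ := by ring
  have hKs : 1 / (2 * s) * K * (182 * C ^ 4 * (2 * M + 1) * Real.exp (lam + 7 * b - M * h)) =
      Real.exp (4 * π) * (2 + 4 * π ^ 2) * (4368 * C ^ 8 * Real.exp (5 * lam)) * (2 * M + 1) *
        s := by
    have h1 : Real.exp (4 * lam) * Real.exp (M * lam - M * h + 3 * b) *
        Real.exp (lam + 7 * b - M * h) = Real.exp (5 * lam) * (s * s) := by
      rw [hs, ← Real.exp_add, ← Real.exp_add, ← Real.exp_add, ← Real.exp_add]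
      congr 1; ring
    calc _ = 1 / (2 * s) * (Real.exp (4 * π) * (2 + 4 * π ^ 2) * (8736 * C ^ 8) * (2 * M + 1)) *
          (Real.exp (4 * lam) * Real.exp (M * lam - M * h + 3 * b) *
            Real.exp (lam + 7 * b - M * h)) := by rw [hK]; ring
      _ = _ := by rw [h1]; field_simp; ring
  calc _ ≤ ∑ a ∈ A, ((Err + s / 2) * μ.real (cylinder a) +
        1 / (2 * s) * K * (μ.real (cylinder a) * En a)) := Finset.sum_le_sum key
    _ = (Err + s / 2) * ∑ a ∈ A, μ.real (cylinder a) +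
        1 / (2 * s) * K * ∑ a ∈ A, μ.real (cylinder a) * En a := by
        rw [Finset.sum_add_distrib, Finset.mul_sum, Finset.mul_sum]
    _ ≤ (Err + s / 2) * 1 + 1 / (2 * s) * K *
        (182 * C ^ 4 * (2 * M + 1) * Real.exp (lam + 7 * b - M * h)) := by
        have : 0 ≤ K := by positivity
        gcongr
    _ ≤ _ := by
        rw [hKs]
        have hM : (0 : ℝ) ≤ M := Nat.cast_nonneg M
        nlinarith

end TypicalWords

/-! ### Fourier decay -/

theorem finite_typical_words (φ : ℝ → ℝ) (lam h b : ℝ) (k : ℕ) :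
    {c : List ℕ | c.length = k ∧ ∃ x ∈ typicalSet φ lam h b k, x ∈ cylinder c}.Finite := by
  by_contra hinf
  obtain ⟨F, hF, hc⟩ := Set.Infinite.exists_subset_card_eq hinf
    (⌊4 * 1 * Real.exp (k * lam + b) + 2⌋₊ + 1)
  have h1 := card_words_near_le (k := k) (u := 0) (r := 1) (Q := Real.exp (k * lam + b)) (F := F)
    zero_le_one (Real.exp_pos _) fun d hd => by
      obtain ⟨hl, x, hx, hxd⟩ := hF hd
      have hm := gaussMap_iterate_mem hxd.1 d.length
      refine ⟨hl, posWord_of_mem_cylinder hxd, cfQ_sq_le_of_typical hl hxd hx,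
        gaussMap^[d.length] x, ⟨(gaussSet_pos hm).le, (gaussSet_lt_one hm).le⟩, ?_⟩
      rw [invBranch_gaussMap_iterate hxd, sub_zero, abs_of_pos (gaussSet_pos hxd.1)]
      exact (gaussSet_lt_one hxd.1).le
  rw [hc] at h1
  have h2 := Nat.lt_floor_add_one (4 * 1 * Real.exp (k * lam + b) + 2)
  push_cast at h1
  linarith

namespace GibbsSystem

variable {φ : ℝ → ℝ} {μ : Measure ℝ} {B θ C : ℝ}

theorem norm_integral_exp_le (G : GibbsSystem φ μ B θ C) {lam h b : ℝ} {M : ℕ} (hlam : 0 < lam)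
    (hh0 : 0 < h) (hb : 0 ≤ b) (hbM : b ≤ lam * M) {ξ : ℝ} (hξ1 : Real.exp (4 * lam * M) ≤ ξ)
    (hξ2 : ξ ≤ Real.exp (4 * lam * (M + 1))) (hh : M * h ≤ Real.exp (2 * b)) :
    ‖∫ x, Complex.exp (-(2 * π * ξ * x : ℝ) * Complex.I) ∂μ‖ ≤
      μ.real (tailSet φ lam h b M)ᶜ + C * μ.real (headSet φ lam h b M)ᶜ +
      (C * (B * Real.exp B * θ ^ (2 * M) +
        128 * π * Real.exp (4 * lam) * Real.exp (-(M * lam) + 3 * b)) +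
      (1 + Real.exp (4 * π) * (2 + 4 * π ^ 2) * (4368 * C ^ 8 * Real.exp (5 * lam))) *
        (2 * M + 1) * Real.exp (M * (lam - 2 * h) / 2 + 5 * b)) := by
  have := G.prob
  have hC := G.C_pos
  set f : ℝ → ℂ := fun x => Complex.exp (-(2 * π * ξ * x : ℝ) * Complex.I) with hf
  have hfm : Measurable f := by fun_prop
  have hf1 : ∀ x, ‖f x‖ = 1 := fun x => by
    simp only [hf]
    rw [← Complex.ofReal_neg, Complex.norm_exp_ofReal_mul_I]
  have hfi : Integrable f μ :=
    Integrable.of_bound hfm.aestronglyMeasurable 1 (Eventually.of_forall fun x => (hf1 x).le)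
  have hAfin : {a : List ℕ | a.length = 2 * M ∧
      ∃ x ∈ headSet φ lam h b M, x ∈ cylinder a}.Finite :=
    (finite_typical_words φ lam h b (2 * M)).subset fun a ⟨hl, x, hx, hxa⟩ =>
      ⟨hl, x, hx.1 _ (by omega), hxa⟩
  have hEfin : {c : List ℕ | c.length = M ∧ ∃ x ∈ tailSet φ lam h b M, x ∈ cylinder c}.Finite :=
    (finite_typical_words φ lam h b M).subset fun a ⟨hl, x, hx, hxa⟩ =>
      ⟨hl, x, by simpa using hx M le_rfl, hxa⟩
  set A := hAfin.toFinset with hA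
  set E := hEfin.toFinset with hE
  have hAm : ∀ a ∈ A, a.length = 2 * M ∧ ∃ x ∈ headSet φ lam h b M, x ∈ cylinder a :=
    fun a ha => hAfin.mem_toFinset.1 ha
  have hEm : ∀ c ∈ E, c.length = M ∧ ∃ x ∈ tailSet φ lam h b M, x ∈ cylinder c :=
    fun c hc => hEfin.mem_toFinset.1 hc
  choose! x hx hxa using fun a ha => (hAm a ha).2
  choose! y hy hyc using fun c hc => (hEm c hc).2
  have S : TypicalWords φ lam h b M A E x y :=
    { lam_pos := hlam, h_pos := hh0, b_nonneg := hb, b_le := hbM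
      head_length := fun a ha => (hAm a ha).1
      head_mem := hxa
      head_typical := fun a ha j hj => (hx a ha).1 j (by omega)
      tail_length := fun c hc => (hEm c hc).1
      tail_mem := hyc
      tail_typical := fun c hc => hy c hc }
  have hmeasY := measurableSet_headSet G.meas lam h b M
  have hTm := measurable_tailSum G.meas E ξ
  have hTb : ∀ᵐ z ∂μ, ‖tailSum φ E ξ z‖ ≤ C := by
    filter_upwards [G.ae_mem] with z hz
    exact G.norm_tailSum_le S.tail_length (fun c hc => S.tail_pos hc) ξ hz
  have hTi : Integrable (tailSum φ E ξ) μ := Integrable.of_bound hTm.aestronglyMeasurable C hTb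
  have hU : MeasurableSet (⋃ c ∈ E, cylinder c) :=
    Finset.measurableSet_biUnion _ fun c _ => measurableSet_cylinder c
  have h1 : ‖∫ x in (⋃ c ∈ E, cylinder c)ᶜ, f x ∂μ‖ ≤ μ.real (tailSet φ lam h b M)ᶜ := by
    refine (norm_setIntegral_le_of_norm_le_const (C := 1) (measure_lt_top _ _)
      fun x _ => (hf1 x).le).trans ?_
    rw [one_mul]
    refine ENNReal.toReal_mono (measure_ne_top _ _) (measure_mono_ae ?_)
    filter_upwards [G.ae_mem] with z hz hzU hzT
    exact hzU (Set.mem_biUnion (x := cfWord M z) (hEfin.mem_toFinset.2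
      ⟨cfWord_length _ _, z, hzT, mem_cylinder_cfWord hz M⟩) (mem_cylinder_cfWord hz M))
  have h2 : ∫ x in (⋃ c ∈ E, cylinder c), f x ∂μ = ∫ z, tailSum φ E ξ z ∂μ := by
    rw [integral_biUnion_finset E (fun c _ => measurableSet_cylinder c)
      (fun c hc d hd hcd => cylinder_disjoint
        ((S.tail_length c hc).trans (S.tail_length d hd).symm) hcd)
      (fun c _ => hfi.integrableOn)]
    simp only [tailSum]
    rw [integral_finsetSum]
    · exact Finset.sum_congr rfl fun c hc => G.setIntegral_cylinder_eq (S.tail_pos hc) hfm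
    · intro c hc
      have hm1 := measurable_gw G.meas c
      have hm2 := measurable_invBranch c
      refine Integrable.of_bound (by fun_prop) (C * μ.real (cylinder c)) ?_
      filter_upwards [G.ae_mem] with z hz
      rw [norm_mul, ← Complex.ofReal_neg, Complex.norm_exp_ofReal_mul_I, mul_one,
        Complex.norm_real, Real.norm_eq_abs, abs_of_pos (gw_pos φ c z)]
      exact G.le_gibbs c (S.tail_pos hc) z hz
  have h3 : ‖∫ z in (headSet φ lam h b M)ᶜ, tailSum φ E ξ z ∂μ‖ ≤
      C * μ.real (headSet φ lam h b M)ᶜ :=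
    norm_setIntegral_le_of_norm_le_const_ae (measure_lt_top _ _)
      (ae_restrict_of_ae hTb)
  have h4 : ∫ z in headSet φ lam h b M, tailSum φ E ξ z ∂μ =
      ∑ a ∈ A, ∫ z in headSet φ lam h b M ∩ cylinder a, tailSum φ E ξ z ∂μ := by
    rw [← integral_biUnion_finset A (fun a _ => hmeasY.inter (measurableSet_cylinder a))
      (fun a ha d hd had => (cylinder_disjoint
        ((S.head_length a ha).trans (S.head_length d hd).symm) had).mono
          Set.inter_subset_right Set.inter_subset_right)
      (fun c _ => hTi.integrableOn)]
    congr 2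
    ext z
    simp only [Set.mem_iUnion, Set.mem_inter_iff, exists_prop]
    refine ⟨fun hz => ?_, fun ⟨a, _, hz, _⟩ => hz⟩
    have hzc := mem_cylinder_cfWord (headSet_subset _ _ _ _ _ hz) (2 * M)
    exact ⟨cfWord (2 * M) z, hAfin.mem_toFinset.2 ⟨cfWord_length _ _, z, hz, hzc⟩, hz, hzc⟩
  rw [← integral_add_compl hU hfi, h2, ← integral_add_compl hmeasY hTi, h4]
  have h5 := (norm_sum_le A _).trans (S.sum_norm_setIntegral_le G hξ1 hξ2 hh)
  refine (norm_add_le _ _).trans ?_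
  have h6 := norm_add_le
    (∑ a ∈ A, ∫ z in headSet φ lam h b M ∩ cylinder a, tailSum φ E ξ z ∂μ)
    (∫ z in (headSet φ lam h b M)ᶜ, tailSum φ E ξ z ∂μ)
  linarith

theorem exists_measureReal_typicalSet_compl_le (G : GibbsSystem φ μ B θ C)
    {ω ω' : ℕ → ℝ} {τ τ' Q Q' : ℝ} (hL : TameObservable φ logAbsDerivGauss ω τ Q)
    (hN : TameObservable φ (fun x => -φ x) ω' τ' Q') {ε : ℝ} (hε : 0 < ε) :
    ∃ c > 0, ∃ K : ℝ, 0 ≤ K ∧ ∀ M k : ℕ, k ≤ 3 * M →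
      μ.real (typicalSet φ (∫ x, logAbsDerivGauss x ∂μ) (∫ x, -φ x ∂μ) (ε * M) k)ᶜ ≤
        K * Real.exp (-(c * M)) := by
  have := G.prob
  obtain ⟨t, ht, K, hK, hbd⟩ := G.exists_deviation_bound hL (show 0 < ε / 6 by positivity)
  obtain ⟨t', ht', K', hK', hbd'⟩ := G.exists_deviation_bound hN (show 0 < ε / 6 by positivity)
  have key : ∀ (s c : ℝ) (M k : ℕ), 0 < s → c ≤ s → k ≤ 3 * M →
      Real.exp (-(s * (ε * M)) + s * k * (ε / 6)) ≤ Real.exp (-(c * ε / 2 * M)) := by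
    intro s c M k hs hc hk
    have hk' : (k : ℝ) ≤ 3 * M := by exact_mod_cast hk
    rw [Real.exp_le_exp]
    have h1 : s * k * (ε / 6) ≤ s * (3 * M) * (ε / 6) := by gcongr
    have h2 : c * ε / 2 * M ≤ s * ε / 2 * M := by gcongr
    linarith
  refine ⟨min t t' * ε / 2, by have := lt_min ht ht'; positivity, K + K', by positivity,
    fun M k hk => ?_⟩
  set lam := ∫ x, logAbsDerivGauss x ∂μ
  set h := ∫ x, -φ x ∂μ
  have hsub : ((typicalSet φ lam h (ε * M) k)ᶜ : Set ℝ) ≤ᵐ[μ]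
      ({x | ε * M ≤ |birkhoff logAbsDerivGauss k x - k * lam|} ∪
        {x | ε * M ≤ |birkhoff (fun x => -φ x) k x - k * h|} : Set ℝ) := by
    filter_upwards [G.ae_mem] with x hx hxt
    by_contra hcon
    refine hxt ⟨hx, ?_⟩
    have hcon : ¬(ε * M ≤ |birkhoff logAbsDerivGauss k x - k * lam| ∨
        ε * M ≤ |birkhoff (fun x => -φ x) k x - k * h|) := hcon
    rw [not_or, not_le, not_le] at hcon
    have h2 : birkhoff (fun x => -φ x) k x - k * h = -(birkhoff φ k x + k * h) := by
      simp only [birkhoff, Finset.sum_neg_distrib]; ring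
    refine ⟨hcon.1.le, ?_⟩
    have h3 := hcon.2.le
    rwa [h2, abs_neg] at h3
  calc μ.real (typicalSet φ lam h (ε * M) k)ᶜ
      ≤ μ.real ({x | ε * M ≤ |birkhoff logAbsDerivGauss k x - k * lam|} ∪
        {x | ε * M ≤ |birkhoff (fun x => -φ x) k x - k * h|}) :=
        ENNReal.toReal_mono (measure_ne_top _ _) (measure_mono_ae hsub)
    _ ≤ _ := measureReal_union_le _ _
    _ ≤ K * Real.exp (-(t * (ε * M)) + t * k * (ε / 6)) +
        K' * Real.exp (-(t' * (ε * M)) + t' * k * (ε / 6)) := add_le_add (hbd _ _) (hbd' _ _)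
    _ ≤ K * Real.exp (-(min t t' * ε / 2 * M)) + K' * Real.exp (-(min t t' * ε / 2 * M)) := by
        exact add_le_add
          (mul_le_mul_of_nonneg_left (key _ _ _ _ ht (min_le_left _ _) hk) hK)
          (mul_le_mul_of_nonneg_left (key _ _ _ _ ht' (min_le_right _ _) hk) hK')
    _ = _ := by ring

theorem measureReal_preimage_iterate (G : GibbsSystem φ μ B θ C) (n : ℕ) {s : Set ℝ}
    (hs : MeasurableSet s) : μ.real (gaussMap^[n] ⁻¹' s) = μ.real s := by
  rw [measureReal_def, measureReal_def, (G.mp.iterate n).measure_preimage hs.nullMeasurableSet]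

theorem measureReal_headSet_compl_le (G : GibbsSystem φ μ B θ C) {lam h b D : ℝ} {M : ℕ}
    (hD : ∀ k ≤ 3 * M, μ.real (typicalSet φ lam h b k)ᶜ ≤ D) :
    μ.real (headSet φ lam h b M)ᶜ ≤ (3 * M + 2) * D := by
  have := G.prob
  have hsub : (headSet φ lam h b M)ᶜ ⊆
      (⋃ k ∈ Finset.range (3 * M + 1), (typicalSet φ lam h b k)ᶜ) ∪
        gaussMap^[2 * M] ⁻¹' (typicalSet φ lam h b M)ᶜ := by
    intro x hx
    by_contra hcon
    refine hx ⟨fun k hk => ?_, ?_⟩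
    · by_contra hk'
      exact hcon (Or.inl (mem_biUnion (Finset.mem_range.2 (by omega : k < 3 * M + 1)) hk'))
    · by_contra hk'
      exact hcon (Or.inr hk')
  calc _ ≤ _ := measureReal_mono hsub (measure_ne_top _ _)
    _ ≤ _ := measureReal_union_le _ _
    _ ≤ (∑ k ∈ Finset.range (3 * M + 1), D) + D := by
        refine add_le_add ((measureReal_biUnion_finset_le _ _).trans
          (Finset.sum_le_sum fun k hk => hD k ?_)) ?_
        · have := Finset.mem_range.1 hk
          omega
        · rw [G.measureReal_preimage_iterate _ (measurableSet_typicalSet G.meas _ _ _ _).compl]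
          exact hD M (by omega)
    _ = _ := by simp; ring

theorem measureReal_tailSet_compl_le (G : GibbsSystem φ μ B θ C) {lam h b D : ℝ} {M : ℕ}
    (hD : ∀ k ≤ 3 * M, μ.real (typicalSet φ lam h b k)ᶜ ≤ D) :
    μ.real (tailSet φ lam h b M)ᶜ ≤ (M + 1) * D := by
  have := G.prob
  have hsub : (tailSet φ lam h b M)ᶜ ⊆
      ⋃ k ∈ Finset.range (M + 1), gaussMap^[M - k] ⁻¹' (typicalSet φ lam h b k)ᶜ := by
    intro x hx
    by_contra hcon
    refine hx fun k hk => ?_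
    by_contra hk'
    exact hcon (mem_biUnion (Finset.mem_range.2 (by omega : k < M + 1)) hk')
  calc _ ≤ _ := measureReal_mono hsub (measure_ne_top _ _)
    _ ≤ ∑ k ∈ Finset.range (M + 1), D := by
        refine (measureReal_biUnion_finset_le _ _).trans
          (Finset.sum_le_sum fun k hk => ?_)
        rw [G.measureReal_preimage_iterate _ (measurableSet_typicalSet G.meas _ _ _ _).compl]
        have := Finset.mem_range.1 hk
        exact hD k (by omega)
    _ = _ := by simp

/-- Exponential decay of the Fourier transform along the scales `exp (4 * lam * M)`. -/
theorem exists_norm_integral_exp_le (G : GibbsSystem φ μ B θ C) {lam h : ℝ} (hlam : 0 < lam)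
    (hdim : lam < 2 * h)
    (hS : ∀ ε > 0, ∃ c > 0, ∃ K : ℝ, 0 ≤ K ∧ ∀ M k : ℕ, k ≤ 3 * M →
      μ.real (typicalSet φ lam h (ε * M) k)ᶜ ≤ K * Real.exp (-(c * M))) :
    ∃ c > 0, ∃ K : ℝ, 0 ≤ K ∧ ∃ M₀ : ℕ, ∀ M ≥ M₀, ∀ ξ : ℝ, Real.exp (4 * lam * M) ≤ ξ →
      ξ ≤ Real.exp (4 * lam * (M + 1)) →
      ‖∫ x, Complex.exp (-(2 * π * ξ * x : ℝ) * Complex.I) ∂μ‖ ≤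
        K * (M + 1) * Real.exp (-(c * M)) := by
  have := G.prob
  have hC := G.C_pos
  have hB := G.B_nonneg
  have hθ := G.theta_pos
  have hθ1 := G.theta_lt
  have hh0 : 0 < h := by linarith
  set ε := min (lam / 6) ((2 * h - lam) / 20) with hεdef
  have hε : 0 < ε := lt_min (by positivity) (by linarith)
  have hε1 : ε ≤ lam / 6 := min_le_left _ _
  have hε2 : ε ≤ (2 * h - lam) / 20 := min_le_right _ _
  obtain ⟨c₀, hc₀, K₀, hK₀, hS⟩ := hS ε hε
  set d := -Real.log θ with hd
  have hdpos : 0 < d := neg_pos.2 (Real.log_neg hθ hθ1)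
  set c := min (min c₀ (2 * d)) (min (lam / 2) ((2 * h - lam) / 4)) with hcdef
  have hc : 0 < c := lt_min (lt_min hc₀ (by positivity)) (lt_min (by positivity) (by linarith))
  have hc1 : c ≤ c₀ := (min_le_left _ _).trans (min_le_left _ _)
  have hc2 : c ≤ 2 * d := (min_le_left _ _).trans (min_le_right _ _)
  have hc3 : c ≤ lam / 2 := (min_le_right _ _).trans (min_le_left _ _)
  have hc4 : c ≤ (2 * h - lam) / 4 := (min_le_right _ _).trans (min_le_right _ _)
  set A₁ := B * Real.exp B with hA₁
  set A₂ := 128 * π * Real.exp (4 * lam) with hA₂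
  set A₃ := (1 + Real.exp (4 * π) * (2 + 4 * π ^ 2) * (4368 * C ^ 8 * Real.exp (5 * lam))) with hA₃
  have hA₁0 : 0 ≤ A₁ := by positivity
  have hA₂0 : 0 ≤ A₂ := by positivity
  have hA₃0 : 0 ≤ A₃ := by positivity
  obtain ⟨M₀, hM₀⟩ := exists_nat_ge (h / (2 * ε ^ 2))
  refine ⟨c, hc, K₀ + C * (3 * K₀) + C * (A₁ + A₂) + 2 * A₃, by positivity, M₀,
    fun M hM ξ h1 h2 => ?_⟩
  have hM0 : (0 : ℝ) ≤ M := Nat.cast_nonneg M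
  have hhM : M * h ≤ Real.exp (2 * (ε * M)) := by
    have e1 : h / (2 * ε ^ 2) ≤ M := hM₀.trans (by exact_mod_cast hM)
    rw [div_le_iff₀ (by positivity)] at e1
    have e2 := Real.quadratic_le_exp_of_nonneg (show 0 ≤ 2 * (ε * M) by positivity)
    have e3 : M * h ≤ M * (M * (2 * ε ^ 2)) := by gcongr
    nlinarith
  have hmain := G.norm_integral_exp_le hlam hh0 (b := ε * M) (by positivity)
    (by gcongr; linarith) h1 h2 hhM
  rw [← hA₁, ← hA₂, ← hA₃] at hmain
  set E := Real.exp (-(c * M)) with hE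
  have hE0 : 0 < E := Real.exp_pos _
  have hD : ∀ k ≤ 3 * M, μ.real (typicalSet φ lam h (ε * M) k)ᶜ ≤ K₀ * E := fun k hk =>
    (hS M k hk).trans (by rw [hE]; gcongr)
  have t1 := G.measureReal_tailSet_compl_le hD
  have t2 : μ.real (headSet φ lam h (ε * M) M)ᶜ ≤ 3 * (M + 1) * (K₀ * E) :=
    (G.measureReal_headSet_compl_le hD).trans (by gcongr; linarith)
  have t3 : θ ^ (2 * M) ≤ E := by
    rw [hE, ← Real.exp_log hθ, ← Real.exp_nat_mul, Real.exp_le_exp]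
    push_cast
    have := mul_nonneg hM0 (show 0 ≤ 2 * d - c by linarith)
    linarith
  have t4 : Real.exp (-(M * lam) + 3 * (ε * M)) ≤ E := by
    rw [hE, Real.exp_le_exp]
    have := mul_nonneg hM0 (show 0 ≤ lam - 3 * ε - c by linarith)
    linarith
  have t5 : Real.exp (M * (lam - 2 * h) / 2 + 5 * (ε * M)) ≤ E := by
    rw [hE, Real.exp_le_exp]
    have := mul_nonneg hM0 (show 0 ≤ (2 * h - lam) / 2 - 5 * ε - c by linarith)
    linarith
  have hM1 : E ≤ (M + 1) * E := le_mul_of_one_le_left hE0.le (by linarith)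
  clear_value A₁ A₂ A₃ E
  have s1 : C * μ.real (headSet φ lam h (ε * M) M)ᶜ ≤ C * (3 * (M + 1) * (K₀ * E)) :=
    mul_le_mul_of_nonneg_left t2 hC.le
  have s2 : C * (A₁ * θ ^ (2 * M) + A₂ * Real.exp (-(M * lam) + 3 * (ε * M))) ≤
      C * (A₁ * ((M + 1) * E) + A₂ * ((M + 1) * E)) :=
    mul_le_mul_of_nonneg_left (add_le_add (mul_le_mul_of_nonneg_left (t3.trans hM1) hA₁0)
      (mul_le_mul_of_nonneg_left (t4.trans hM1) hA₂0)) hC.le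
  have s3 : A₃ * (2 * M + 1) * Real.exp (M * (lam - 2 * h) / 2 + 5 * (ε * M)) ≤
      A₃ * (2 * (M + 1)) * E :=
    mul_le_mul (mul_le_mul_of_nonneg_left (by linarith) hA₃0) t5 (Real.exp_nonneg _)
      (by positivity)
  refine hmain.trans ((add_le_add (add_le_add t1 s1) (add_le_add s2 s3)).trans_eq ?_)
  ring

end GibbsSystem

theorem exists_rpow_decay_of_exp_scales {F : ℝ → ℝ} {lam c K : ℝ} {M₀ : ℕ} (hlam : 0 < lam)
    (hc : 0 < c) (hK : 0 ≤ K) (hF1 : ∀ ξ, F ξ ≤ 1)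
    (hF : ∀ M ≥ M₀, ∀ ξ : ℝ, Real.exp (4 * lam * M) ≤ ξ → ξ ≤ Real.exp (4 * lam * (M + 1)) →
      F ξ ≤ K * (M + 1) * Real.exp (-(c * M))) :
    ∃ η > (0 : ℝ), ∃ K' : ℝ, ∀ ξ : ℝ, 1 ≤ ξ → F ξ ≤ K' * ξ ^ (-η) := by
  refine ⟨c / (8 * lam), by positivity,
    K * (1 + 2 / c) * Real.exp (c / 2) + Real.exp (c / 2 * (M₀ + 1)), fun ξ hξ => ?_⟩
  have hξ0 : 0 < ξ := by linarith
  have hlog := Real.log_nonneg hξ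
  set M := ⌊Real.log ξ / (4 * lam)⌋₊ with hM
  have h1 : Real.exp (4 * lam * M) ≤ ξ := by
    rw [← Real.le_log_iff_exp_le hξ0, mul_comm, ← le_div_iff₀ (by positivity)]
    exact Nat.floor_le (by positivity)
  have h2' : Real.log ξ ≤ 4 * lam * (M + 1) := by
    rw [mul_comm, ← div_le_iff₀ (by positivity)]
    exact (Nat.lt_floor_add_one _).le
  have h2 : ξ ≤ Real.exp (4 * lam * (M + 1)) := (Real.log_le_iff_le_exp hξ0).1 h2'
  have h3 : Real.exp (-(c / 2 * (M + 1))) ≤ ξ ^ (-(c / (8 * lam))) := by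
    rw [Real.rpow_def_of_pos hξ0, Real.exp_le_exp]
    have : c / (8 * lam) * Real.log ξ ≤ c / (8 * lam) * (4 * lam * (M + 1)) := by gcongr
    have e : c / (8 * lam) * (4 * lam * (M + 1)) = c / 2 * (M + 1) := by field_simp; ring
    rw [e] at this
    linarith
  have hr : 0 < ξ ^ (-(c / (8 * lam))) := Real.rpow_pos_of_pos hξ0 _
  rw [add_mul]
  rcases le_or_gt M₀ M with hMM | hMM
  · refine le_trans ?_ (le_add_of_nonneg_right (by positivity))
    refine (hF M hMM ξ h1 h2).trans ?_
    have h4 : (M : ℝ) + 1 ≤ (1 + 2 / c) * Real.exp (c / 2 * M) := by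
      have e1 := Real.add_one_le_exp (c / 2 * M)
      have e2 : (1 : ℝ) ≤ Real.exp (c / 2 * M) := Real.one_le_exp (by positivity)
      have e3 : (M : ℝ) = 2 / c * (c / 2 * M) := by field_simp
      have e4 : 2 / c * (c / 2 * M) ≤ 2 / c * Real.exp (c / 2 * M) := by gcongr; linarith
      linarith
    calc K * (M + 1) * Real.exp (-(c * M))
        ≤ K * ((1 + 2 / c) * Real.exp (c / 2 * M)) * Real.exp (-(c * M)) := by gcongr
      _ = K * (1 + 2 / c) * (Real.exp (c / 2 * M) * Real.exp (-(c * M))) := by ring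
      _ = K * (1 + 2 / c) * (Real.exp (c / 2) * Real.exp (-(c / 2 * (M + 1)))) := by
          rw [← Real.exp_add, ← Real.exp_add]; congr 2; ring
      _ ≤ K * (1 + 2 / c) * (Real.exp (c / 2) * ξ ^ (-(c / (8 * lam)))) := by gcongr
      _ = _ := by ring
  · refine le_trans ?_ (le_add_of_nonneg_left (by positivity))
    refine (hF1 ξ).trans ?_
    calc (1 : ℝ) = Real.exp (c / 2 * (M₀ + 1)) * Real.exp (-(c / 2 * (M₀ + 1))) := by
          rw [← Real.exp_add]; simp
      _ ≤ Real.exp (c / 2 * (M₀ + 1)) * Real.exp (-(c / 2 * (M + 1))) := by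
          have : (M : ℝ) ≤ M₀ := by exact_mod_cast hMM.le
          gcongr
      _ ≤ _ := by gcongr

theorem norm_muFourier_neg (μ : Measure ℝ) (ξ : ℝ) : ‖muFourier μ (-ξ)‖ = ‖muFourier μ ξ‖ := by
  have : muFourier μ (-ξ) = starRingEnd ℂ (muFourier μ ξ) := by
    rw [muFourier, muFourier, ← integral_conj]
    congr 1
    ext x
    rw [← Complex.exp_conj]
    congr 1
    simp [Complex.conj_ofNat]
  rw [this, RCLike.norm_conj]

theorem norm_muFourier_le_one (μ : Measure ℝ) [IsProbabilityMeasure μ] (ξ : ℝ) :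
    ‖muFourier μ ξ‖ ≤ 1 := by
  refine (norm_integral_le_of_norm_le_const (C := 1) (Eventually.of_forall fun x => ?_)).trans ?_
  · rw [← Complex.ofReal_neg, Complex.norm_exp_ofReal_mul_I]
  · simp

/-- Any Gibbs measure for the Gauss map with a locally Hölder potential
`φ ≤ 0`, `P(φ) = 0`, `𝓛_φ 1 = 1`, satisfying the polynomial tail condition and with
Hausdorff dimension `h_μ/λ_μ > 1/2`, is a Rajchman measure with polynomially
decaying Fourier transform. -/
theorem gibbs_polynomial_fourier_decay
    (φ : ℝ → ℝ) (μ : MeasureTheory.Measure ℝ) [MeasureTheory.IsProbabilityMeasure μ]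
    (hμX : μ gaussSet = 1) (hinv : GaussInvariant μ)
    (hφH : LocHolder φ) (hφ0 : ∀ x ∈ gaussSet, φ x ≤ 0)
    (hP : HasPressure φ 0) (hL : TransferNormalized φ)
    (hGibbs : IsGibbs φ μ) (htail : PolyTail μ)
    (h : ℝ) (hent : HasEntropy μ h) (hdim : 1/2 < h / lyapunov μ) :
    ∃ η > (0:ℝ), ∃ K : ℝ, ∀ ξ : ℝ, 1 ≤ |ξ| →
      ‖muFourier μ ξ‖ ≤ K * |ξ| ^ (-η) := by
  obtain ⟨ψ, B, θ, C, G, hH⟩ := exists_gibbsSystem hμX hinv hφH hφ0 hL hGibbs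
  have hmom : ∃ β > (0 : ℝ), ∫⁻ x, ENNReal.ofReal ((cfDigit1 x : ℝ) ^ β) ∂μ < ⊤ := by
    obtain ⟨δ, hδ, K, hK⟩ := htail
    exact ⟨δ / 2, by positivity, lintegral_rpow_digit_lt_top G.ae_mem hδ hK⟩
  obtain ⟨β, hβ, hmom⟩ := hmom
  obtain ⟨ω, τ, Q, hTL⟩ := G.exists_tame_logAbsDerivGauss hβ hmom
  obtain ⟨ω', τ', Q', hTN⟩ := G.exists_tame_neg hH hβ hmom
  have hψi : Integrable ψ μ := by
    simpa using (G.integrable_observable hTN).neg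
  have hh : h = ∫ x, -ψ x ∂μ := by
    rw [integral_neg]; exact G.entropy_eq hψi hent
  have hlam0 : 0 ≤ lyapunov μ := integral_nonneg_of_ae (by
    filter_upwards [G.ae_mem] with x hx using logAbsDerivGauss_nonneg hx)
  have hlam : 0 < lyapunov μ := hlam0.lt_of_ne fun h0 => by
    rw [← h0, div_zero] at hdim
    norm_num at hdim
  have hdim' : lyapunov μ < 2 * h := by
    rw [lt_div_iff₀ hlam] at hdim
    linarith
  obtain ⟨c, hc, K, hK, M₀, hdec⟩ := G.exists_norm_integral_exp_le hlam hdim' (by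
    rw [hh]
    exact fun ε hε => G.exists_measureReal_typicalSet_compl_le hTL hTN hε)
  obtain ⟨η, hη, K', hbd⟩ := exists_rpow_decay_of_exp_scales (F := fun ξ => ‖muFourier μ ξ‖)
    hlam hc hK (norm_muFourier_le_one μ) hdec
  refine ⟨η, hη, K', fun ξ hξ => ?_⟩
  rcases abs_choice ξ with h0 | h0
  · simpa only [h0] using hbd _ hξ
  · simpa only [h0, norm_muFourier_neg] using hbd _ hξ
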